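/- Let n ∈ ℕ, let C_nuc_n be the class of separable unital C*-algebras D with nuclear dimension dim_nuc(D) ≤ n, let A be a separable unital C*-algebra which is a unital local C_nuc_n-algebra, and let α : G → Aut(A) be an action of a finite group G with the Rokhlin property. Then the fixed point algebra A^α satisfies dim_nuc(A^α) ≤ n. -/

import Mathlib

noncomputable section
set_option linter.unusedSectionVars false

open scoped ComplexOrder Matrix.Norms.L2Operator
open Filter Topology

/-- An element of a `*`-ring is *positive* (in the C*-algebraic sense) if it has the
form `star y * y`. -/
def IsPosElem {R : Type*} [Mul R] [Star R] (a : R) : Prop :=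
  ∃ y : R, a = star y * y

/-- A linear functional on a unital complex `*`-algebra is a *tracial state* if it is unital,
positive and tracial. -/
def IsTracialState {R : Type*} [Ring R] [StarRing R] [Module ℂ R] (τ : R →ₗ[ℂ] ℂ) : Prop :=
  τ 1 = 1 ∧ (∀ x : R, 0 ≤ τ (star x * x)) ∧ ∀ a b : R, τ (a * b) = τ (b * a)

/-- A linear map between complex `*`-algebras is *completely positive* if all of its matrix
amplifications map positive elements to positive elements. -/
def IsCompletelyPositive {A B : Type*} [Ring A] [StarRing A] [Module ℂ A]
    [Ring B] [StarRing B] [Module ℂ B] (φ : A →ₗ[ℂ] B) : Prop :=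
  ∀ (k : ℕ) (x : Matrix (Fin k) (Fin k) A), IsPosElem x → IsPosElem (x.map φ)

/-- A map has *order zero* on a subset if it preserves orthogonality there. -/
def OrderZeroOn {F D : Type*} [Mul F] [Zero F] [Mul D] [Zero D] (φ : F → D) (s : Set F) : Prop :=
  ∀ e ∈ s, ∀ f ∈ s, e * f = 0 → f * e = 0 → φ e * φ f = 0 ∧ φ f * φ e = 0

/-- The finite-dimensional C*-algebra `⊕_{i=1}^s M_{r i}(ℂ)`. -/
abbrev FDBlock (s : ℕ) (r : Fin s → ℕ) : Type :=
  ∀ i : Fin s, Matrix (Fin (r i)) (Fin (r i)) ℂ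

/-- The elements of `⊕_{i=1}^s M_{r i}(ℂ)` supported on the blocks with label `j`. -/
def blockSupp {s : ℕ} {r : Fin s → ℕ} {n : ℕ} (J : Fin s → Fin (n + 1)) (j : Fin (n + 1)) :
    Set (FDBlock s r) :=
  {x | ∀ i : Fin s, J i ≠ j → x i = 0}

/-- `DecompositionRankLE n D` : the C*-algebra `D` has decomposition rank at most `n`. -/
def DecompositionRankLE (n : ℕ) (D : Type*) [NormedRing D] [StarRing D]
    [NormedAlgebra ℂ D] : Prop :=
  ∀ (S : Finset D) (ε : ℝ), 0 < ε →
    ∃ (s : ℕ) (r : Fin s → ℕ) (J : Fin s → Fin (n + 1))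
      (ψ : D →ₗ[ℂ] FDBlock s r) (φ : FDBlock s r →ₗ[ℂ] D),
      IsCompletelyPositive ψ ∧ IsCompletelyPositive φ ∧
      (∀ a : D, ‖ψ a‖ ≤ ‖a‖) ∧ (∀ x : FDBlock s r, ‖φ x‖ ≤ ‖x‖) ∧
      (∀ j : Fin (n + 1), OrderZeroOn φ (blockSupp J j)) ∧
      ∀ a ∈ S, ‖φ (ψ a) - a‖ < ε

/-- `NuclearDimensionLE n D` : the C*-algebra `D` has nuclear dimension at most `n`. -/
def NuclearDimensionLE (n : ℕ) (D : Type*) [NormedRing D] [StarRing D]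
    [NormedAlgebra ℂ D] : Prop :=
  ∀ (S : Finset D) (ε : ℝ), 0 < ε →
    ∃ (s : ℕ) (r : Fin s → ℕ) (J : Fin s → Fin (n + 1))
      (ψ : D →ₗ[ℂ] FDBlock s r) (φ : FDBlock s r →ₗ[ℂ] D),
      IsCompletelyPositive ψ ∧ IsCompletelyPositive φ ∧
      (∀ a : D, ‖ψ a‖ ≤ ‖a‖) ∧
      (∀ j : Fin (n + 1), (∀ x ∈ blockSupp J j, ‖φ x‖ ≤ ‖x‖) ∧
        OrderZeroOn φ (blockSupp J j)) ∧
      ∀ a ∈ S, ‖φ (ψ a) - a‖ < ε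

/-- A bundled unital C*-algebra. -/
structure CStarAlg : Type 1 where
  carrier : Type
  [str : CStarAlgebra carrier]

attribute [instance] CStarAlg.str

/-- The *finite saturation* of a class `𝒞` of unital C*-algebras: the smallest class
containing `𝒞` which is closed under isomorphism, finite direct sums, matrix amplifications
and corners by nonzero projections. -/
inductive FinSat (𝒞 : CStarAlg → Prop) : CStarAlg → Prop
  | base {B : CStarAlg} : 𝒞 B → FinSat 𝒞 B
  | iso {B B' : CStarAlg} : FinSat 𝒞 B → Nonempty (B'.carrier ≃⋆ₐ[ℂ] B.carrier) →
      FinSat 𝒞 B'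
  | sum {B₁ B₂ B : CStarAlg} : FinSat 𝒞 B₁ → FinSat 𝒞 B₂ →
      Nonempty (B.carrier ≃⋆ₐ[ℂ] (B₁.carrier × B₂.carrier)) → FinSat 𝒞 B
  | matrix {B B' : CStarAlg} (k : ℕ) : FinSat 𝒞 B →
      Nonempty (B'.carrier ≃⋆ₐ[ℂ] Matrix (Fin (k + 1)) (Fin (k + 1)) B.carrier) →
      FinSat 𝒞 B'
  | corner {B B' : CStarAlg} (p : B.carrier) : FinSat 𝒞 B → p ≠ 0 → p * p = p →
      star p = p →
      (∃ ι : B'.carrier →⋆ₙₐ[ℂ] B.carrier, Function.Injective ι ∧ ι 1 = p ∧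
        Set.range ι = {x : B.carrier | p * x * p = x}) →
      FinSat 𝒞 B'

/-- `A` is a *unital local `𝒞`-algebra*. -/
def IsUnitalLocalAlg (𝒞 : CStarAlg → Prop) (A : Type*) [NormedRing A] [StarRing A]
    [NormedAlgebra ℂ A] : Prop :=
  ∀ (S : Finset A) (ε : ℝ), 0 < ε →
    ∃ B : CStarAlg, FinSat 𝒞 B ∧
      ∃ φ : B.carrier →⋆ₐ[ℂ] A, ∀ a ∈ S, ∃ b : B.carrier, ‖a - φ b‖ < ε

/-- The class of separable unital C*-algebras with decomposition rank at most `n`. -/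
def drClass (n : ℕ) : CStarAlg → Prop :=
  fun B => TopologicalSpace.SeparableSpace B.carrier ∧ DecompositionRankLE n B.carrier

/-- The class of separable unital C*-algebras with nuclear dimension at most `n`. -/
def nucClass (n : ℕ) : CStarAlg → Prop :=
  fun B => TopologicalSpace.SeparableSpace B.carrier ∧ NuclearDimensionLE n B.carrier

/-- The class of separable unital C*-algebras with finite nuclear dimension. -/
def lnucClass : CStarAlg → Prop :=
  fun B => TopologicalSpace.SeparableSpace B.carrier ∧ ∃ n : ℕ, NuclearDimensionLE n B.carrier

/-- A separable unital C*-algebra has *locally finite nuclear dimension* if it is a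
unital local `C_lnuc`-algebra. -/
def HasLocallyFiniteNuclearDimension (A : Type*) [NormedRing A] [StarRing A]
    [NormedAlgebra ℂ A] : Prop :=
  IsUnitalLocalAlg lnucClass A
/-! ### Group actions and the Rokhlin property -/

/-- `α : G → (A →⋆ₐ[ℂ] A)` is an action of the group `G` on `A` by *-automorphisms. -/
def IsGroupAction {G A : Type*} [Group G] [CStarAlgebra A] (α : G → (A →⋆ₐ[ℂ] A)) : Prop :=
  (∀ a : A, α 1 a = a) ∧ ∀ (g h : G) (a : A), α g (α h a) = α (g * h) a

/-- The fixed point algebra `A^α` of an action, as a star subalgebra of `A`. -/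
def fixedPointAlgebra {G A : Type*} [Group G] [CStarAlgebra A] (α : G → (A →⋆ₐ[ℂ] A)) :
    StarSubalgebra ℂ A where
  carrier := {a : A | ∀ g : G, α g a = a}
  mul_mem' := fun {a} {b} ha hb g => by rw [map_mul, ha g, hb g]
  add_mem' := fun {a} {b} ha hb g => by rw [map_add, ha g, hb g]
  algebraMap_mem' := fun c g => by rw [AlgHomClass.commutes]
  star_mem' := fun {a} ha g => by rw [map_star, ha g]

/-- The Rokhlin property for a finite group action, expressed in terms of representing
sequences for projections in `A_∞ = (ℓ^∞(ℕ,A)/c₀(ℕ,A)) ∩ A'`. -/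
def ActionHasRokhlin {G A : Type*} [Group G] [Fintype G] [CStarAlgebra A]
    (α : G → (A →⋆ₐ[ℂ] A)) : Prop :=
  ∃ e : G → ℕ → A,
    (∀ g, ∃ M : ℝ, ∀ k, ‖e g k‖ ≤ M) ∧
    (∀ g, Tendsto (fun k => ‖e g k * e g k - e g k‖) atTop (𝓝 0)) ∧
    (∀ g, Tendsto (fun k => ‖star (e g k) - e g k‖) atTop (𝓝 0)) ∧
    (∀ g (a : A), Tendsto (fun k => ‖e g k * a - a * e g k‖) atTop (𝓝 0)) ∧
    Tendsto (fun k => ‖(∑ g : G, e g k) - 1‖) atTop (𝓝 0) ∧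
    (∀ g h, Tendsto (fun k => ‖α g (e h k) - e (g * h) k‖) atTop (𝓝 0))

/-! ### Inclusions of unital C*-algebras, conditional expectations, Watatani index -/

variable {P A : Type*}

/-- `E : A →ₗ[ℂ] P` is a conditional expectation onto the subalgebra `P` (included in `A`
via the injective unital *-homomorphism `ι`). -/
structure IsCondExpect [CStarAlgebra P] [CStarAlgebra A] (ι : P →⋆ₐ[ℂ] A)
    (E : A →ₗ[ℂ] P) : Prop where
  restricts : ∀ p : P, E (ι p) = p
  pos : ∀ x : A, IsPosElem (E (star x * x))
  bimodule : ∀ (p q : P) (x : A), E (ι p * x * ι q) = p * E x * q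

/-- `{(u i, v i)}` is a quasi-basis for the conditional expectation `E`; the existence of a
quasi-basis says precisely that `E` is of index-finite type. -/
def IsQuasiBasis [CStarAlgebra P] [CStarAlgebra A] (ι : P →⋆ₐ[ℂ] A) (E : A →ₗ[ℂ] P)
    {m : ℕ} (u v : Fin m → A) : Prop :=
  ∀ a : A, (a = ∑ i, u i * ι (E (v i * a))) ∧ (a = ∑ i, ι (E (a * u i)) * v i)

/-- The Rokhlin property for a conditional expectation of index-finite type with index
`ind = ∑ u i * v i` : there is a projection `e` in `A_∞ = (ℓ^∞(ℕ,A)/c₀(ℕ,A)) ∩ A'`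
(given by a representing sequence) with `E^∞(e) = (Index E)⁻¹ · 1` such that `x ↦ x e`
is injective on `A`. -/
def CondExpectHasRokhlin [CStarAlgebra P] [CStarAlgebra A] (ι : P →⋆ₐ[ℂ] A)
    (E : A →ₗ[ℂ] P) (ind : A) : Prop :=
  ∃ e : ℕ → A,
    (∃ M : ℝ, ∀ k, ‖e k‖ ≤ M) ∧
    Tendsto (fun k => ‖e k * e k - e k‖) atTop (𝓝 0) ∧
    Tendsto (fun k => ‖star (e k) - e k‖) atTop (𝓝 0) ∧
    (∀ a : A, Tendsto (fun k => ‖e k * a - a * e k‖) atTop (𝓝 0)) ∧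
    (∃ w : A, w * ind = 1 ∧ ind * w = 1 ∧
      Tendsto (fun k => ‖ι (E (e k)) - w‖) atTop (𝓝 0)) ∧
    (∀ x : A, Tendsto (fun k => ‖x * e k‖) atTop (𝓝 0) → x = 0)

/-! ### Cuntz comparison, dimension functions, strict comparison, almost divisibility -/

/-- Cuntz subequivalence for positive matrices over a C*-algebra (the topology on matrices
over a C*-algebra is the norm topology, which agrees with the product topology). -/
def CuntzSub {R : Type*} [NonUnitalNonAssocSemiring R] [Star R] [TopologicalSpace R]
    {m k : Type*} [Fintype m] [Fintype k] (a : Matrix m m R) (b : Matrix k k R) : Prop :=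
  ∃ v : ℕ → Matrix m k R, Tendsto (fun j => v j * b * (v j).conjTranspose) atTop (𝓝 a)

/-- `matNthRoot a j` is the (unique, if it exists) positive `j`-th root `a^{1/j}` of a
positive matrix `a` over a C*-algebra. -/
def matNthRoot {R : Type*} [Ring R] [StarRing R] {m : Type*} [Fintype m] [DecidableEq m]
    (a : Matrix m m R) (j : ℕ) : Matrix m m R :=
  open scoped Classical in
  if h : ∃ b : Matrix m m R, IsPosElem b ∧ b ^ j = a then h.choose else 0

/-- The standard extension `τ ⊗ Tr` of a functional `τ` to matrices. -/
def traceExt {R : Type*} [Ring R] [Module ℂ R] {m : Type*} [Fintype m]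
    (τ : R →ₗ[ℂ] ℂ) (x : Matrix m m R) : ℂ :=
  ∑ i, τ (x i i)

/-- The dimension function `d_τ(a) = lim_{n → ∞} τ(a^{1/n})` associated to a tracial
state `τ` (the limit exists, so it agrees with the `limsup` used here). -/
def dimFun {R : Type*} [Ring R] [StarRing R] [Module ℂ R] {m : Type*} [Fintype m]
    [DecidableEq m] (τ : R →ₗ[ℂ] ℂ) (a : Matrix m m R) : ℝ :=
  Filter.limsup (fun j : ℕ => (traceExt τ (matNthRoot a (j + 1))).re) atTop

/-- A unital C*-algebra `R` has *strict comparison* (of positive elements, with respect to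
tracial states) if `d_τ(a) < d_τ(b)` for all tracial states `τ` implies `a ≾ b`. -/
def HasStrictComparison (R : Type*) [Ring R] [StarRing R] [Module ℂ R]
    [TopologicalSpace R] : Prop :=
  ∀ (m k : ℕ) (a : Matrix (Fin m) (Fin m) R) (b : Matrix (Fin k) (Fin k) R),
    IsPosElem a → IsPosElem b →
    (∀ τ : R →ₗ[ℂ] ℂ, IsTracialState τ → dimFun τ a < dimFun τ b) →
    CuntzSub a b

/-- The Cuntz semigroup `W(R)` is *almost divisible*: for every positive contraction `a`
over `R` and every `k ≠ 0` there is `x = ⟨c⟩ ∈ W(R)` with `k ⬝ x ≤ ⟨a⟩ ≤ (k+1) ⬝ x`. -/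
def AlmostDivisible (R : Type*) [Ring R] [StarRing R] [TopologicalSpace R] : Prop :=
  ∀ (m : ℕ) (a : Matrix (Fin m) (Fin m) R),
    IsPosElem a → IsPosElem ((1 : Matrix (Fin m) (Fin m) R) - a) →
    ∀ k : ℕ, k ≠ 0 →
      ∃ (l : ℕ) (c : Matrix (Fin l) (Fin l) R), IsPosElem c ∧
        CuntzSub (Matrix.blockDiagonal fun _ : Fin k => c) a ∧
        CuntzSub a (Matrix.blockDiagonal fun _ : Fin (k + 1) => c)

/-- A unital C*-algebra is *pure* if it has strict comparison and almost divisible Cuntz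
semigroup. -/
def IsPure (R : Type*) [Ring R] [StarRing R] [Module ℂ R] [TopologicalSpace R] : Prop :=
  HasStrictComparison R ∧ AlmostDivisible R

/-- The order on projections over `R` is determined by traces. -/
def ProjOrderDeterminedByTraces (R : Type*) [Ring R] [StarRing R] [Module ℂ R] : Prop :=
  ∀ (k l : ℕ) (p : Matrix (Fin k) (Fin k) R) (q : Matrix (Fin l) (Fin l) R),
    p * p = p → star p = p → q * q = q → star q = q →
    (∀ τ : R →ₗ[ℂ] ℂ, IsTracialState τ → (traceExt τ p).re < (traceExt τ q).re) →
    ∃ v : Matrix (Fin l) (Fin k) R,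
      v.conjTranspose * v = p ∧ IsPosElem (q - v * v.conjTranspose)

/-- A unital C*-algebra has stable rank one if its invertible elements are dense. -/
def HasStableRankOne (R : Type*) [Ring R] [TopologicalSpace R] : Prop :=
  Dense {x : R | IsUnit x}

/-- A unital C*-algebra is simple if it has no nontrivial closed two-sided ideals. -/
def IsSimpleCStarAlgebra (A : Type*) [CStarAlgebra A] : Prop :=
  ∀ I : TwoSidedIdeal A, IsClosed (I : Set A) → I = ⊥ ∨ I = ⊤
/-! ### Corners `pRp` by a projection `p` -/

section CornerSection

variable {R : Type*} [Ring R] [StarRing R] [Algebra ℂ R] [StarModule ℂ R]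

/-- The corner `p R p` of a unital C*-algebra `R` by a projection `p`, as a unital
`*`-algebra with unit `p`. -/
def Corner (p : R) (_hp : p * p = p) (_hsp : star p = p) : Type _ :=
  {x : R // p * x * p = x}

namespace Corner

variable {p : R} {hp : p * p = p} {hsp : star p = p}

theorem mem_mul_left (hp : p * p = p) {x : R} (hx : p * x * p = x) : p * x = x := by
  conv_lhs => rw [← hx]
  simp only [← mul_assoc]
  rw [hp, hx]

theorem mem_mul_right (hp : p * p = p) {x : R} (hx : p * x * p = x) : x * p = x := by
  conv_lhs => rw [← hx]
  rw [mul_assoc, mul_assoc, hp, ← mul_assoc, hx]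

instance : Add (Corner p hp hsp) :=
  ⟨fun x y => ⟨x.1 + y.1, by rw [mul_add, add_mul, x.2, y.2]⟩⟩

instance : Zero (Corner p hp hsp) :=
  ⟨⟨0, by rw [mul_zero, zero_mul]⟩⟩

instance : Neg (Corner p hp hsp) :=
  ⟨fun x => ⟨-x.1, by rw [mul_neg, neg_mul, x.2]⟩⟩

instance : Mul (Corner p hp hsp) :=
  ⟨fun x y => ⟨x.1 * y.1, by
    rw [← mul_assoc p x.1 y.1, mem_mul_left hp x.2, mul_assoc x.1 y.1 p,
      mem_mul_right hp y.2]⟩⟩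

instance : One (Corner p hp hsp) :=
  ⟨⟨p, by rw [hp, hp]⟩⟩

instance : SMul ℂ (Corner p hp hsp) :=
  ⟨fun c x => ⟨c • x.1, by rw [mul_smul_comm, smul_mul_assoc, x.2]⟩⟩

instance : Star (Corner p hp hsp) :=
  ⟨fun x => ⟨star x.1, by
    conv_rhs => rw [← x.2]
    rw [star_mul, star_mul, hsp, ← mul_assoc]⟩⟩

@[simp] theorem val_add (x y : Corner p hp hsp) : (x + y).1 = x.1 + y.1 := rfl
@[simp] theorem val_mul (x y : Corner p hp hsp) : (x * y).1 = x.1 * y.1 := rfl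
@[simp] theorem val_zero : (0 : Corner p hp hsp).1 = 0 := rfl
@[simp] theorem val_one : (1 : Corner p hp hsp).1 = p := rfl
@[simp] theorem val_neg (x : Corner p hp hsp) : (-x).1 = -x.1 := rfl
@[simp] theorem val_smul (c : ℂ) (x : Corner p hp hsp) : (c • x).1 = c • x.1 := rfl
@[simp] theorem val_star (x : Corner p hp hsp) : (star x).1 = star x.1 := rfl

instance instRing : Ring (Corner p hp hsp) where
  add_assoc x y z := Subtype.ext <| by simp [add_assoc]
  zero_add x := Subtype.ext <| by simp
  add_zero x := Subtype.ext <| by simp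
  add_comm x y := Subtype.ext <| by simp [add_comm]
  neg_add_cancel x := Subtype.ext <| by simp
  nsmul := nsmulRec
  zsmul := zsmulRec
  mul_assoc x y z := Subtype.ext <| by simp [mul_assoc]
  one_mul x := Subtype.ext <| by simpa using mem_mul_left hp x.2
  mul_one x := Subtype.ext <| by simpa using mem_mul_right hp x.2
  left_distrib x y z := Subtype.ext <| by simp [left_distrib]
  right_distrib x y z := Subtype.ext <| by simp [right_distrib]
  zero_mul x := Subtype.ext <| by simp
  mul_zero x := Subtype.ext <| by simp

instance instStarRing : StarRing (Corner p hp hsp) where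
  star_involutive x := Subtype.ext <| by simp
  star_mul x y := Subtype.ext <| by simp
  star_add x y := Subtype.ext <| by simp

instance instModule : Module ℂ (Corner p hp hsp) where
  one_smul x := Subtype.ext <| by simp
  mul_smul c d x := Subtype.ext <| by simp [mul_smul]
  smul_zero c := Subtype.ext <| by simp
  smul_add c x y := Subtype.ext <| by simp
  add_smul c d x := Subtype.ext <| by simp [add_smul]
  zero_smul x := Subtype.ext <| by simp

instance instTop [TopologicalSpace R] : TopologicalSpace (Corner p hp hsp) :=
  instTopologicalSpaceSubtype

end Corner

end CornerSection

/-! ### Sequence algebras: `A^∞ = ℓ^∞(ℕ, A)/c₀(ℕ, A)` via representing sequences -/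

/-- A sequence in a normed space is null (i.e. lies in `c₀(ℕ, A)`). -/
def IsNullSeq {A : Type*} [Norm A] (x : ℕ → A) : Prop :=
  Tendsto (fun n => ‖x n‖) atTop (𝓝 0)

/-- A sequence in a normed space is bounded (i.e. lies in `ℓ^∞(ℕ, A)`). -/
def IsBddSeq {A : Type*} [Norm A] (x : ℕ → A) : Prop :=
  ∃ M : ℝ, ∀ n, ‖x n‖ ≤ M

/-- A linear map `β : A →ₗ[ℂ] ℓ^∞(ℕ, P)` represents a unital *-homomorphism
`A → P^∞ = ℓ^∞(ℕ, P)/c₀(ℕ, P)` : it takes values in bounded sequences and is unital,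
multiplicative and star-preserving modulo `c₀(ℕ, P)`. -/
structure RepresentsHomToSeqAlg {A P : Type*} [CStarAlgebra A] [CStarAlgebra P]
    (β : A →ₗ[ℂ] (ℕ → P)) : Prop where
  bdd : ∀ x : A, IsBddSeq (β x)
  unital : IsNullSeq (β 1 - 1)
  mul : ∀ x y : A, IsNullSeq (β (x * y) - β x * β y)
  star : ∀ x : A, IsNullSeq (β (star x) - star (β x))

/-- A Banach limit: a linear functional on (bounded) complex sequences which is unital,
shift-invariant, positive and bounded. -/
structure IsBanachLimit (L : (ℕ → ℂ) →ₗ[ℂ] ℂ) : Prop where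
  unital : L 1 = 1
  shift : ∀ x : ℕ → ℂ, IsBddSeq x → L (fun n => x (n + 1)) = L x
  pos : ∀ x : ℕ → ℂ, IsBddSeq x → (∀ n, 0 ≤ x n) → 0 ≤ L x
  norm_le : ∀ (x : ℕ → ℂ) (M : ℝ), (∀ n, ‖x n‖ ≤ M) → ‖L x‖ ≤ M

/-- A C*-algebra is *exact* iff it is nuclearly embeddable (Kirchberg): it admits a faithful
representation `π : A → B(H)` which approximately factors through matrix algebras by
completely positive contractions in the point-norm topology. -/
def IsExactCStar (A : Type*) [CStarAlgebra A] : Prop :=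
  ∃ (H : Type) (_ : NormedAddCommGroup H) (_ : InnerProductSpace ℂ H) (_ : CompleteSpace H)
    (π : A →⋆ₐ[ℂ] (H →L[ℂ] H)), Function.Injective π ∧
      ∀ (S : Finset A) (ε : ℝ), 0 < ε →
        ∃ (k : ℕ) (ψ : A →ₗ[ℂ] Matrix (Fin k) (Fin k) ℂ)
          (φ : Matrix (Fin k) (Fin k) ℂ →ₗ[ℂ] (H →L[ℂ] H)),
          IsCompletelyPositive ψ ∧ IsCompletelyPositive φ ∧
          (∀ a : A, ‖ψ a‖ ≤ ‖a‖) ∧ (∀ x, ‖φ x‖ ≤ ‖x‖) ∧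
          ∀ a ∈ S, ‖φ (ψ a) - π a‖ < ε

section
set_option linter.style.haveILetI false
set_option linter.unusedSectionVars false
open scoped ComplexOrder Matrix.Norms.L2Operator
open Filter Topology

theorem isPosElem_iff {D : Type*} [CStarAlgebra D] [PartialOrder D] [StarOrderedRing D] (a : D) :
    IsPosElem a ↔ 0 ≤ a := by
  rw [CStarAlgebra.nonneg_iff_eq_star_mul_self]; rfl

theorem IsPosElem.add {D : Type*} [CStarAlgebra D] {a b : D} (ha : IsPosElem a)
    (hb : IsPosElem b) : IsPosElem (a + b) := by
  letI := CStarAlgebra.spectralOrder D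
  haveI := CStarAlgebra.spectralOrderedRing D
  rw [isPosElem_iff] at *
  exact add_nonneg ha hb

theorem isPosElem_zero {R : Type*} [NonUnitalNonAssocSemiring R] [StarRing R] :
    IsPosElem (0 : R) := ⟨0, by simp⟩

theorem IsPosElem.mat_add {D m : Type*} [CStarAlgebra D] [Fintype m]
    {a b : Matrix m m D} (ha : IsPosElem a)
    (hb : IsPosElem b) : IsPosElem (a + b) := by
  classical
  letI := CStarAlgebra.spectralOrder D
  haveI := CStarAlgebra.spectralOrderedRing D
  exact IsPosElem.add (D := CStarMatrix m m D) ha hb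

theorem IsPosElem.mat_sum {D m L : Type*} [CStarAlgebra D] [Fintype m]
    (s : Finset L) {a : L → Matrix m m D} (ha : ∀ l ∈ s, IsPosElem (a l)) :
    IsPosElem (∑ l ∈ s, a l) := by
  classical
  induction s using Finset.induction_on with
  | empty => exact isPosElem_zero
  | insert i s hi ih =>
    rw [Finset.sum_insert hi]
    exact IsPosElem.mat_add (ha _ (by simp)) (ih fun l hl => ha l (by simp [hl]))

theorem pos_of_gram {D m L : Type*} [CStarAlgebra D] [Fintype m] [Fintype L]
    (x : Matrix m m D) (w : L → m → D) (h : ∀ i j, x i j = ∑ l, star (w l i) * w l j) :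
    IsPosElem x := by
  classical
  have : x = ∑ l, Matrix.of (fun i j => star (w l i) * w l j) := by
    ext i j; rw [h, Matrix.sum_apply]; rfl
  rw [this]
  refine IsPosElem.mat_sum _ fun l _ => ?_
  rcases isEmpty_or_nonempty m with hm | ⟨⟨i0⟩⟩
  · exact ⟨0, by ext i; exact hm.elim i⟩
  · refine ⟨Matrix.of fun a j => if a = i0 then w l j else 0, ?_⟩
    ext i j
    simp [Matrix.mul_apply, Matrix.star_apply]

theorem gram_of_pos {R m : Type*} [Ring R] [StarRing R] [Fintype m]
    {x : Matrix m m R} (h : IsPosElem x) :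
    ∃ w : m → m → R, ∀ i j, x i j = ∑ l, star (w l i) * w l j := by
  obtain ⟨y, rfl⟩ := h
  exact ⟨y, fun i j => by simp [Matrix.mul_apply, Matrix.star_apply]⟩

/-- flattening -/
theorem pos_of_gram_mat {D m ι L : Type*} [CStarAlgebra D] [Fintype m] [Fintype ι] [Fintype L]
    (x : Matrix m m (Matrix ι ι D)) (w : L → m → ι → D)
    (h : ∀ p q i j, x p q i j = ∑ l, star (w l p i) * w l q j) :
    IsPosElem x := by
  classical
  obtain ⟨y, hy⟩ := pos_of_gram (Matrix.comp m m ι ι D x) (fun l pi => w l pi.1 pi.2)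
    (fun i j => h _ _ _ _)
  refine ⟨(Matrix.comp m m ι ι D).symm y, ?_⟩
  ext p q i j
  have := congrFun (congrFun hy (p, i)) (q, j)
  simp only [Matrix.comp_apply] at this
  rw [this]
  simp [Matrix.mul_apply, Matrix.star_apply, Matrix.sum_apply, Fintype.sum_prod_type]

theorem gram_mat_of_pos {R m ι : Type*} [Ring R] [StarRing R] [Fintype m] [Fintype ι]
    {x : Matrix m m (Matrix ι ι R)} (h : IsPosElem x) :
    ∃ w : (m × ι) → m → ι → R, ∀ p q i j, x p q i j = ∑ l, star (w l p i) * w l q j := by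
  obtain ⟨y, rfl⟩ := h
  refine ⟨fun l p i => y l.1 p l.2 i, fun p q i j => ?_⟩
  simp [Matrix.mul_apply, Matrix.star_apply, Matrix.sum_apply, Fintype.sum_prod_type]

section CP
variable {B C D : Type*} [CStarAlgebra B] [CStarAlgebra C] [CStarAlgebra D]

theorem IsCompletelyPositive.fintype {R S : Type*} [Ring R] [StarRing R] [Module ℂ R]
    [Ring S] [StarRing S] [Module ℂ S] {φ : R →ₗ[ℂ] S} (h : IsCompletelyPositive φ)
    {m : Type*} [Fintype m] {x : Matrix m m R} (hx : IsPosElem x) : IsPosElem (x.map φ) := by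
  let e := Fintype.equivFin m
  have h1 : IsPosElem (x.submatrix e.symm e.symm) := by
    obtain ⟨y, rfl⟩ := hx
    refine ⟨y.submatrix e.symm e.symm, ?_⟩
    simp [Matrix.star_eq_conjTranspose, Matrix.conjTranspose_submatrix, Matrix.submatrix_mul_equiv]
  obtain ⟨y, hy⟩ := h _ _ h1
  refine ⟨y.submatrix e e, ?_⟩
  have : x.map φ = ((x.submatrix e.symm e.symm).map φ).submatrix e e := by
    ext i j; simp
  rw [this, hy]
  simp [Matrix.star_eq_conjTranspose, Matrix.conjTranspose_submatrix, Matrix.submatrix_mul_equiv]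

/-- CP maps on a Gram family -/
theorem IsCompletelyPositive.gram {R S : Type*} [CStarAlgebra R]
    [Ring S] [StarRing S] [Module ℂ S] {φ : R →ₗ[ℂ] S} (h : IsCompletelyPositive φ)
    {m L : Type*} [Fintype m] [Fintype L] (w : L → m → R) :
    ∃ v : m → m → S, ∀ i j, φ (∑ l, star (w l i) * w l j) = ∑ l, star (v l i) * v l j := by
  have := h.fintype (pos_of_gram (Matrix.of fun i j => ∑ l, star (w l i) * w l j) w
    (fun i j => rfl))
  obtain ⟨v, hv⟩ := gram_of_pos this
  exact ⟨v, fun i j => hv i j⟩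

theorem cp_of_gram {R : Type*} [Ring R] [StarRing R] [Module ℂ R] (φ : R →ₗ[ℂ] D)
    (h : ∀ (k : ℕ) (w : Fin k → Fin k → R), ∃ (L : Type) (_ : Fintype L) (v : L → Fin k → D),
      ∀ i j, φ (∑ l, star (w l i) * w l j) = ∑ l, star (v l i) * v l j) :
    IsCompletelyPositive φ := by
  intro k x hx
  obtain ⟨w, hw⟩ := gram_of_pos hx
  obtain ⟨L, _, v, hv⟩ := h k w
  exact pos_of_gram _ v fun i j => by rw [Matrix.map_apply, hw, hv]

/-- Gram criterion for maps into matrices. -/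
theorem cp_of_gram_mat {R ι : Type*} [Fintype ι] [DecidableEq ι] [Ring R] [StarRing R] [Module ℂ R]
    (φ : R →ₗ[ℂ] Matrix ι ι D)
    (h : ∀ (k : ℕ) (w : Fin k → Fin k → R), ∃ (L : Type) (_ : Fintype L) (v : L → Fin k → ι → D),
      ∀ p q i j, φ (∑ l, star (w l p) * w l q) i j = ∑ l, star (v l p i) * v l q j) :
    IsCompletelyPositive φ := by
  intro k x hx
  obtain ⟨w, hw⟩ := gram_of_pos hx
  obtain ⟨L, _, v, hv⟩ := h k w
  exact pos_of_gram_mat _ v fun p q i j => by rw [Matrix.map_apply, hw, hv]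

theorem IsCompletelyPositive.comp {R S T : Type*} [Ring R] [StarRing R] [Module ℂ R]
    [Ring S] [StarRing S] [Module ℂ S] [Ring T] [StarRing T] [Module ℂ T]
    {φ : R →ₗ[ℂ] S} {ψ : S →ₗ[ℂ] T} (hψ : IsCompletelyPositive ψ)
    (hφ : IsCompletelyPositive φ) : IsCompletelyPositive (ψ ∘ₗ φ) := by
  intro k x hx
  have := hψ k _ (hφ k x hx)
  rwa [Matrix.map_map] at this

theorem cp_of_hom {R S : Type*} [Ring R] [StarRing R] [Module ℂ R]
    [Ring S] [StarRing S] [Module ℂ S] (φ : R →ₗ[ℂ] S)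
    (hm : ∀ x y, φ (x * y) = φ x * φ y) (hs : ∀ x, φ (star x) = star (φ x)) :
    IsCompletelyPositive φ := by
  rintro k _ ⟨y, rfl⟩
  refine ⟨y.map φ, ?_⟩
  ext i j
  simp [Matrix.mul_apply, Matrix.star_apply, hm, hs]

/-- `x ↦ v* x v` -/
def conjL {R : Type*} [CStarAlgebra R] (v : R) : R →ₗ[ℂ] R :=
  LinearMap.mulLeft ℂ (star v) ∘ₗ LinearMap.mulRight ℂ v

theorem conjL_apply {R : Type*} [CStarAlgebra R] (v x : R) : conjL v x = star v * x * v := by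
  simp [conjL, mul_assoc]

theorem cp_conjL {R : Type*} [CStarAlgebra R] (v : R) : IsCompletelyPositive (conjL v) := by
  refine cp_of_gram _ fun k w => ⟨Fin k, inferInstance, fun l j => w l j * v, fun i j => ?_⟩
  rw [conjL_apply, Finset.mul_sum, Finset.sum_mul]
  simp [mul_assoc]

theorem cp_add {R : Type*} [Ring R] [StarRing R] [Module ℂ R] {φ ψ : R →ₗ[ℂ] D}
    (h1 : IsCompletelyPositive φ) (h2 : IsCompletelyPositive ψ) :
    IsCompletelyPositive (φ + ψ) := by
  intro k x hx
  have := (h1 k x hx).mat_add (h2 k x hx)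
  convert this using 1; ext i j; simp

theorem cp_zero {R S : Type*} [Ring R] [StarRing R] [Module ℂ R]
    [Ring S] [StarRing S] [Module ℂ S]  :
    IsCompletelyPositive (0 : R →ₗ[ℂ] S) := by
  intro k x hx
  have : x.map (0 : R →ₗ[ℂ] S) = 0 := by ext; simp
  rw [this]; exact isPosElem_zero

theorem cp_sum {R K : Type*} [Ring R] [StarRing R] [Module ℂ R] {φ : K → R →ₗ[ℂ] D}
    (s : Finset K) (h1 : ∀ k ∈ s, IsCompletelyPositive (φ k)) :
    IsCompletelyPositive (∑ k ∈ s, φ k) := by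
  classical
  induction s using Finset.induction_on with
  | empty => exact cp_zero
  | insert i s hi ih =>
    rw [Finset.sum_insert hi]
    exact cp_add (h1 _ (by simp)) (ih fun l hl => h1 l (by simp [hl]))

theorem cp_smul {R : Type*} [Ring R] [StarRing R] [Module ℂ R] {φ : R →ₗ[ℂ] D}
    (h1 : IsCompletelyPositive φ) {c : ℝ} (hc : 0 ≤ c) :
    IsCompletelyPositive ((c : ℂ) • φ) := by
  have : (c : ℂ) • φ = conjL (algebraMap ℂ D (Real.sqrt c : ℂ)) ∘ₗ φ := by
    ext x
    rw [LinearMap.comp_apply, conjL_apply, ← algebraMap_star_comm, ← Algebra.commutes, ← mul_assoc,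
      ← map_mul, ← Algebra.smul_def]
    simp [← Complex.ofReal_mul, Real.mul_self_sqrt hc]
  rw [this]
  exact (cp_conjL _).comp h1

/-- Stinespring-type vectors for a `2×2` block. -/
theorem cp_vec {θ : B →ₗ[ℂ] D} (h : IsCompletelyPositive θ) (b c : B) :
    ∃ y0 y1 : Fin 2 → D, θ (star b * b) = ∑ i, star (y0 i) * y0 i ∧
      θ (star b * c) = ∑ i, star (y0 i) * y1 i ∧
      θ (star c * b) = ∑ i, star (y1 i) * y0 i ∧
      θ (star c * c) = ∑ i, star (y1 i) * y1 i := by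
  obtain ⟨v, hv⟩ := h.gram (m := Fin 2) (L := Unit) (fun _ i => ![b, c] i)
  refine ⟨fun l => v l 0, fun l => v l 1, ?_, ?_, ?_, ?_⟩
  · simpa using hv 0 0
  · simpa using hv 0 1
  · simpa using hv 1 0
  · simpa using hv 1 1

theorem IsCompletelyPositive.star_map {θ : B →ₗ[ℂ] D} (h : IsCompletelyPositive θ) (b : B) :
    θ (star b) = star (θ b) := by
  obtain ⟨y0, y1, -, h1, h2, -⟩ := cp_vec h 1 b
  simp only [star_one, one_mul, mul_one] at h1 h2
  rw [h1, h2, star_sum]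
  simp

theorem IsCompletelyPositive.pos {θ : B →ₗ[ℂ] D} (h : IsCompletelyPositive θ) {b : B}
    (hb : IsPosElem b) : IsPosElem (θ b) := by
  obtain ⟨y, rfl⟩ := hb
  obtain ⟨v, hv⟩ := h.gram (m := Fin 1) (L := Unit) (fun _ i => y)
  exact ⟨v 0 0, by simpa using hv 0 0⟩

theorem IsCompletelyPositive.nonneg [PartialOrder B] [StarOrderedRing B]
    [PartialOrder D] [StarOrderedRing D] {θ : B →ₗ[ℂ] D} (h : IsCompletelyPositive θ) {b : B}
    (hb : 0 ≤ b) : 0 ≤ θ b := by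
  rw [← isPosElem_iff] at *; exact h.pos hb

theorem IsCompletelyPositive.mono [PartialOrder B] [StarOrderedRing B]
    [PartialOrder D] [StarOrderedRing D] {θ : B →ₗ[ℂ] D} (h : IsCompletelyPositive θ) {b c : B}
    (hb : b ≤ c) : θ b ≤ θ c := by
  rw [← sub_nonneg, ← map_sub]; exact h.nonneg (sub_nonneg.2 hb)

/-- Cauchy–Schwarz -/
theorem cs_ineq {L : Type*} [Fintype L] (y z : L → D) :
    ‖∑ i, star (y i) * z i‖ ^ 2 ≤ ‖∑ i, star (y i) * y i‖ * ‖∑ i, star (z i) * z i‖ := by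
  letI := CStarAlgebra.spectralOrder D
  haveI := CStarAlgebra.spectralOrderedRing D
  let Y : WithCStarModule D (L → D) := WithCStarModule.equiv D (L → D) |>.symm (fun i => star (y i))
  let Z : WithCStarModule D (L → D) := WithCStarModule.equiv D (L → D) |>.symm (fun i => star (z i))
  have h := CStarModule.norm_inner_le (A := D) (WithCStarModule D (L → D)) (x := Z) (y := Y)
  have e : ∀ (u v : L → D), inner D ((WithCStarModule.equiv D (L → D)).symm (fun i => star (u i)))
      ((WithCStarModule.equiv D (L → D)).symm (fun i => star (v i))) = ∑ i, star (v i) * u i := by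
    intro u v
    rw [WithCStarModule.pi_inner]
    simp [WithCStarModule.inner_def]
  have h2 := pow_le_pow_left₀ (norm_nonneg _) h 2
  rw [mul_pow, CStarModule.norm_sq_eq D (x := Z), CStarModule.norm_sq_eq D (x := Y), e, e, e] at h2
  linarith

end CP

end

section
set_option linter.style.haveILetI false
set_option linter.unusedSectionVars false
open scoped ComplexOrder Matrix.Norms.L2Operator
open Filter Topology

section Fam
variable {D : Type*} [CStarAlgebra D]

theorem fam_cs_fin {K : Type*} [Fintype K] {B : K → Type*} [∀ k, CStarAlgebra (B k)]
    (θ : ∀ k, B k →ₗ[ℂ] D) (hθ : ∀ k, IsCompletelyPositive (θ k)) (c : D) (z : ∀ k, B k) :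
    ‖c * ∑ k, θ k (z k)‖ ^ 2 ≤ ‖c * (∑ k, θ k 1) * star c‖ * ‖∑ k, θ k (star (z k) * z k)‖ := by
  choose y0 y1 h1 h2 h3 h4 using fun k => cp_vec (hθ k) 1 (z k)
  have := cs_ineq (L := K × Fin 2) (fun p => y0 p.1 p.2 * star c) (fun p => y1 p.1 p.2)
  simp only [star_one, one_mul] at h1 h2
  convert this using 2
  · congr 1
    rw [Fintype.sum_prod_type, Finset.mul_sum]
    refine Finset.sum_congr rfl fun k _ => ?_
    rw [h2, Finset.mul_sum]
    simp [mul_assoc]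
  · congr 1
    rw [Fintype.sum_prod_type, Finset.mul_sum, Finset.sum_mul]
    refine Finset.sum_congr rfl fun k _ => ?_
    rw [h1, Finset.mul_sum, Finset.sum_mul]
    simp [mul_assoc]
  · rw [Fintype.sum_prod_type]
    congr 1
    refine Finset.sum_congr rfl fun k _ => ?_
    rw [h4]

theorem fam_cs {K : Type*} (s : Finset K) {B : K → Type*} [∀ k, CStarAlgebra (B k)]
    (θ : ∀ k, B k →ₗ[ℂ] D) (hθ : ∀ k, IsCompletelyPositive (θ k)) (c : D) (z : ∀ k, B k) :
    ‖c * ∑ k ∈ s, θ k (z k)‖ ^ 2 ≤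
      ‖c * (∑ k ∈ s, θ k 1) * star c‖ * ‖∑ k ∈ s, θ k (star (z k) * z k)‖ := by
  have := fam_cs_fin (K := s) (fun k => θ k) (fun k => hθ k) c (fun k => z k)
  simpa only [Finset.sum_coe_sort s (fun k => θ k (z k)), Finset.sum_coe_sort s (fun k => θ k 1),
    Finset.sum_coe_sort s (fun k => θ k (star (z k) * z k))] using this

theorem star_mul_le_sq {B : Type*} [CStarAlgebra B] [PartialOrder B] [StarOrderedRing B]
    (z : B) {M : ℝ} (hM : ‖z‖ ≤ M) : star z * z ≤ ((M ^ 2 : ℝ) : ℂ) • (1 : B) := by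
  have h := CStarAlgebra.star_mul_le_algebraMap_norm_sq (a := z)
  refine h.trans ?_
  rw [Algebra.algebraMap_eq_smul_one]
  have : (((M ^ 2 : ℝ) : ℂ) • (1 : B)) = (M ^ 2) • (1 : B) := by
    rw [Complex.coe_smul]
  rw [this]
  gcongr

theorem fam_norm {K : Type*} (s : Finset K) {B : K → Type*} [∀ k, CStarAlgebra (B k)]
    (θ : ∀ k, B k →ₗ[ℂ] D) (hθ : ∀ k, IsCompletelyPositive (θ k)) (z : ∀ k, B k) {M : ℝ}
    (hM0 : 0 ≤ M) (hM : ∀ k ∈ s, ‖z k‖ ≤ M) :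
    ‖∑ k ∈ s, θ k (z k)‖ ≤ M * ‖∑ k ∈ s, θ k 1‖ := by
  letI := CStarAlgebra.spectralOrder D
  haveI := CStarAlgebra.spectralOrderedRing D
  letI := fun k => CStarAlgebra.spectralOrder (B k)
  haveI := fun k => CStarAlgebra.spectralOrderedRing (B k)
  have h := fam_cs s θ hθ 1 z
  simp only [one_mul, star_one, mul_one] at h
  have h2 : ‖∑ k ∈ s, θ k (star (z k) * z k)‖ ≤ M ^ 2 * ‖∑ k ∈ s, θ k 1‖ := by
    calc _ ≤ ‖((M ^ 2 : ℝ) : ℂ) • ∑ k ∈ s, θ k 1‖ := by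
          apply CStarAlgebra.norm_le_norm_of_nonneg_of_le
          · exact Finset.sum_nonneg fun k _ => (hθ k).nonneg (star_mul_self_nonneg _)
          · rw [Finset.smul_sum]
            refine Finset.sum_le_sum fun k hk => ?_
            rw [← map_smul]
            exact (hθ k).mono (star_mul_le_sq _ (hM k hk))
      _ = _ := by rw [norm_smul, Complex.norm_real, Real.norm_of_nonneg (by positivity)]
  refine le_of_sq_le_sq (h.trans ?_) (by positivity)
  nlinarith [norm_nonneg (∑ k ∈ s, θ k 1)]

theorem cp_norm {B : Type*} [CStarAlgebra B] {θ : B →ₗ[ℂ] D} (hθ : IsCompletelyPositive θ)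
    (z : B) : ‖θ z‖ ≤ ‖z‖ * ‖θ 1‖ := by
  simpa using fam_norm (K := Unit) Finset.univ (fun _ => θ) (fun _ => hθ) (fun _ => z)
    (norm_nonneg z) (fun _ _ => le_rfl)

theorem cp_norm_le {B : Type*} [CStarAlgebra B] {θ : B →ₗ[ℂ] D} (hθ : IsCompletelyPositive θ)
    (h1 : ‖θ 1‖ ≤ 1) (z : B) : ‖θ z‖ ≤ ‖z‖ :=
  (cp_norm hθ z).trans (mul_le_of_le_one_right (norm_nonneg _) h1)

end Fam

/-- A finite family of order zero maps organised by colors. -/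
structure OZSys {D : Type*} [CStarAlgebra D] {K : Type} {n : ℕ} (c : K → Fin (n + 1))
    {ι : K → Type} [∀ k, Fintype (ι k)] [∀ k, DecidableEq (ι k)]
    (φ : ∀ k, Matrix (ι k) (ι k) ℂ →ₗ[ℂ] D) : Prop where
  cp : ∀ k, IsCompletelyPositive (φ k)
  mul : ∀ k x y, φ k x * φ k y = φ k 1 * φ k (x * y)
  norm : ∀ k, ‖φ k 1‖ ≤ 1
  orth : ∀ k l, k ≠ l → c k = c l → φ k 1 * φ l 1 = 0

def ND (n : ℕ) (D : Type*) [CStarAlgebra D] : Prop :=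
  ∀ (S : Finset D) (ε : ℝ), 0 < ε →
    ∃ (K : Type) (_ : Fintype K) (c : K → Fin (n + 1)) (ι : K → Type) (_ : ∀ k, Fintype (ι k))
      (_ : ∀ k, DecidableEq (ι k)) (ψ : ∀ k, D →ₗ[ℂ] Matrix (ι k) (ι k) ℂ)
      (φ : ∀ k, Matrix (ι k) (ι k) ℂ →ₗ[ℂ] D),
      (∀ k, IsCompletelyPositive (ψ k)) ∧ (∀ k, ‖ψ k 1‖ ≤ 1) ∧ OZSys c φ ∧
      ∀ a ∈ S, ‖∑ k, φ k (ψ k a) - a‖ < ε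

namespace OZSys
variable {D : Type*} [CStarAlgebra D] {K : Type} {n : ℕ} {c : K → Fin (n + 1)}
    {ι : K → Type} [∀ k, Fintype (ι k)] [∀ k, DecidableEq (ι k)]
    {φ : ∀ k, Matrix (ι k) (ι k) ℂ →ₗ[ℂ] D}

theorem sa (h : OZSys c φ) (k : K) : star (φ k 1) = φ k 1 := by
  rw [← (h.cp k).star_map, star_one]

theorem comm (h : OZSys c φ) (k : K) (x : Matrix (ι k) (ι k) ℂ) :
    φ k x * φ k 1 = φ k 1 * φ k x := by
  rw [h.mul, mul_one]

theorem orth' (h : OZSys c φ) {k l : K} (hkl : k ≠ l) (hc : c k = c l)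
    (x : Matrix (ι k) (ι k) ℂ) (y : Matrix (ι l) (ι l) ℂ) : φ k x * φ l y = 0 := by
  have key : ∀ {k l : K} (x : Matrix (ι k) (ι k) ℂ), k ≠ l → c k = c l → φ k x * φ l 1 = 0 := by
    intro k l x hkl hc
    rw [← CStarRing.star_mul_self_eq_zero_iff, star_mul, h.sa, ← (h.cp k).star_map]
    rw [mul_assoc, ← mul_assoc (φ k _), h.mul, ← mul_assoc, ← mul_assoc, h.orth l k hkl.symm hc.symm]
    simp
  have h1 : φ l y * φ l (star y) = φ l (y * star y) * φ l 1 := by rw [h.mul, h.comm]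
  rw [← CStarRing.mul_star_self_eq_zero_iff, star_mul, ← (h.cp l).star_map, mul_assoc,
    ← mul_assoc (φ l y), h1, h.comm, mul_assoc, ← mul_assoc (φ k x), key x hkl hc, zero_mul]

theorem color_sum (h : OZSys c φ) (s : Finset K) (j : Fin (n + 1)) (hs : ∀ k ∈ s, c k = j) :
    ‖∑ k ∈ s, φ k 1‖ ≤ 1 := by
  classical
  letI := CStarAlgebra.spectralOrder D
  haveI := CStarAlgebra.spectralOrderedRing D
  set t := ∑ k ∈ s, φ k 1 with ht
  have hsa : star t = t := by
    rw [ht, star_sum]; exact Finset.sum_congr rfl fun k _ => h.sa k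
  have hsq : star t * t = ∑ k ∈ s, φ k 1 * φ k 1 := by
    rw [hsa, ht, Finset.sum_mul]
    refine Finset.sum_congr rfl fun k hk => ?_
    rw [Finset.mul_sum, Finset.sum_eq_single k]
    · intro l hl hlk
      exact h.orth k l hlk.symm ((hs k hk).trans (hs l hl).symm)
    · intro h'; exact absurd hk h'
  have hpos : ∀ k, 0 ≤ φ k 1 := fun k =>
    (isPosElem_iff _).1 ((h.cp k).pos ⟨1, by simp⟩)
  have hle : star t * t ≤ t := by
    rw [hsq, ht]
    refine Finset.sum_le_sum fun k _ => ?_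
    have h1 : φ k 1 ≤ 1 := (CStarAlgebra.norm_le_one_iff_of_nonneg _ (hpos k)).1 (h.norm k)
    have hc := (Commute.refl (φ k 1)).sub_left (Commute.one_left (φ k 1))
    have : 0 ≤ φ k 1 * (1 - φ k 1) :=
      Commute.mul_nonneg (hpos k) (sub_nonneg.2 h1) ((Commute.one_right _).sub_right (Commute.refl _))
    rw [mul_sub, mul_one] at this
    exact sub_nonneg.1 this
  have := CStarAlgebra.norm_le_norm_of_nonneg_of_le (star_mul_self_nonneg t) hle
  rw [CStarRing.norm_star_mul_self] at this
  by_contra! hc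
  nlinarith

theorem color_norm (h : OZSys c φ) (s : Finset K) (j : Fin (n + 1)) (hs : ∀ k ∈ s, c k = j)
    (z : ∀ k, Matrix (ι k) (ι k) ℂ) {M : ℝ} (hM0 : 0 ≤ M) (hM : ∀ k ∈ s, ‖z k‖ ≤ M) :
    ‖∑ k ∈ s, φ k (z k)‖ ≤ M := by
  refine (fam_norm s φ h.cp z hM0 hM).trans ?_
  exact mul_le_of_le_one_right hM0 (h.color_sum s j hs)

theorem total [Fintype K] (h : OZSys c φ) : ‖∑ k, φ k 1‖ ≤ n + 1 := by
  classical
  rw [← Finset.sum_fiberwise Finset.univ c]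
  refine (norm_sum_le _ _).trans ?_
  refine (Finset.sum_le_sum (fun j _ => h.color_sum _ j (by simp))).trans ?_
  simp

theorem total_norm [Fintype K] (h : OZSys c φ)
    (z : ∀ k, Matrix (ι k) (ι k) ℂ) {M : ℝ} (hM0 : 0 ≤ M) (hM : ∀ k, ‖z k‖ ≤ M) :
    ‖∑ k, φ k (z k)‖ ≤ M * (n + 1) := by
  refine (fam_norm Finset.univ φ h.cp z hM0 (fun k _ => hM k)).trans ?_
  exact mul_le_mul_of_nonneg_left h.total hM0

end OZSys

/-- From ND to the official definition. -/
theorem ND.nuclearDimensionLE {n : ℕ} {D : Type*} [CStarAlgebra D] (h : ND n D) :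
    NuclearDimensionLE n D := by
  classical
  intro S ε hε
  obtain ⟨K, _, c, ι, _, _, ψ, φ, hψ, hψ1, hφ, hS⟩ := h S ε hε
  let e := Fintype.equivFin K
  let r : Fin (Fintype.card K) → ℕ := fun i => Fintype.card (ι (e.symm i))
  let f : ∀ i, ι (e.symm i) ≃ Fin (r i) := fun i => Fintype.equivFin _
  let R : ∀ i, Matrix (ι (e.symm i)) (ι (e.symm i)) ℂ ≃ₐ[ℂ] Matrix (Fin (r i)) (Fin (r i)) ℂ :=
    fun i => Matrix.reindexAlgEquiv ℂ ℂ (f i)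
  have Rstar : ∀ i x, R i (star x) = star (R i x) := fun i x => by
    ext a b; simp [R, Matrix.star_apply]
  have Rstar' : ∀ i x, (R i).symm (star x) = star ((R i).symm x) := fun i x => by
    ext a b; simp [R, Matrix.star_apply]
  let RR : ∀ i, Matrix (ι (e.symm i)) (ι (e.symm i)) ℂ ≃⋆ₐ[ℂ] Matrix (Fin (r i)) (Fin (r i)) ℂ :=
    fun i => StarAlgEquiv.ofAlgEquiv (R i) (Rstar i)
  have Rnorm : ∀ i x, ‖R i x‖ = ‖x‖ := fun i x => StarAlgEquiv.norm_map (RR i) x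
  have Rnorm' : ∀ i x, ‖(R i).symm x‖ = ‖x‖ := fun i x => by
    rw [← Rnorm, AlgEquiv.apply_symm_apply]
  let Ψ : D →ₗ[ℂ] FDBlock (Fintype.card K) r :=
    LinearMap.pi fun i => (R i).toLinearMap ∘ₗ ψ (e.symm i)
  let Φ : FDBlock (Fintype.card K) r →ₗ[ℂ] D :=
    ∑ i, φ (e.symm i) ∘ₗ (R i).symm.toLinearMap ∘ₗ LinearMap.proj i
  have Φapp : ∀ x, Φ x = ∑ i, φ (e.symm i) ((R i).symm (x i)) := fun x => by
    simp [Φ]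
  refine ⟨Fintype.card K, r, fun i => c (e.symm i), Ψ, Φ, ?_, ?_, ?_, ?_, ?_⟩
  · intro k x hx
    have h1 : ∀ i, IsPosElem (x.map ((R i).toLinearMap ∘ₗ ψ (e.symm i))) := fun i =>
      IsCompletelyPositive.comp (cp_of_hom _ (by simp) (by simpa using Rstar i)) (hψ _) k x hx
    choose y hy using h1
    refine ⟨Matrix.of fun a b i => y i a b, ?_⟩
    ext a b i
    have := congrFun (congrFun (hy i) a) b
    simp only [Matrix.map_apply] at this
    simp only [Matrix.map_apply]
    rw [show Ψ (x a b) i = ((R i).toLinearMap ∘ₗ ψ (e.symm i)) (x a b) from rfl, this]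
    simp [Matrix.mul_apply, Matrix.star_apply]
  · refine cp_sum _ fun i _ => (hφ.cp _).comp ((cp_of_hom _ ?_ ?_).comp (cp_of_hom _ ?_ ?_))
    · simp
    · simpa using Rstar' i
    · simp
    · simp
  · intro a
    refine (pi_norm_le_iff_of_nonneg (norm_nonneg _)).2 fun i => ?_
    change ‖R i (ψ (e.symm i) a)‖ ≤ _
    rw [Rnorm]
    exact cp_norm_le (hψ _) (hψ1 _) a
  · intro j
    have hred : ∀ x ∈ blockSupp (r := r) (fun i => c (e.symm i)) j, Φ x =
        ∑ i with c (e.symm i) = j, φ (e.symm i) ((R i).symm (x i)) := by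
      intro x hx
      rw [Φapp, Finset.sum_filter]
      refine Finset.sum_congr rfl fun i _ => ?_
      split_ifs with hi
      · rfl
      · rw [hx i hi]; simp
    have hsys : OZSys (K := Fin (Fintype.card K)) (fun i => c (e.symm i))
        (ι := fun i => ι (e.symm i)) (fun i => φ (e.symm i)) :=
      ⟨fun i => hφ.cp _, fun i => hφ.mul _, fun i => hφ.norm _, fun i l hil hc =>
        hφ.orth _ _ (fun h => hil (e.symm.injective h)) hc⟩
    constructor
    · intro x hx
      rw [hred x hx]
      refine hsys.color_norm _ j (by simp) (fun i => (R i).symm (x i)) (norm_nonneg _) ?_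
      intro i _
      rw [Rnorm']
      exact norm_le_pi_norm x i
    · have key : ∀ x ∈ blockSupp (r := r) (fun i => c (e.symm i)) j,
          ∀ y ∈ blockSupp (r := r) (fun i => c (e.symm i)) j, x * y = 0 → Φ x * Φ y = 0 := by
        intro x hx y hy hxy
        rw [hred x hx, hred y hy, Finset.sum_mul]
        refine Finset.sum_eq_zero fun i hi => ?_
        rw [Finset.mul_sum]
        refine Finset.sum_eq_zero fun l hl => ?_
        simp only [Finset.mem_filter, Finset.mem_univ, true_and] at hi hl
        by_cases hil : i = l
        · subst hil
          rw [hφ.mul, ← map_mul (R i).symm, show x i * y i = 0 from congrFun hxy i]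
          simp
        · exact hsys.orth' hil (hi.trans hl.symm) _ _
      exact fun x hx y hy hxy hyx => ⟨key x hx y hy hxy, key y hy x hx hyx⟩
  · intro a ha
    rw [Φapp]
    have : ∑ i, φ (e.symm i) ((R i).symm (Ψ a i)) = ∑ k, φ k (ψ k a) := by
      rw [← Equiv.sum_comp e.symm]
      refine Finset.sum_congr rfl fun i _ => ?_
      change φ (e.symm i) ((R i).symm ((R i) (ψ (e.symm i) a))) = _
      rw [AlgEquiv.symm_apply_apply]
    rw [this]
    exact hS a ha

end

section
set_option linter.style.haveILetI false
set_option linter.unusedSectionVars false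
open scoped ComplexOrder Matrix.Norms.L2Operator
open Filter Topology

theorem hermitian_decomp {ι : Type*} [Fintype ι] [DecidableEq ι] {x : Matrix ι ι ℂ}
    (hx : star x = x) : ∃ (l : ι → ℝ) (p : ι → Matrix ι ι ℂ), (∀ i j, p i * p j = if i = j then p i else 0) ∧
      x = ∑ i, (l i : ℂ) • p i := by
  have hh : x.IsHermitian := hx
  set U := (hh.eigenvectorUnitary : Matrix ι ι ℂ) with hU
  have hUU : star U * U = 1 := (Matrix.mem_unitaryGroup_iff').1 hh.eigenvectorUnitary.2
  refine ⟨hh.eigenvalues, fun i => U * Matrix.single i i 1 * star U, ?_, ?_⟩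
  · intro i j
    have : U * Matrix.single i i (1 : ℂ) * star U * (U * Matrix.single j j 1 * star U) =
        U * (Matrix.single i i (1 : ℂ) * (star U * U) * Matrix.single j j 1) * star U := by
      simp only [mul_assoc]
    rw [this, hUU, mul_one]
    split_ifs with h
    · subst h; simp
    · simp [Matrix.single_mul_single_of_ne, h]
  · conv_lhs => rw [hh.spectral_theorem]
    rw [Unitary.conjStarAlgAut_apply, ← hU]
    have : Matrix.diagonal (RCLike.ofReal ∘ hh.eigenvalues : ι → ℂ) =
        ∑ i, (hh.eigenvalues i : ℂ) • Matrix.single i i (1 : ℂ) := by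
      ext a b
      rw [Matrix.sum_apply]
      simp [Matrix.single_apply, Matrix.diagonal_apply]
      by_cases hab : a = b
      · subst hab; simp
      · simp only [hab, if_false]
        symm
        refine Finset.sum_eq_zero fun i _ => ?_
        rw [if_neg]
        rintro ⟨rfl, rfl⟩; exact hab rfl
    rw [this, Finset.mul_sum, Finset.sum_mul]
    refine Finset.sum_congr rfl fun i _ => ?_
    rw [mul_smul_comm, smul_mul_assoc]

theorem jordan_aux {R : Type*} [Ring R] [Algebra ℂ R] (a b : R) :
    (a - Complex.I • b) * (a + Complex.I • b) +
      (a + Complex.I • b) * (a - Complex.I • b) = (2 : ℂ) • (a * a) + (2 : ℂ) • (b * b) := by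
  simp only [mul_add, add_mul, mul_sub, sub_mul, smul_mul_smul_comm, Complex.I_mul_I]
  module

section
variable {D : Type*} [CStarAlgebra D] {ι : Type*} [Fintype ι] [DecidableEq ι]

theorem re_im_decomp {R : Type*} [CStarAlgebra R] (x : R) : ∃ a b : R, star a = a ∧ star b = b ∧
    x = a + Complex.I • b := by
  refine ⟨realPart x, imaginaryPart x, (realPart x).2, (imaginaryPart x).2, ?_⟩
  exact (realPart_add_I_smul_imaginaryPart x).symm

theorem oz_struct {φ : Matrix ι ι ℂ →ₗ[ℂ] D} (hφ : IsCompletelyPositive φ)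
    (ho : ∀ e f, e * f = 0 → f * e = 0 → φ e * φ f = 0) (x y : Matrix ι ι ℂ) :
    φ x * φ y = φ 1 * φ (x * y) := by
  letI := CStarAlgebra.spectralOrder D
  haveI := CStarAlgebra.spectralOrderedRing D
  set h := φ 1 with hh
  have hidem : ∀ e : Matrix ι ι ℂ, e * e = e → φ e * φ e = h * φ e ∧ φ e * h = h * φ e := by
    intro e he
    have h1 := ho e (1 - e) (by rw [mul_sub, he, mul_one, sub_self])
      (by rw [sub_mul, he, one_mul, sub_self])
    have h2 := ho (1 - e) e (by rw [sub_mul, he, one_mul, sub_self])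
      (by rw [mul_sub, he, mul_one, sub_self])
    rw [map_sub, mul_sub, sub_eq_zero] at h1
    rw [map_sub, sub_mul, sub_eq_zero] at h2
    exact ⟨h2.symm, h1.trans h2.symm⟩
  have hherm : ∀ x : Matrix ι ι ℂ, star x = x → φ x * φ x = h * φ (x * x) ∧ φ x * h = h * φ x := by
    intro x hx
    obtain ⟨l, p, hp, rfl⟩ := hermitian_decomp hx
    have hpp : ∀ i, p i * p i = p i := fun i => by simp [hp]
    constructor
    · have e1 : φ (∑ i, (l i : ℂ) • p i) * φ (∑ i, (l i : ℂ) • p i)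
          = ∑ i, ((l i : ℂ) * l i) • (h * φ (p i)) := by
        simp only [map_sum, map_smul, Finset.sum_mul]
        refine Finset.sum_congr rfl fun i _ => ?_
        rw [Finset.mul_sum, Finset.sum_eq_single i]
        · rw [smul_mul_smul_comm, (hidem _ (hpp i)).1]
        · intro j _ hj
          rw [smul_mul_smul_comm, ho (p i) (p j), smul_zero]
          · simp [hp, hj.symm]
          · simp [hp, hj]
        · simp
      have e2 : (∑ i, (l i : ℂ) • p i) * (∑ i, (l i : ℂ) • p i)
          = ∑ i, ((l i : ℂ) * l i) • p i := by
        simp only [Finset.sum_mul]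
        refine Finset.sum_congr rfl fun i _ => ?_
        rw [Finset.mul_sum, Finset.sum_eq_single i]
        · rw [smul_mul_smul_comm, hpp]
        · intro j _ hj
          simp [hp, hj.symm]
        · simp
      rw [e1, e2]
      simp only [map_sum, map_smul, Finset.mul_sum, mul_smul_comm]
    · simp only [map_sum, map_smul, Finset.sum_mul, Finset.mul_sum, smul_mul_assoc, mul_smul_comm]
      exact Finset.sum_congr rfl fun i _ => by rw [(hidem _ (hpp i)).2]
  have hcomm : ∀ x, φ x * h = h * φ x := by
    intro x
    obtain ⟨a, b, ha, hb, rfl⟩ := re_im_decomp x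
    rw [map_add, map_smul, add_mul, mul_add, smul_mul_assoc, mul_smul_comm, (hherm a ha).2,
      (hherm b hb).2]
  have hj : ∀ x, φ (star x) * φ x + φ x * φ (star x) = h * φ (star x * x + x * star x) := by
    intro x
    obtain ⟨a, b, ha, hb, rfl⟩ := re_im_decomp x
    have hs : star (a + Complex.I • b) = a - Complex.I • b := by
      rw [star_add, star_smul, ha, hb]; simp [sub_eq_add_neg]
    have e2 := jordan_aux (φ a) (φ b)
    rw [hs, jordan_aux, map_add, map_sub, map_smul, e2, (hherm a ha).1, (hherm b hb).1]
    simp only [map_add, map_smul, mul_add, mul_smul_comm]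
  have hpos : ∀ x, 0 ≤ h * (h * φ (star x * x) - φ (star x) * φ x) := by
    intro x
    obtain ⟨y0, y1, h1, h2, h3, h4⟩ := cp_vec hφ 1 x
    simp only [star_one, one_mul, mul_one] at h1 h2 h3
    have hsa : star h = h := by rw [hh, ← hφ.star_map, star_one]
    have : h * (h * φ (star x * x) - φ (star x) * φ x) =
        ∑ i, star (y1 i * h - y0 i * φ x) * (y1 i * h - y0 i * φ x) := by
      have e : ∀ i, star (y1 i * h - y0 i * φ x) * (y1 i * h - y0 i * φ x) =
          h * (star (y1 i) * y1 i) * h - h * (star (y1 i) * y0 i) * φ x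
          - φ (star x) * (star (y0 i) * y1 i) * h + φ (star x) * (star (y0 i) * y0 i) * φ x := by
        intro i
        rw [star_sub, star_mul, star_mul, hsa, ← hφ.star_map]
        noncomm_ring
      simp only [e, Finset.sum_sub_distrib, Finset.sum_add_distrib, ← Finset.mul_sum,
        ← Finset.sum_mul]
      rw [← h4, ← h3, ← h2, ← h1, ← hh, mul_assoc h (φ (star x * x)) h, hcomm, mul_sub,
        mul_assoc (φ (star x)) (φ x) h, hcomm x]
      noncomm_ring
    rw [this]
    exact Finset.sum_nonneg fun i _ => star_mul_self_nonneg _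
  have hZ : ∀ x, φ (star x) * φ x = h * φ (star x * x) := by
    intro x
    set Z := h * φ (star x * x) - φ (star x) * φ x with hZd
    have hsa : star h = h := by rw [hh, ← hφ.star_map, star_one]
    have hZs : star Z = Z := by
      simp only [hZd, star_sub, star_mul, ← hφ.star_map, hsa, star_star, hcomm]
    have hZZ : h * φ (x * star x) - φ x * φ (star x) = - Z := by
      have := hj x
      rw [map_add, mul_add] at this
      rw [hZd, neg_sub, sub_eq_sub_iff_add_eq_add, add_comm, ← this, add_comm]
    have h1 := hpos x
    have h2 := hpos (star x)
    rw [star_star, hZZ, mul_neg] at h2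
    have hhZ : h * Z = 0 := le_antisymm (neg_nonneg.1 h2) h1
    have hZh : Z * h = 0 := by
      have := congrArg star hhZ
      rwa [star_mul, hZs, hsa, star_zero] at this
    have hxZ : φ x * Z = 0 := by
      rw [← CStarRing.star_mul_self_eq_zero_iff]
      refine le_antisymm ?_ (star_mul_self_nonneg _)
      have : star (φ x * Z) * (φ x * Z) + star (φ (star x) * Z) * (φ (star x) * Z) = 0 := by
        simp only [star_mul, ← hφ.star_map, star_star, hZs]
        calc _ = Z * (φ (star x) * φ x + φ x * φ (star x)) * Z := by noncomm_ring
          _ = _ := by rw [hj, ← mul_assoc, hZh, zero_mul, zero_mul]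
      rw [← this]
      exact le_add_of_nonneg_right (star_mul_self_nonneg _)
    have hZx : Z * φ (star x) = 0 := by
      have := congrArg star hxZ
      rwa [star_mul, hZs, ← hφ.star_map, star_zero] at this
    have hZ0 : Z = 0 := by
      rw [← CStarRing.star_mul_self_eq_zero_iff, hZs]
      conv_lhs => rw [hZd, ← hZd]
      have : Z * Z = Z * h * φ (star x * x) - Z * φ (star x) * φ x := by
        conv_lhs => rhs; rw [hZd]
        noncomm_ring
      rw [this, hZh, hZx, zero_mul, zero_mul, sub_zero]
    exact (sub_eq_zero.1 (hZd ▸ hZ0)).symm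
  -- polarize
  have hF : ∀ x y, φ (star x) * φ y = h * φ (star x * y) := by
    intro x y
    have h1 := hZ x
    have h2 := hZ y
    have h3 := hZ (x + y)
    have h4 := hZ (x + Complex.I • y)
    have a3 : φ (star x) * φ y + φ (star y) * φ x = h * φ (star x * y) + h * φ (star y * x) := by
      simp only [star_add, map_add, mul_add, add_mul] at h3
      rw [h1, h2] at h3
      have := congrArg (fun t => t - h * φ (star x * x) - h * φ (star y * y)) h3
      convert this using 1 <;> abel
    have a4 : φ (star x) * φ y - φ (star y) * φ x = h * φ (star x * y) - h * φ (star y * x) := by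
      have hI : star (Complex.I • y) = (-Complex.I) • star y := by
        rw [star_smul]; simp
      simp only [star_add, hI, map_add, mul_add, add_mul, map_smul, smul_mul_assoc, mul_smul_comm] at h4
      rw [h1, h2] at h4
      have := congrArg (fun t => (-Complex.I) • (t - h * φ (star x * x) - h * φ (star y * y))) h4
      have e : ∀ p q r s : D, (-Complex.I) • (p + -Complex.I • q + Complex.I • (r + -Complex.I • s) - p - s) = r - q := by
        intro p q r s
        have : Complex.I • (r + -Complex.I • s) = Complex.I • r + s := by
          rw [smul_add, smul_smul]; simp
        rw [this, show p + -Complex.I • q + (Complex.I • r + s) - p - s = Complex.I • (r - q) by module,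
          smul_smul]
        simp
      simpa only [e] using this
    have := congrArg₂ (fun s t => (2⁻¹ : ℂ) • (s + t)) a3 a4
    convert this using 1 <;> module
  simpa using hF (star x) y
end

theorem NuclearDimensionLE.nd {n : ℕ} {D : Type*} [CStarAlgebra D]
    (h : NuclearDimensionLE n D) : ND n D := by
  classical
  intro S ε hε
  obtain ⟨s, r, J, ψ, φ, hψ, hφ, hψ1, hφ1, hS⟩ := h S ε hε
  have hsupp : ∀ i (x : Matrix (Fin (r i)) (Fin (r i)) ℂ),
      (Pi.single i x : FDBlock s r) ∈ blockSupp J (J i) := by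
    intro i x i' hi'
    rw [Pi.single_eq_of_ne]
    rintro rfl; exact hi' rfl
  refine ⟨Fin s, inferInstance, J, fun i => Fin (r i), inferInstance, inferInstance,
    fun i => LinearMap.proj i ∘ₗ ψ, fun i => φ ∘ₗ LinearMap.single ℂ (fun i => Matrix (Fin (r i)) (Fin (r i)) ℂ) i, ?_, ?_, ?_, ?_⟩
  · intro i
    exact (cp_of_hom _ (by simp) (by simp)).comp hψ
  · intro i
    refine (norm_le_pi_norm (ψ 1) i).trans ((hψ1 1).trans ?_)
    rcases subsingleton_or_nontrivial D with hD | hD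
    · rw [Subsingleton.elim (1 : D) 0]; simp
    · simp
  · have hcp : ∀ i, IsCompletelyPositive (φ ∘ₗ LinearMap.single ℂ (fun i => Matrix (Fin (r i)) (Fin (r i)) ℂ) i) := by
      intro i
      refine hφ.comp (cp_of_hom _ ?_ ?_)
      · intro x y; simp [Pi.single_mul]
      · intro x
        ext1 i'
        by_cases hi : i' = i
        · subst hi; simp
        · simp [Pi.single_eq_of_ne hi]
    refine ⟨hcp, ?_, ?_, ?_⟩
    · intro i x y
      refine oz_struct (hcp i) ?_ x y
      intro e f hef hfe
      simp only [LinearMap.comp_apply, LinearMap.single_apply]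
      refine ((hφ1 (J i)).2 _ (hsupp i e) _ (hsupp i f) ?_ ?_).1
      · rw [← Pi.single_mul, hef, Pi.single_zero]
      · rw [← Pi.single_mul, hfe, Pi.single_zero]
    · intro i
      simp only [LinearMap.comp_apply, LinearMap.single_apply]
      refine ((hφ1 (J i)).1 _ (hsupp i 1)).trans ?_
      refine (pi_norm_le_iff_of_nonneg zero_le_one).2 fun i' => ?_
      by_cases hi : i' = i
      · subst hi
        rw [Pi.single_eq_same]
        rcases isEmpty_or_nonempty (Fin (r i')) with hE | hE
        · rw [Subsingleton.elim (1 : Matrix (Fin (r i')) (Fin (r i')) ℂ) 0]; simp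
        · simp
      · rw [Pi.single_eq_of_ne hi]; simp
    · intro k l hkl hc
      simp only [LinearMap.comp_apply, LinearMap.single_apply]
      have hl : (Pi.single l (1 : Matrix (Fin (r l)) (Fin (r l)) ℂ) : FDBlock s r) ∈ blockSupp J (J k) := by
        rw [hc]; exact hsupp l 1
      refine ((hφ1 (J k)).2 _ (hsupp k 1) _ hl ?_ ?_).1
      · ext1 i
        rw [Pi.mul_apply, Pi.zero_apply]
        by_cases hi : i = k
        · subst hi; rw [Pi.single_eq_of_ne hkl, mul_zero]
        · rw [Pi.single_eq_of_ne hi, zero_mul]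
      · ext1 i
        rw [Pi.mul_apply, Pi.zero_apply]
        by_cases hi : i = k
        · subst hi; rw [Pi.single_eq_of_ne hkl, zero_mul]
        · rw [Pi.single_eq_of_ne hi, mul_zero]
  · intro a ha
    have : ∑ i, (φ ∘ₗ LinearMap.single ℂ (fun i => Matrix (Fin (r i)) (Fin (r i)) ℂ) i) ((LinearMap.proj i ∘ₗ ψ) a) = φ (ψ a) := by
      simp only [LinearMap.comp_apply, LinearMap.single_apply, LinearMap.proj_apply]
      rw [← map_sum]
      congr 1
      exact Finset.univ_sum_single (ψ a)
    rw [this]; exact hS a ha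

end

section
set_option linter.style.haveILetI false
set_option linter.unusedSectionVars false
open scoped ComplexOrder Matrix.Norms.L2Operator
open Filter Topology

theorem poly_comm (P : Polynomial ℝ) : ∃ C : ℝ, 0 ≤ C ∧ ∀ (B : Type) [CStarAlgebra B] (t x : B),
    ‖t‖ ≤ 1 → ‖Polynomial.aeval t P * x - x * Polynomial.aeval t P‖ ≤ C * ‖t * x - x * t‖ := by
  induction P using Polynomial.induction_on' with
  | add p q hp hq =>
    obtain ⟨C, hC, h1⟩ := hp
    obtain ⟨C', hC', h2⟩ := hq
    refine ⟨C + C', by positivity, fun B _ t x ht => ?_⟩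
    rw [map_add, add_mul, mul_add, add_sub_add_comm, add_mul]
    exact (norm_add_le _ _).trans (add_le_add (h1 B t x ht) (h2 B t x ht))
  | monomial m a =>
    refine ⟨|a| * m, by positivity, fun B _ t x ht => ?_⟩
    have hpow : ‖t ^ m * x - x * t ^ m‖ ≤ m * ‖t * x - x * t‖ := by
      induction m with
      | zero => simp
      | succ m ih =>
        have : t ^ (m + 1) * x - x * t ^ (m + 1) = t ^ m * (t * x - x * t)
          + (t ^ m * x - x * t ^ m) * t := by
          rw [pow_succ]; noncomm_ring
        rw [this]
        have h1 : ‖t ^ m * (t * x - x * t)‖ ≤ 1 * ‖t * x - x * t‖ := by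
          rcases subsingleton_or_nontrivial B with hB | hB
          · rw [Subsingleton.elim (t ^ m * (t * x - x * t)) 0]; simp
          refine (norm_mul_le _ _).trans ?_
          gcongr
          exact (norm_pow_le _ _).trans (pow_le_one₀ (norm_nonneg _) ht)
        have h2 : ‖(t ^ m * x - x * t ^ m) * t‖ ≤ m * ‖t * x - x * t‖ * 1 :=
          (norm_mul_le _ _).trans (mul_le_mul ih ht (norm_nonneg _) (by positivity))
        push_cast
        linarith [norm_add_le (t ^ m * (t * x - x * t)) ((t ^ m * x - x * t ^ m) * t)]
    rw [Polynomial.aeval_monomial, ← Algebra.smul_def, smul_mul_assoc, mul_smul_comm, ← smul_sub,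
      norm_smul, Real.norm_eq_abs, mul_assoc]
    gcongr

theorem comm_sqrt (ε R : ℝ) (hε : 0 < ε) (hR : 0 ≤ R) : ∃ δ : ℝ, 0 < δ ∧
    ∀ (B : Type) [CStarAlgebra B] (t : B), IsPosElem t → ‖t‖ ≤ 1 →
    ∃ u : B, star u = u ∧ u * u = t ∧ ∀ x, ‖x‖ ≤ R → ‖t * x - x * t‖ ≤ δ →
      ‖u * x - x * u‖ ≤ ε := by
  obtain ⟨P, hP⟩ := exists_polynomial_near_of_continuousOn 0 1 Real.sqrt
    Real.continuous_sqrt.continuousOn (ε / (4 * (R + 1))) (by positivity)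
  obtain ⟨C, hC, h⟩ := poly_comm P
  refine ⟨ε / (2 * (C + 1)), by positivity, fun B _ t htpos ht => ?_⟩
  letI := CStarAlgebra.spectralOrder B
  haveI := CStarAlgebra.spectralOrderedRing B
  rw [isPosElem_iff] at htpos
  have hsp : ∀ s ∈ spectrum ℝ t, s ∈ Set.Icc (0 : ℝ) 1 := by
    intro s hs
    refine ⟨spectrum_nonneg_of_nonneg htpos hs, ?_⟩
    rcases subsingleton_or_nontrivial B with hB | hB
    · simp at hs
    · exact (le_abs_self s).trans ((spectrum.norm_le_norm_of_mem hs).trans ht)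
  have hsa : IsSelfAdjoint t := htpos.isSelfAdjoint
  have huu : cfc Real.sqrt t * cfc Real.sqrt t = t := by
    rw [← cfc_mul _ _ _]
    conv_rhs => rw [← cfc_id ℝ t]
    refine cfc_congr fun s hs => ?_
    exact Real.mul_self_sqrt (hsp s hs).1
  have husa : star (cfc Real.sqrt t) = cfc Real.sqrt t := cfc_predicate (R := ℝ) (p := IsSelfAdjoint) Real.sqrt t
  refine ⟨cfc Real.sqrt t, husa, huu, fun x hx hc => ?_⟩
  set u := cfc Real.sqrt t
  have hd : ‖Polynomial.aeval t P - u‖ ≤ ε / (4 * (R + 1)) := by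
    rw [← cfc_polynomial P t, ← cfc_sub _ _ _]
    refine norm_cfc_le (by positivity) fun s hs => ?_
    exact (hP s (hsp s hs)).le
  have h1 := h B t x ht
  have h2 : u * x - x * u = (Polynomial.aeval t P * x - x * Polynomial.aeval t P)
      - (Polynomial.aeval t P - u) * x + x * (Polynomial.aeval t P - u) := by noncomm_ring
  have hb : ε / (4 * (R + 1)) * R ≤ ε / 4 := by
    rw [div_mul_eq_mul_div, div_le_div_iff₀ (by positivity) (by positivity)]
    nlinarith
  have h3 : ‖(Polynomial.aeval t P - u) * x‖ ≤ ε / 4 :=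
    (norm_mul_le _ _).trans ((mul_le_mul hd hx (norm_nonneg _) (by positivity)).trans hb)
  have h4 : ‖x * (Polynomial.aeval t P - u)‖ ≤ ε / 4 := by
    refine (norm_mul_le _ _).trans (le_trans ?_ hb)
    rw [mul_comm]
    exact (mul_le_mul hd hx (norm_nonneg _) (by positivity))
  have h5 : C * ‖t * x - x * t‖ ≤ ε / 2 := by
    calc _ ≤ C * (ε / (2 * (C + 1))) := by gcongr
      _ ≤ ε / 2 := by
        rw [mul_div_assoc', div_le_div_iff₀ (by positivity) (by positivity)]
        nlinarith
  rw [h2]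
  calc _ ≤ _ := norm_add_le _ _
    _ ≤ ‖Polynomial.aeval t P * x - x * Polynomial.aeval t P‖ + ‖(Polynomial.aeval t P - u) * x‖
      + ‖x * (Polynomial.aeval t P - u)‖ := by gcongr; exact norm_sub_le _ _
    _ ≤ ε := by linarith

/-- existence of states peaking at a positive element -/
theorem exists_state {D : Type*} [CStarAlgebra D] {a : D} (ha : IsPosElem a) (hn : ‖a‖ = 1) :
    ∃ f : D →ₗ[ℂ] ℂ, f 1 = 1 ∧ f a = 1 ∧ ∀ x, 0 ≤ f (star x * x) := by
  letI := CStarAlgebra.spectralOrder D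
  haveI := CStarAlgebra.spectralOrderedRing D
  have hpos := (isPosElem_iff _).1 ha
  haveI : Nontrivial D := by
    by_contra h
    rw [not_nontrivial_iff_subsingleton] at h
    rw [Subsingleton.elim a 0] at hn; simp at hn
  have h1 : (1 : ℝ) ≤ ‖(1 : D) + a‖ := by
    have := CStarAlgebra.norm_le_norm_of_nonneg_of_le (zero_le_one (α := D)) (le_add_of_nonneg_right hpos)
    simpa using this
  have h2 : ‖(1 : D) + a‖ = 2 := by
    refine le_antisymm ((norm_add_le _ _).trans (by rw [hn, norm_one]; norm_num)) ?_
    have e1 : (1 : D) + a ≤ algebraMap ℝ D ‖(1 : D) + a‖ :=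
      IsSelfAdjoint.le_algebraMap_norm_self ((IsSelfAdjoint.one D).add hpos.isSelfAdjoint)
    have e2 : a ≤ algebraMap ℝ D (‖(1 : D) + a‖ - 1) := by
      rw [map_sub, map_one]; exact le_sub_iff_add_le'.2 e1
    have := (CStarAlgebra.norm_le_iff_le_algebraMap a (sub_nonneg.2 h1) hpos).2 e2
    linarith
  obtain ⟨g, hg1, hg2⟩ := exists_dual_vector'' ℂ ((1 : D) + a)
  have hgn : ∀ x, ‖g x‖ ≤ ‖x‖ := fun x => g.le_of_opNorm_le hg1 x |>.trans (by simp)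
  rw [h2, map_add] at hg2
  have r1 : (g 1).re ≤ 1 := (Complex.re_le_norm _).trans ((hgn 1).trans (by simp))
  have r2 : (g a).re ≤ 1 := (Complex.re_le_norm _).trans ((hgn a).trans hn.le)
  have r3 := congrArg Complex.re hg2
  simp at r3
  let f : D →ₗ[ℂ] ℂ :=
    { toFun := fun x => (1 / 2 : ℂ) * (g x + star (g (star x)))
      map_add' := fun x y => by simp; ring
      map_smul' := fun c x => by simp; ring }
  have fre : ∀ x, star x = x → f x = (g x).re := by
    intro x hx
    change (1 / 2 : ℂ) * (g x + star (g (star x))) = _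
    rw [hx]
    apply Complex.ext
    · simp; ring
    · simp
  refine ⟨f, ?_, ?_, ?_⟩
  · rw [fre _ (star_one _), show (g 1).re = 1 by linarith]; simp
  · rw [fre _ hpos.isSelfAdjoint, show (g a).re = 1 by linarith]; simp
  · intro x
    rw [fre _ (by simp)]
    set b := star x * x with hb
    have hb0 : 0 ≤ b := star_mul_self_nonneg x
    have e1 : b ≤ algebraMap ℝ D ‖b‖ := IsSelfAdjoint.le_algebraMap_norm_self hb0.isSelfAdjoint
    have e2 : ‖algebraMap ℝ D ‖b‖ - b‖ ≤ ‖b‖ := by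
      refine (CStarAlgebra.norm_le_iff_le_algebraMap _ (norm_nonneg _) (sub_nonneg.2 e1)).2 ?_
      exact sub_le_self _ hb0
    have e3 := hgn (algebraMap ℝ D ‖b‖ - b)
    have e4 : g (algebraMap ℝ D ‖b‖ - b) = ‖b‖ * g 1 - g b := by
      rw [map_sub, Algebra.algebraMap_eq_smul_one]
      congr 1
      rw [← Complex.coe_smul, map_smul, smul_eq_mul]
    have e5 := Complex.re_le_norm (g (algebraMap ℝ D ‖b‖ - b))
    rw [e4] at e5
    simp [show (g 1).re = 1 by linarith] at e5
    rw [← e4] at e5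
    have : 0 ≤ (g b).re := by linarith
    exact_mod_cast this

theorem cp_of_state {D : Type*} [CStarAlgebra D] {f : D →ₗ[ℂ] ℂ}
    (hf : ∀ x, 0 ≤ f (star x * x)) : IsCompletelyPositive f := by
  intro k x hx
  obtain ⟨w, hw⟩ := gram_of_pos hx
  have hst : ∀ x, f (star x) = star (f x) := by
    intro x
    have h1 := hf (1 + x)
    have h2 := hf (1 + Complex.I • x)
    have h0 := hf x
    have h3 := hf 1
    simp only [star_add, star_one, add_mul, mul_add, one_mul, mul_one, map_add, star_smul,
      smul_mul_assoc, mul_smul_comm, map_smul, smul_eq_mul, Complex.star_def, Complex.conj_I] at h1 h2 h3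
    have i0 := (Complex.nonneg_iff.1 h0).2
    have i1 := (Complex.nonneg_iff.1 h1).2
    have i2 := (Complex.nonneg_iff.1 h2).2
    have i3 := (Complex.nonneg_iff.1 h3).2
    simp at i1 i2 i3
    apply Complex.ext
    · simp; linarith
    · simp; linarith
  have hps : (x.map f).PosSemidef := by
    refine Matrix.PosSemidef.of_dotProduct_mulVec_nonneg ?_ ?_
    · ext i j
      simp only [Matrix.conjTranspose_apply, Matrix.map_apply]
      rw [← hst, hw, hw, star_sum]
      simp
    · intro v
      have : star v ⬝ᵥ (x.map f).mulVec v =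
          ∑ l, f (star (∑ i, v i • w l i) * (∑ i, v i • w l i)) := by
        simp only [dotProduct, Matrix.mulVec, Matrix.map_apply, hw, map_sum, star_sum, Finset.sum_mul,
          Finset.mul_sum, star_smul, smul_mul_smul_comm, map_smul, smul_eq_mul, Pi.star_apply]
        rw [Finset.sum_comm]
        refine Eq.trans ?_ Finset.sum_comm
        refine Finset.sum_congr rfl fun i _ => ?_
        refine Eq.trans ?_ Finset.sum_comm
        refine Finset.sum_congr rfl fun j _ => ?_
        refine Finset.sum_congr rfl fun l _ => ?_
        ring
      rw [this]
      exact Finset.sum_nonneg fun l _ => hf _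
  open scoped MatrixOrder in
  exact (isPosElem_iff _).2 hps.nonneg

end

section
set_option linter.style.haveILetI false
set_option linter.unusedSectionVars false
open scoped ComplexOrder Matrix.Norms.L2Operator
open Filter Topology

theorem state_peak {D : Type*} [CStarAlgebra D] {h : D} (hpos : IsPosElem h) (hn : ‖h‖ = 1)
    {f : D →ₗ[ℂ] ℂ} (hf1 : f 1 = 1) (hfh : f h = 1) (hf : ∀ x, 0 ≤ f (star x * x)) (z : D) :
    f (z * h) = f z ∧ f (h * z) = f z := by
  letI := CStarAlgebra.spectralOrder D
  haveI := CStarAlgebra.spectralOrderedRing D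
  have h0 := (isPosElem_iff _).1 hpos
  have hcp := cp_of_state hf
  have h1 : h ≤ 1 := (CStarAlgebra.norm_le_one_iff_of_nonneg h h0).1 hn.le
  have hsa : star h = h := h0.isSelfAdjoint
  have e1 : 0 ≤ h * (1 - h) :=
    (((Commute.one_right h).sub_right (Commute.refl h))).mul_nonneg h0 (sub_nonneg.2 h1)
  have e2 : 0 ≤ f (h * (1 - h)) := by
    obtain ⟨y, hy⟩ := (isPosElem_iff _).2 e1
    rw [hy]; exact hf y
  have e3 : 0 ≤ f ((1 - h) * (1 - h)) := by
    have := hf (1 - h)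
    rwa [star_sub, star_one, hsa] at this
  have e4 : f ((1 - h) * (1 - h)) = - f (h * (1 - h)) := by
    have : (1 - h) * (1 - h) = 1 - h - h * (1 - h) := by noncomm_ring
    rw [this, map_sub, map_sub, hf1, hfh]; ring
  have e5 : f ((1 - h) * (1 - h)) = 0 := le_antisymm (by rw [e4]; exact neg_nonpos.2 e2) e3
  have key : ∀ z, f (z * (1 - h)) = 0 := by
    intro z
    obtain ⟨y0, y1, -, g2, -, g4⟩ := cp_vec hcp (star z) (1 - h)
    rw [star_star] at g2
    rw [star_sub, star_one, hsa, e5] at g4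
    have := cs_ineq y0 y1
    rw [← g2, ← g4] at this
    simpa using this
  have k1 : ∀ z, f (z * h) = f z := by
    intro z
    have := key z
    rw [mul_sub, mul_one, map_sub, sub_eq_zero] at this
    exact this.symm
  refine ⟨k1 z, ?_⟩
  have := k1 (star z)
  rw [← star_star (h * z), star_mul, hsa, hcp.star_map, this, hcp.star_map, star_star]

theorem peak {D : Type*} [CStarAlgebra D] {ι : Type} [Fintype ι] [DecidableEq ι]
    {χ : Matrix ι ι ℂ →ₗ[ℂ] D} (hχ : IsCompletelyPositive χ)
    (hmul : ∀ x y, χ x * χ y = χ 1 * χ (x * y)) (h0 : χ 1 ≠ 0) :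
    ∃ ρ : D →ₗ[ℂ] Matrix ι ι ℂ, IsCompletelyPositive ρ ∧ ρ 1 = 1 ∧
      (∀ d x, ρ (d * χ x) = (‖χ 1‖ : ℂ) • (ρ d * x)) ∧
      (∀ d x, ρ (χ x * d) = (‖χ 1‖ : ℂ) • (x * ρ d)) := by
  have hc : 0 < ‖χ 1‖ := norm_pos_iff.2 h0
  set c := ‖χ 1‖ with hcdef
  have hcC : (c : ℂ) ≠ 0 := by exact_mod_cast hc.ne'
  have hpos1 : IsPosElem (((c⁻¹ : ℝ) : ℂ) • χ 1) :=
    (cp_smul hχ (inv_nonneg.2 hc.le)).pos ⟨1, by simp⟩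
  have hn1 : ‖((c⁻¹ : ℝ) : ℂ) • χ 1‖ = 1 := by
    rw [norm_smul, Complex.norm_real, Real.norm_of_nonneg (inv_nonneg.2 hc.le), ← hcdef]
    exact inv_mul_cancel₀ hc.ne'
  obtain ⟨f, hf1, hfh, hf⟩ := exists_state hpos1 hn1
  have hpk := state_peak hpos1 hn1 hf1 hfh hf
  have hfcp := cp_of_state hf
  have pk1 : ∀ z, f (z * χ 1) = c * f z := by
    intro z
    have := (hpk z).1
    rw [mul_smul_comm, map_smul, smul_eq_mul] at this
    rw [← this]; push_cast; field_simp
  have pk2 : ∀ z, f (χ 1 * z) = c * f z := by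
    intro z
    have := (hpk z).2
    rw [smul_mul_assoc, map_smul, smul_eq_mul] at this
    rw [← this]; push_cast; field_simp
  have hcomm : ∀ x, χ x * χ 1 = χ 1 * χ x := fun x => by rw [hmul, mul_one]
  have hst : ∀ x, χ (star x) = star (χ x) := hχ.star_map
  let E : ι → ι → Matrix ι ι ℂ := fun i j => Matrix.single i j 1
  have hEs : ∀ i j, star (E i j) = E j i := by
    intro i j; simp [E, Matrix.star_eq_conjTranspose]
  have hEE : ∀ i j k l, E i j * E k l = if j = k then E i l else 0 := by
    intro i j k l
    by_cases h : j = k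
    · subst h; simp [E]
    · simp [E, h]
  obtain ⟨i0, hi0⟩ : ∃ i0, f (χ (E i0 i0)) ≠ 0 := by
    by_contra! hcon
    have : (1 : Matrix ι ι ℂ) = ∑ i, E i i := by
      ext a b
      simp [E, Matrix.sum_apply, Matrix.one_apply, Matrix.single_apply, Finset.sum_ite_eq, ite_and]
    have h2 : f (χ 1) = 0 := by
      conv_lhs => rw [this]
      rw [map_sum, map_sum]
      exact Finset.sum_eq_zero fun i _ => hcon i
    have h3 := pk1 1
    rw [one_mul, h2, hf1, mul_one] at h3
    exact hcC h3.symm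
  obtain ⟨s, hs0, hs⟩ : ∃ s : ℝ, 0 < s ∧ f (χ (E i0 i0)) = s := by
    have : IsPosElem (E i0 i0) := ⟨E i0 i0, by rw [hEs, hEE]; simp⟩
    obtain ⟨y, hy⟩ := (hfcp.comp hχ).pos this
    have hy' : f (χ (E i0 i0)) = star y * y := hy
    have e : star y * y = ((Complex.normSq y : ℝ) : ℂ) := by
      rw [Complex.star_def, Complex.normSq_eq_conj_mul_self]
    rw [e] at hy'
    refine ⟨_, lt_of_le_of_ne (Complex.normSq_nonneg y) ?_, hy'⟩
    intro h
    rw [← h] at hy'; exact hi0 (by simpa using hy')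
  let ρ0 : D →ₗ[ℂ] Matrix ι ι ℂ :=
    { toFun := fun d => Matrix.of fun i j => f (χ (E i0 i) * d * χ (E j i0))
      map_add' := fun x y => by ext i j; simp [mul_add, add_mul]
      map_smul' := fun r x => by ext i j; simp }
  have hρ0 : ∀ d i j, ρ0 d i j = f (χ (E i0 i) * d * χ (E j i0)) := fun _ _ _ => rfl
  have hρcp : IsCompletelyPositive ρ0 := by
    refine cp_of_gram_mat ρ0 fun k w => ?_
    obtain ⟨v, hv⟩ := hfcp.gram (m := Fin k × ι) (fun l (q : Fin k × ι) => w l q.1 * χ (E q.2 i0))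
    refine ⟨Fin k × ι, inferInstance, fun l p i => v l (p, i), fun p q i j => ?_⟩
    rw [hρ0, ← hv (p, i) (q, j), Finset.mul_sum, Finset.sum_mul]
    congr 1
    refine Finset.sum_congr rfl fun l _ => ?_
    rw [star_mul, ← hst, hEs]
    simp only [mul_assoc]
  have hρ01 : ρ0 1 = ((c * s : ℝ) : ℂ) • 1 := by
    ext i j
    rw [hρ0, mul_one, hmul, pk2, hEE]
    by_cases h : i = j
    · subst h; simp [hs]
    · simp [h]
  have hcs : (0 : ℝ) < c * s := by positivity
  have hcsC : ((c * s : ℝ) : ℂ) ≠ 0 := by exact_mod_cast hcs.ne'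
  have hdec1 : ∀ (x : Matrix ι ι ℂ) j, x * E j i0 = ∑ l, x l j • E l i0 := by
    intro x j
    ext a b
    simp [E, Matrix.mul_apply, Matrix.sum_apply, Matrix.single_apply, ite_and, Finset.sum_ite_eq]
  have hdec2 : ∀ (x : Matrix ι ι ℂ) i, E i0 i * x = ∑ l, x i l • E i0 l := by
    intro x j
    ext a b
    simp [E, Matrix.mul_apply, Matrix.sum_apply, Matrix.single_apply, ite_and, Finset.sum_ite_eq]
  refine ⟨(((c * s)⁻¹ : ℝ) : ℂ) • ρ0, cp_smul hρcp (inv_nonneg.2 hcs.le), ?_, ?_, ?_⟩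
  · rw [LinearMap.smul_apply, hρ01, smul_smul, Complex.ofReal_inv, inv_mul_cancel₀ hcsC, one_smul]
  · intro d x
    rw [LinearMap.smul_apply, LinearMap.smul_apply, smul_mul_assoc, smul_comm (c : ℂ)]
    congr 1
    ext i j
    rw [hρ0, Matrix.smul_apply, Matrix.mul_apply, ← mul_assoc (χ (E i0 i)), mul_assoc _ (χ x), hmul,
      ← hcomm, ← mul_assoc, pk1, hdec1, map_sum, Finset.mul_sum, map_sum, smul_eq_mul]
    congr 1
    refine Finset.sum_congr rfl fun l _ => ?_
    rw [hρ0, map_smul, mul_smul_comm, map_smul, smul_eq_mul, mul_comm]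
  · intro d x
    rw [LinearMap.smul_apply, LinearMap.smul_apply, mul_smul_comm, smul_comm (c : ℂ)]
    congr 1
    ext i j
    rw [hρ0, Matrix.smul_apply, Matrix.mul_apply, ← mul_assoc (χ (E i0 i)), hmul,
      mul_assoc, mul_assoc, pk2, hdec2, map_sum, Finset.sum_mul, map_sum, smul_eq_mul]
    congr 1
    refine Finset.sum_congr rfl fun l _ => ?_
    rw [hρ0, map_smul, smul_mul_assoc, map_smul, smul_eq_mul, ← mul_assoc]

end

section
set_option linter.style.haveILetI false
set_option linter.unusedSectionVars false
open scoped ComplexOrder Matrix.Norms.L2Operator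
open Filter Topology

theorem theta_comm {D B K : Type*} [CStarAlgebra D] [CStarAlgebra B] [Fintype K]
    (θ : K → B →ₗ[ℂ] D) (hθ : ∀ k, IsCompletelyPositive (θ k)) (hθ1 : ∀ k, ‖θ k 1‖ ≤ 1)
    {δ R : ℝ} (hδ : 0 ≤ δ) (hR : 1 ≤ R) (h1 : ‖∑ k, θ k 1 - 1‖ ≤ δ) {a : D} {b : B} (ha : ‖a‖ ≤ R)
    (hb : ‖∑ k, θ k b - a‖ ≤ δ) (hbs : ‖∑ k, θ k (star b) - star a‖ ≤ δ)
    (hbb : ‖∑ k, θ k (star b * b) - star a * a‖ ≤ δ) (k : K) :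
    ‖θ k b - θ k 1 * a‖ ^ 2 ≤ 4 * R ^ 2 * δ := by
  letI := CStarAlgebra.spectralOrder D
  haveI := CStarAlgebra.spectralOrderedRing D
  choose y0 y1 e1 e2 e3 e4 using fun k => cp_vec (hθ k) 1 b
  simp only [star_one, one_mul, mul_one] at e1 e2 e3
  let z : K → Fin 2 → D := fun k i => y1 k i - y0 k i * a
  let W : K → D := fun k => ∑ i, star (z k i) * z k i
  have hW0 : ∀ k, 0 ≤ W k := fun k => Finset.sum_nonneg fun i _ => star_mul_self_nonneg _
  have hW : ∀ k, W k = θ k (star b * b) - θ k (star b) * a - star a * θ k b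
      + star a * θ k 1 * a := by
    intro k
    rw [e1, e2, e3, e4]
    simp only [W, z, Fin.sum_univ_two, star_sub, star_mul]
    noncomm_ring
  have hz : θ k b - θ k 1 * a = ∑ i, star (y0 k i) * z k i := by
    rw [e1, e2]
    simp only [z, Fin.sum_univ_two]
    noncomm_ring
  have hsum : ∑ k, W k = (∑ k, θ k (star b * b) - star a * a) - (∑ k, θ k (star b) - star a) * a
      - star a * (∑ k, θ k b - a) + star a * (∑ k, θ k 1 - 1) * a := by
    simp only [hW, Finset.sum_add_distrib, Finset.sum_sub_distrib, ← Finset.sum_mul,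
      ← Finset.mul_sum]
    noncomm_ring
  have has : ‖star a‖ ≤ R := by rwa [norm_star]
  have hn : ‖∑ k, W k‖ ≤ 4 * R ^ 2 * δ := by
    rw [hsum]
    have n1 : ‖(∑ k, θ k (star b) - star a) * a‖ ≤ δ * R :=
      (norm_mul_le _ _).trans (mul_le_mul hbs ha (norm_nonneg _) hδ)
    have n2 : ‖star a * (∑ k, θ k b - a)‖ ≤ R * δ :=
      (norm_mul_le _ _).trans (mul_le_mul has hb (norm_nonneg _) (by linarith))
    have n3 : ‖star a * (∑ k, θ k 1 - 1) * a‖ ≤ R * δ * R :=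
      (norm_mul_le _ _).trans (mul_le_mul ((norm_mul_le _ _).trans
        (mul_le_mul has h1 (norm_nonneg _) (by linarith))) ha (norm_nonneg _)
          (mul_nonneg (by linarith) hδ))
    refine (norm_add_le _ _).trans ?_
    refine (add_le_add ((norm_sub_le _ _).trans (add_le_add (norm_sub_le _ _) le_rfl)) le_rfl).trans ?_
    have q1 : δ ≤ R * δ := le_mul_of_one_le_left hδ hR
    have q2 : R * δ ≤ R * (R * δ) := le_mul_of_one_le_left (by positivity) hR
    nlinarith
  have hle : ‖W k‖ ≤ ‖∑ k, W k‖ :=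
    CStarAlgebra.norm_le_norm_of_nonneg_of_le (hW0 k)
      (Finset.single_le_sum (f := W) (fun k _ => hW0 k) (Finset.mem_univ k))
  have := cs_ineq (y0 k) (z k)
  rw [← hz, ← e1] at this
  refine this.trans ?_
  calc _ ≤ 1 * (4 * R ^ 2 * δ) :=
        mul_le_mul (hθ1 k) (hle.trans hn) (norm_nonneg _) zero_le_one
    _ = _ := one_mul _

theorem norm_one_le' (B : Type*) [CStarAlgebra B] : ‖(1 : B)‖ ≤ 1 := by
  rcases subsingleton_or_nontrivial B with h | h
  · rw [Subsingleton.elim (1 : B) 0]; simp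
  · simp

theorem peak_step {D B ι : Type} [CStarAlgebra D] [CStarAlgebra B] [Fintype ι] [DecidableEq ι]
    {χ : Matrix ι ι ℂ →ₗ[ℂ] D} (hχ : IsCompletelyPositive χ)
    (hmul : ∀ x y, χ x * χ y = χ 1 * χ (x * y)) (hχ1 : ‖χ 1‖ ≤ 1)
    {ψ : B →ₗ[ℂ] Matrix ι ι ℂ} (hψ : IsCompletelyPositive ψ) (hψ1 : ‖ψ 1‖ ≤ 1)
    {ε' R δ1 κ : ℝ} (hε : 0 ≤ ε')  (hκ0 : 0 ≤ κ) (hκ : 2 * κ ≤ δ1)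
    (hsq : ∀ (B : Type) [CStarAlgebra B] (t : B), IsPosElem t → ‖t‖ ≤ 1 →
    ∃ u : B, star u = u ∧ u * u = t ∧ ∀ x, ‖x‖ ≤ R → ‖t * x - x * t‖ ≤ δ1 →
      ‖u * x - x * u‖ ≤ ε') :
    ∃ (ψ' : D →ₗ[ℂ] Matrix ι ι ℂ) (r : ℝ), 0 ≤ r ∧ IsCompletelyPositive ψ' ∧ ‖ψ' 1‖ ≤ 1 ∧
      ‖(r : ℂ) • χ 1‖ ≤ 1 ∧ ∀ a b, ‖a‖ ≤ R → ‖χ (ψ b) - χ (ψ 1) * a‖ ≤ κ →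
        ‖χ (ψ b) - a * χ (ψ 1)‖ ≤ κ →
        ∃ y, (r : ℂ) • χ y = χ (ψ b) ∧ ‖ψ' a - y‖ ≤ ε' + κ := by
  by_cases h0 : χ 1 = 0
  · have hz : ∀ x, χ x = 0 := fun x => by
      have := cp_norm hχ x
      rw [h0, norm_zero, mul_zero] at this
      exact norm_le_zero_iff.1 this
    refine ⟨0, 1, zero_le_one, cp_zero, by simp, by simp [h0], fun a b _ _ _ => ⟨0, by simp [hz], ?_⟩⟩
    simp; positivity
  obtain ⟨ρ, hρ, hρ1, hr1, hr2⟩ := peak hχ hmul h0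
  have hc : 0 < ‖χ 1‖ := norm_pos_iff.2 h0
  set c := ‖χ 1‖ with hcd
  have hcC : (c : ℂ) ≠ 0 := by exact_mod_cast hc.ne'
  have hρn : ∀ z, ‖ρ z‖ ≤ ‖z‖ := cp_norm_le hρ (by rw [hρ1]; exact norm_one_le' _)
  have htp : IsPosElem ((c : ℂ) • ψ 1) := (cp_smul hψ hc.le).pos ⟨1, by simp⟩
  have htn : ‖(c : ℂ) • ψ 1‖ ≤ 1 := by
    rw [norm_smul, Complex.norm_real, Real.norm_of_nonneg hc.le]
    exact mul_le_one₀ hχ1 (norm_nonneg _) hψ1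
  obtain ⟨u, hus, huu, hu⟩ := hsq _ _ htp htn
  have hun : ‖u‖ ≤ 1 := by
    have h1 : ‖u‖ * ‖u‖ ≤ 1 := by
      rw [← CStarRing.norm_star_mul_self, hus, huu]; exact htn
    nlinarith [norm_nonneg u]
  refine ⟨conjL u ∘ₗ ρ, c⁻¹, inv_nonneg.2 hc.le, (cp_conjL u).comp hρ, ?_, ?_, ?_⟩
  · rw [LinearMap.comp_apply, conjL_apply, hρ1, mul_one, hus, huu]; exact htn
  · rw [norm_smul, Complex.norm_real, Real.norm_of_nonneg (inv_nonneg.2 hc.le), ← hcd,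
      inv_mul_cancel₀ hc.ne']
  · intro a b ha k1 k2
    refine ⟨(c : ℂ) • ψ b, ?_, ?_⟩
    · rw [map_smul, smul_smul, Complex.ofReal_inv, inv_mul_cancel₀ hcC, one_smul]
    have y1 : ρ (χ (ψ b)) = (c : ℂ) • ψ b := by
      have := hr2 1 (ψ b)
      rwa [mul_one, hρ1, mul_one] at this
    have d1 : ‖(c : ℂ) • ψ b - ((c : ℂ) • ψ 1) * ρ a‖ ≤ κ := by
      refine le_trans ?_ ((hρn _).trans k1)
      rw [map_sub, y1, hr2, smul_mul_assoc]
    have d2 : ‖(c : ℂ) • ψ b - ρ a * ((c : ℂ) • ψ 1)‖ ≤ κ := by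
      refine le_trans ?_ ((hρn _).trans k2)
      rw [map_sub, y1, hr1, mul_smul_comm]
    set y := (c : ℂ) • ψ b
    set t := (c : ℂ) • ψ 1
    have d3 : ‖t * ρ a - ρ a * t‖ ≤ δ1 := by
      have : t * ρ a - ρ a * t = (y - ρ a * t) - (y - t * ρ a) := by abel
      rw [this]
      exact (norm_sub_le _ _).trans (by linarith)
    have d4 := hu (ρ a) ((hρn a).trans ha) d3
    rw [LinearMap.comp_apply, conjL_apply, hus]
    have : u * ρ a * u - y = (u * ρ a - ρ a * u) * u - (y - ρ a * t) := by
      rw [← huu]; noncomm_ring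
    rw [this]
    refine (norm_sub_le _ _).trans (add_le_add ((norm_mul_le _ _).trans ?_) d2)
    calc _ ≤ ε' * 1 := mul_le_mul d4 hun (norm_nonneg _) hε
      _ = ε' := mul_one _

theorem lemmaP {n : ℕ} {D : Type} [CStarAlgebra D]
    (H : ∀ (S : Finset D) (δ : ℝ), 0 < δ → ∃ (B : Type) (_ : CStarAlgebra B)
      (K : Type) (_ : Fintype K) (c : K → Fin (n + 1)) (ι : K → Type) (_ : ∀ k, Fintype (ι k))
      (_ : ∀ k, DecidableEq (ι k)) (ψ : ∀ k, B →ₗ[ℂ] Matrix (ι k) (ι k) ℂ)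
      (χ : ∀ k, Matrix (ι k) (ι k) ℂ →ₗ[ℂ] D),
      (∀ k, IsCompletelyPositive (ψ k)) ∧ (∀ k, ‖ψ k 1‖ ≤ 1) ∧ OZSys c χ ∧
      ‖∑ k, χ k (ψ k 1) - 1‖ ≤ δ ∧
      ∀ a ∈ S, ∃ b, ‖∑ k, χ k (ψ k b) - a‖ ≤ δ ∧ ‖∑ k, χ k (ψ k (star b)) - star a‖ ≤ δ ∧
        ‖∑ k, χ k (ψ k (star b * b)) - star a * a‖ ≤ δ ∧
        ‖∑ k, χ k (ψ k (b * star b)) - a * star a‖ ≤ δ) : ND n D := by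
  intro S ε hε
  let R : ℝ := 1 + ∑ a ∈ S, ‖a‖
  have hR : 1 ≤ R := by
    have : 0 ≤ ∑ a ∈ S, ‖a‖ := Finset.sum_nonneg fun _ _ => norm_nonneg _
    simp only [R]; linarith
  have hRa : ∀ a ∈ S, ‖a‖ ≤ R := fun a ha => by
    have := Finset.single_le_sum (f := fun a : D => ‖a‖) (fun _ _ => norm_nonneg _) ha
    simp only [R]; linarith
  let ε' : ℝ := ε / (4 * (n + 1))
  have hε' : 0 < ε' := by positivity
  obtain ⟨δ1, hδ1, hsq⟩ := comm_sqrt ε' R hε' (by linarith)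
  let κ : ℝ := min (δ1 / 2) ε'
  have hκ : 0 < κ := lt_min (by positivity) hε'
  have hκ1 : 2 * κ ≤ δ1 := by have := min_le_left (δ1 / 2) ε'; simp only [κ]; linarith
  have hκ2 : κ ≤ ε' := min_le_right _ _
  let δ : ℝ := min ((κ / (2 * R)) ^ 2) (ε / 4)
  have hδ : 0 < δ := lt_min (by positivity) (by positivity)
  have hδκ : 4 * R ^ 2 * δ ≤ κ ^ 2 := by
    calc 4 * R ^ 2 * δ ≤ 4 * R ^ 2 * (κ / (2 * R)) ^ 2 := by gcongr; exact min_le_left _ _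
      _ = κ ^ 2 := by field_simp; norm_num
  obtain ⟨B, _, K, _, c, ι, _, _, ψ, χ, hψ, hψ1, hχ, h1, hS⟩ := H S δ hδ
  choose! b hb1 hb2 hb3 hb4 using hS
  have hθ : ∀ k, IsCompletelyPositive (χ k ∘ₗ ψ k) := fun k => (hχ.cp k).comp (hψ k)
  have hθ1 : ∀ k, ‖(χ k ∘ₗ ψ k) 1‖ ≤ 1 := fun k =>
    (cp_norm_le (hχ.cp k) (hχ.norm k) _).trans (hψ1 k)
  have kk1 : ∀ k, ∀ a ∈ S, ‖χ k (ψ k (b a)) - χ k (ψ k 1) * a‖ ≤ κ := by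
    intro k a ha
    refine le_of_sq_le_sq ?_ hκ.le
    exact (theta_comm (fun k => χ k ∘ₗ ψ k) hθ hθ1 hδ.le hR h1 (hRa a ha) (hb1 a ha) (hb2 a ha)
      (hb3 a ha) k).trans hδκ
  have kk2 : ∀ k, ∀ a ∈ S, ‖χ k (ψ k (b a)) - a * χ k (ψ k 1)‖ ≤ κ := by
    intro k a ha
    refine le_of_sq_le_sq ?_ hκ.le
    have := (theta_comm (fun k => χ k ∘ₗ ψ k) hθ hθ1 hδ.le hR h1 (a := star a) (b := star (b a))
      (by rw [norm_star]; exact hRa a ha) (hb2 a ha) (by simpa using hb1 a ha)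
      (by simpa using hb4 a ha) k).trans hδκ
    rw [(hθ k).star_map, ← norm_star, star_sub, star_mul, star_star, star_star,
      ← (hθ k).star_map, star_one] at this
    exact this
  choose ψ' r hr hψ' hψ'1 hr1 hy using fun k => peak_step (hχ.cp k) (hχ.mul k) (hχ.norm k)
    (hψ k) (hψ1 k) hε'.le hκ.le hκ1 hsq
  have hφ' : OZSys c (fun k => (r k : ℂ) • χ k) :=
    { cp := fun k => cp_smul (hχ.cp k) (hr k)
      mul := fun k x y => by
        simp only [LinearMap.smul_apply, smul_mul_smul_comm, hχ.mul k x y]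
      norm := fun k => hr1 k
      orth := fun k l hkl hc => by
        simp only [LinearMap.smul_apply, smul_mul_smul_comm, hχ.orth k l hkl hc, smul_zero] }
  refine ⟨K, inferInstance, c, ι, inferInstance, inferInstance, ψ', _, hψ', hψ'1, hφ', ?_⟩
  intro a ha
  choose y hy1 hy2 using fun k => hy k a (b a) (hRa a ha) (kk1 k a ha) (kk2 k a ha)
  have e : ∑ k, ((r k : ℂ) • χ k) (ψ' k a) - a = ∑ k, ((r k : ℂ) • χ k) (ψ' k a - y k)
      + (∑ k, χ k (ψ k (b a)) - a) := by
    simp only [map_sub, Finset.sum_sub_distrib]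
    have : ∑ k, ((r k : ℂ) • χ k) (y k) = ∑ k, χ k (ψ k (b a)) :=
      Finset.sum_congr rfl fun k _ => hy1 k
    rw [this]; abel
  rw [e]
  have e1 := hφ'.total_norm (fun k => ψ' k a - y k) (M := ε' + κ) (by positivity) hy2
  have e2 := (hb1 a ha).trans (min_le_right _ _ : δ ≤ ε / 4)
  have e3 : (ε' + κ) * (n + 1) ≤ ε / 2 := by
    calc (ε' + κ) * (n + 1) ≤ (ε' + ε') * (n + 1) := by gcongr
      _ = ε / 2 := by simp only [ε']; field_simp; norm_num
  calc _ ≤ _ := norm_add_le _ _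
    _ ≤ ε / 2 + ε / 4 := add_le_add (e1.trans e3) e2
    _ < ε := by linarith

end

section
set_option linter.style.haveILetI false
set_option linter.unusedSectionVars false
open scoped ComplexOrder Matrix.Norms.L2Operator
open Filter Topology

section Polar
variable {B : Type*} [CStarAlgebra B] [PartialOrder B] [StarOrderedRing B]

theorem spec_Icc {a : B} (h0 : 0 ≤ a) (h1 : ‖a‖ ≤ 1) : ∀ s ∈ spectrum ℝ a, s ∈ Set.Icc (0 : ℝ) 1 := by
  intro s hs
  refine ⟨spectrum_nonneg_of_nonneg h0 hs, ?_⟩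
  rcases subsingleton_or_nontrivial B with hB | hB
  · simp at hs
  · exact (le_abs_self s).trans ((spectrum.norm_le_norm_of_mem hs).trans h1)

theorem cfc_conj_bound {g a : B} (hg : star g = g) (ha0 : 0 ≤ a) (ha1 : ‖a‖ ≤ 1) {lam : ℝ}
    (hl : 0 < lam) (hle : lam • (g * g) ≤ a) {q : ℝ → ℝ} (hq : Continuous q) {M : ℝ} (hM : 0 ≤ M)
    (hq0 : ∀ t ∈ Set.Icc (0 : ℝ) 1, 0 ≤ q t) (hqM : ∀ t ∈ Set.Icc (0 : ℝ) 1, t * q t ≤ M) :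
    ‖g * cfc q a * g‖ ≤ lam⁻¹ * M := by
  have hsp := spec_Icc ha0 ha1
  have hsa : IsSelfAdjoint a := ha0.isSelfAdjoint
  let Y := cfc (fun t => Real.sqrt (q t)) a
  have hYs : star Y = Y := cfc_predicate (R := ℝ) (p := IsSelfAdjoint) _ a
  have hYY : Y * Y = cfc q a := by
    rw [← cfc_mul _ _ _]
    exact cfc_congr fun s hs => Real.mul_self_sqrt (hq0 s (hsp s hs))
  have hYaY : Y * a * Y = cfc (fun t => t * q t) a := by
    have : Y * a * Y = cfc (fun t => Real.sqrt (q t) * t * Real.sqrt (q t)) a := by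
      rw [cfc_mul _ _ _, cfc_mul _ _ _, cfc_id' ℝ a]
    rw [this]
    refine cfc_congr fun s hs => ?_
    have := Real.mul_self_sqrt (hq0 s (hsp s hs))
    linear_combination s * this
  have h1 : ‖g * cfc q a * g‖ = ‖Y * (g * g) * Y‖ := by
    have e1 : g * cfc q a * g = star (Y * g) * (Y * g) := by
      rw [star_mul, hYs, hg, ← hYY]; noncomm_ring
    have e2 : Y * (g * g) * Y = (Y * g) * star (Y * g) := by
      rw [star_mul, hYs, hg]; noncomm_ring
    rw [e1, e2, CStarRing.norm_star_mul_self, CStarRing.norm_self_mul_star]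
  rw [h1]
  have h2 : Y * (g * g) * Y ≤ lam⁻¹ • (Y * a * Y) := by
    have := star_left_conjugate_le_conjugate hle Y
    rw [hYs, mul_smul_comm, smul_mul_assoc] at this
    calc Y * (g * g) * Y = lam⁻¹ • (lam • (Y * (g * g) * Y)) := by
          rw [smul_smul, inv_mul_cancel₀ hl.ne', one_smul]
      _ ≤ _ := smul_le_smul_of_nonneg_left this (inv_nonneg.2 hl.le)
  have h3 : 0 ≤ Y * (g * g) * Y := by
    have : Y * (g * g) * Y = (Y * g) * star (Y * g) := by
      rw [star_mul, hYs, hg]; noncomm_ring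
    rw [this]; exact mul_star_self_nonneg _
  refine (CStarAlgebra.norm_le_norm_of_nonneg_of_le h3 h2).trans ?_
  rw [norm_smul, Real.norm_of_nonneg (inv_nonneg.2 hl.le), hYaY]
  gcongr
  refine norm_cfc_le hM fun s hs => ?_
  rw [Real.norm_of_nonneg (mul_nonneg (hsp s hs).1 (hq0 s (hsp s hs)))]
  exact hqM s (hsp s hs)

theorem polar_aux (s t : ℝ) (hs : 0 < s) (ht : 0 ≤ t) :
    0 ≤ Real.sqrt t - t * (Real.sqrt (max t s))⁻¹ ∧
    Real.sqrt t - t * (Real.sqrt (max t s))⁻¹ ≤ Real.sqrt s ∧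
    0 ≤ 1 - t * ((Real.sqrt (max t s))⁻¹) ^ 2 ∧
    t * (1 - t * ((Real.sqrt (max t s))⁻¹) ^ 2) ≤ s := by
  have hm : 0 < max t s := lt_of_lt_of_le hs (le_max_right _ _)
  have hm' := Real.sqrt_pos.2 hm
  rw [inv_pow, Real.sq_sqrt hm.le]
  rcases le_total s t with h | h
  · have ht' : 0 < t := lt_of_lt_of_le hs h
    have e1 : t * (Real.sqrt t)⁻¹ = Real.sqrt t := by
      rw [← div_eq_mul_inv, Real.div_sqrt]
    rw [max_eq_left h, e1, mul_inv_cancel₀ ht'.ne']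
    simp [hs.le]
  · rw [max_eq_right h]
    have h1 : Real.sqrt t ≤ Real.sqrt s := Real.sqrt_le_sqrt h
    have hs' := Real.sqrt_pos.2 hs
    have h2 : t * (Real.sqrt s)⁻¹ ≤ Real.sqrt t := by
      rw [← div_eq_mul_inv, div_le_iff₀ hs']
      nlinarith [Real.mul_self_sqrt ht, Real.sqrt_nonneg t]
    have h3 : t * s⁻¹ ≤ 1 := by rw [← div_eq_mul_inv, div_le_one hs]; exact h
    have h4 : 0 ≤ t * s⁻¹ := by positivity
    have h5 : 0 ≤ t * (Real.sqrt s)⁻¹ := by positivity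
    refine ⟨by linarith, by linarith, by linarith, ?_⟩
    nlinarith

theorem polar {g p : B} (hg0 : 0 ≤ g) (hg1 : ‖g‖ ≤ 1) (hp : p * p = p) (hps : star p = p)
    {lam : ℝ} (hl : 0 < lam) (hle : lam • (g * g) ≤ g * p * g) :
    ∃ v, p * v = v ∧ star v * v = g * g ∧ g * v = CFC.sqrt (g * p * g) * g := by
  have hg : star g = g := hg0.isSelfAdjoint
  set a := g * p * g with ha
  have haa : a = star (p * g) * (p * g) := by
    rw [star_mul, hps, hg, ha, mul_assoc g p (p * g), ← mul_assoc p p g, hp, ← mul_assoc]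
  have hag : ∀ z, g * (p * (g * z)) = a * z := by intro z; rw [ha]; simp only [mul_assoc]
  have ha0 : 0 ≤ a := by rw [haa]; exact star_mul_self_nonneg _
  have hpn : ‖p‖ ≤ 1 := by
    have : ‖p‖ * ‖p‖ = ‖p‖ := by rw [← CStarRing.norm_star_mul_self, hps, hp]
    nlinarith [norm_nonneg p]
  have hpg : ‖p * g‖ ≤ 1 := (norm_mul_le _ _).trans (mul_le_one₀ hpn (norm_nonneg _) hg1)
  have ha1 : ‖a‖ ≤ 1 := by
    rw [haa, CStarRing.norm_star_mul_self]; exact mul_le_one₀ hpg (norm_nonneg _) hpg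
  have hsa : IsSelfAdjoint a := ha0.isSelfAdjoint
  have hsp := spec_Icc ha0 ha1
  let f : ℕ → ℝ → ℝ := fun m t => (Real.sqrt (max t (1 / ((m : ℝ) + 1))))⁻¹
  have hs : ∀ m : ℕ, (0 : ℝ) < 1 / ((m : ℝ) + 1) := fun m => by positivity
  have hfc : ∀ m, Continuous (f m) := fun m => by
    refine Continuous.inv₀ (by fun_prop) fun t => ?_
    exact (Real.sqrt_pos.2 (lt_of_lt_of_le (hs m) (le_max_right _ _))).ne'
  have hfc' : ∀ m, ContinuousOn (f m) (spectrum ℝ a) := fun m => (hfc m).continuousOn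
  let X : ℕ → B := fun m => p * g * cfc (f m) a * g
  have hFs : ∀ q : ℝ → ℝ, star (cfc q a) = cfc q a := fun q =>
    cfc_predicate (R := ℝ) (p := IsSelfAdjoint) _ a
  have hXX : ∀ q : ℝ → ℝ, Continuous q → star (p * g * cfc q a * g) * (p * g * cfc q a * g)
      = g * cfc (fun t => t * q t ^ 2) a * g := by
    intro q hq
    have : cfc (fun t => t * q t ^ 2) a = cfc q a * a * cfc q a := by
      rw [show (fun t => t * q t ^ 2) = (fun t => q t * t * q t) by ext t; ring,
        cfc_mul _ _ _, cfc_mul _ _ _, cfc_id' ℝ a]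
    rw [this]
    simp only [star_mul, hFs, hg, hps]
    simp only [mul_assoc]
    rw [← mul_assoc p p, hp, hag]
  have hcau : CauchySeq X := by
    refine cauchySeq_of_le_tendsto_0 (fun N : ℕ => Real.sqrt (lam⁻¹ * (1 / ((N : ℝ) + 1)))) ?_ ?_
    · intro i j N hi hj
      rw [dist_eq_norm]
      refine Real.le_sqrt_of_sq_le ?_
      have e : X i - X j = p * g * cfc (fun t => f i t - f j t) a * g := by
        rw [cfc_sub _ _ _]; simp only [X]; noncomm_ring
      rw [e, sq, ← CStarRing.norm_star_mul_self, hXX (fun t => f i t - f j t) ((hfc i).sub (hfc j))]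
      refine cfc_conj_bound hg ha0 ha1 hl hle ?_ (hs N).le ?_ ?_
      · have := hfc i; have := hfc j; fun_prop
      · intro t ht; exact mul_nonneg ht.1 (sq_nonneg _)
      · intro t ht
        have a1 := polar_aux _ t (hs i) ht.1
        have a2 := polar_aux _ t (hs j) ht.1
        have s1 : Real.sqrt (1 / ((i : ℝ) + 1)) ≤ Real.sqrt (1 / ((N : ℝ) + 1)) := by
          apply Real.sqrt_le_sqrt; gcongr
        have s2 : Real.sqrt (1 / ((j : ℝ) + 1)) ≤ Real.sqrt (1 / ((N : ℝ) + 1)) := by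
          apply Real.sqrt_le_sqrt; gcongr
        have : t * (t * (f i t - f j t) ^ 2) = (t * f i t - t * f j t) ^ 2 := by ring
        rw [this, ← Real.sq_sqrt (hs N).le]
        apply sq_le_sq'
        · simp only [f]; linarith [a1.1, a1.2.1, a2.1, a2.2.1]
        · simp only [f]; linarith [a1.1, a1.2.1, a2.1, a2.2.1]
    · have h := tendsto_one_div_add_atTop_nhds_zero_nat (𝕜 := ℝ)
      have h2 := (Real.continuous_sqrt.tendsto _).comp (h.const_mul lam⁻¹)
      simpa [Function.comp_def] using h2
  obtain ⟨v, hv⟩ := cauchySeq_tendsto_of_complete hcau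
  refine ⟨v, ?_, ?_, ?_⟩
  · refine tendsto_nhds_unique (hv.const_mul p) (hv.congr fun m => ?_)
    simp only [X, ← mul_assoc]; rw [hp]
  · refine tendsto_nhds_unique (hv.star.mul hv) ?_
    rw [tendsto_iff_norm_sub_tendsto_zero]
    have h := (tendsto_one_div_add_atTop_nhds_zero_nat (𝕜 := ℝ)).const_mul lam⁻¹
    rw [mul_zero] at h
    refine squeeze_zero (fun _ => norm_nonneg _) (fun m => ?_) h
    have e : star (X m) * X m - g * g = -(g * cfc (fun t => 1 - t * f m t ^ 2) a * g) := by
      have := hfc m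
      rw [hXX _ this, cfc_sub _ _ _, cfc_const_one ℝ a]; noncomm_ring
    rw [e, norm_neg]
    refine cfc_conj_bound hg ha0 ha1 hl hle ?_ (hs m).le ?_ ?_
    · have := hfc m; fun_prop
    · intro t ht; exact (polar_aux _ t (hs m) ht.1).2.2.1
    · intro t ht; exact (polar_aux _ t (hs m) ht.1).2.2.2
  · have hsq : CFC.sqrt a = cfc Real.sqrt a := by
      refine CFC.sqrt_unique ?_ (cfc_nonneg fun _ _ => Real.sqrt_nonneg _)
      rw [← cfc_mul _ _ _]
      conv_rhs => rw [← cfc_id ℝ a]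
      exact cfc_congr fun s hs => Real.mul_self_sqrt (hsp s hs).1
    rw [hsq]
    refine tendsto_nhds_unique (hv.const_mul g) ?_
    rw [tendsto_iff_norm_sub_tendsto_zero]
    have h := (Real.continuous_sqrt.tendsto _).comp (tendsto_one_div_add_atTop_nhds_zero_nat (𝕜 := ℝ))
    rw [Real.sqrt_zero] at h
    refine squeeze_zero (fun _ => norm_nonneg _) (fun m => ?_) h
    have e : g * X m - cfc Real.sqrt a * g = - (cfc (fun t => Real.sqrt t - t * f m t) a * g) := by
      rw [cfc_sub _ _ _ (by fun_prop) (by have := hfc m; fun_prop), cfc_mul _ _ _, cfc_id' ℝ a]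
      simp only [X]
      simp only [mul_assoc, hag]
      noncomm_ring
    rw [e, norm_neg]
    refine (norm_mul_le _ _).trans ((mul_le_of_le_one_right (norm_nonneg _) hg1).trans ?_)
    refine norm_cfc_le (Real.sqrt_nonneg _) fun t ht => ?_
    have := polar_aux _ t (hs m) (hsp t ht).1
    rw [Real.norm_of_nonneg this.1]
    exact this.2.1

end Polar

end

section
set_option linter.style.haveILetI false
set_option linter.unusedSectionVars false
open scoped ComplexOrder Matrix.Norms.L2Operator
open Filter Topology

section LemV
variable {B : Type*} [CStarAlgebra B]

theorem proj_norm {p : B} (hp : p * p = p) (hps : star p = p) : ‖p‖ ≤ 1 := by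
  have : ‖p‖ * ‖p‖ = ‖p‖ := by rw [← CStarRing.norm_star_mul_self, hps, hp]
  nlinarith [norm_nonneg p]

variable [PartialOrder B] [StarOrderedRing B]

theorem lemV_fun {y : ℝ} (hy : 0 < y) : ∃ f r : ℝ → ℝ, Continuous f ∧ (∀ t, 0 ≤ f t) ∧
    (∀ t, f t ≤ 1) ∧ (∀ t, 2 * y ≤ t → f t = 1) ∧ Continuous r ∧ (∀ t, 0 ≤ r t) ∧
    (∀ t, r t ≤ y⁻¹) ∧ ∀ t, t * r t * f t = f t := by
  refine ⟨fun t => max 0 (min 1 (t / y - 1)), fun t => (max t y)⁻¹, by fun_prop,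
    fun t => le_max_left _ _, fun t => max_le zero_le_one (min_le_left _ _), ?_, ?_, ?_, ?_, ?_⟩
  · intro t h2
    have h3 : 2 ≤ t / y := by rw [le_div_iff₀ hy]; exact h2
    change max 0 (min 1 (t / y - 1)) = 1
    rw [min_eq_left (by linarith), max_eq_right zero_le_one]
  · exact Continuous.inv₀ (by fun_prop) fun t => (lt_of_lt_of_le hy (le_max_right _ _)).ne'
  · exact fun t => inv_nonneg.2 (hy.le.trans (le_max_right _ _))
  · exact fun t => inv_anti₀ hy (le_max_right _ _)
  · intro t
    change t * (max t y)⁻¹ * max 0 (min 1 (t / y - 1)) = max 0 (min 1 (t / y - 1))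
    rcases le_total t y with ht | ht
    · have : max 0 (min 1 (t / y - 1)) = 0 := by
        apply max_eq_left
        refine (min_le_right _ _).trans ?_
        have : t / y ≤ 1 := (div_le_one hy).2 ht
        linarith
      rw [this, mul_zero]
    · rw [max_eq_left ht, mul_inv_cancel₀ (hy.trans_le ht).ne', one_mul]

set_option maxHeartbeats 1000000 in
theorem lemV {h p : B} (hh0 : 0 ≤ h) (hh1 : ‖h‖ ≤ 1) (hp : p * p = p) (hps : star p = p)
    {m y : ℝ} (hm0 : 0 ≤ m) (hm : ‖(1 - p) * h‖ ≤ m) (hy : 0 < y) (hmy : m ≤ y / 2) :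
    ∃ v g : B, p * v = v ∧ star g = g ∧ ‖g‖ ≤ 1 ∧ star v * v = g * g ∧
      (∀ x, Commute h x → Commute g x) ∧ ‖v - g‖ ≤ 2 * (m / y) ∧
      ‖(1 - g * g) * h * (1 - g * g)‖ ≤ 2 * y := by
  have hsp := spec_Icc hh0 hh1
  have hsa : IsSelfAdjoint h := hh0.isSelfAdjoint
  obtain ⟨f, r, hf, hf0, hf1, hf2, hr, hr0, hr1, hrf⟩ := lemV_fun hy
  let g := cfc f h
  have hg0 : 0 ≤ g := cfc_nonneg fun t _ => hf0 t
  have hg : star g = g := hg0.isSelfAdjoint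
  have hg1 : ‖g‖ ≤ 1 := norm_cfc_le zero_le_one fun t _ => by
    rw [Real.norm_of_nonneg (hf0 t)]; exact hf1 t
  let X := (1 - p) * h * cfc r h
  have hXg : (1 - p) * g = X * g := by
    have : h * cfc r h * g = g := by
      have : cfc (fun t => t * r t * f t) h = h * cfc r h * g := by
        rw [cfc_mul _ _ _, cfc_mul _ _ _, cfc_id' ℝ h]
      rw [← this]; exact cfc_congr fun t _ => hrf t
    calc (1 - p) * g = (1 - p) * (h * cfc r h * g) := by rw [this]
      _ = X * g := by simp only [X, mul_assoc]
  have hX : ‖X‖ ≤ m / y := by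
    refine (norm_mul_le _ _).trans ?_
    rw [div_eq_mul_inv]
    refine mul_le_mul hm ?_ (norm_nonneg _) hm0
    refine norm_cfc_le (inv_nonneg.2 hy.le) fun t _ => ?_
    rw [Real.norm_of_nonneg (hr0 t)]
    exact hr1 t
  set η := m / y with hη
  have hη0 : 0 ≤ η := by positivity
  have hη2 : η ≤ 1 / 2 := by rw [hη, div_le_iff₀ hy]; linarith
  have hq : g * (1 - p) * g = star (X * g) * (X * g) := by
    rw [← hXg, star_mul, star_sub, star_one, hps, hg]
    have : (1 - p) * (1 - p) = 1 - p := by simp [mul_sub, sub_mul, hp]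
    calc g * (1 - p) * g = g * ((1 - p) * (1 - p)) * g := by rw [this]
      _ = _ := by simp only [mul_assoc]
  have hq0 : 0 ≤ g * (1 - p) * g := by rw [hq]; exact star_mul_self_nonneg _
  have hgg0 : 0 ≤ g * g := by
    have := star_mul_self_nonneg g
    rwa [hg] at this
  have hq1 : g * (1 - p) * g ≤ (η ^ 2) • (g * g) := by
    have h1 : g * (1 - p) * g = star g * (star X * X) * g := by
      rw [hq, star_mul]; simp only [mul_assoc]
    rw [h1]
    refine (CStarAlgebra.star_left_conjugate_le_norm_smul (hb := IsSelfAdjoint.star_mul_self X)).trans ?_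
    rw [hg, CStarRing.norm_star_mul_self]
    refine smul_le_smul_of_nonneg_right ?_ hgg0
    nlinarith [norm_nonneg X]
  have hsplit : g * p * g = g * g - g * (1 - p) * g := by noncomm_ring
  set a := g * p * g with ha
  have hle : (1 - η ^ 2) • (g * g) ≤ a := by
    rw [hsplit, sub_smul, one_smul]
    exact sub_le_sub_left hq1 _
  have hage : a ≤ g * g := by rw [hsplit]; exact sub_le_self _ hq0
  have hl : 0 < 1 - η ^ 2 := by nlinarith
  obtain ⟨v, hv1, hv2, hv3⟩ := polar hg0 hg1 hp hps hl hle
  rw [← ha] at hv3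
  have s1 : CFC.sqrt a ≤ g := by
    have := CFC.sqrt_le_sqrt _ _ hage
    rwa [CFC.sqrt_mul_self g hg0] at this
  have s2 : Real.sqrt (1 - η ^ 2) • g ≤ CFC.sqrt a := by
    have := CFC.sqrt_le_sqrt _ _ hle
    rwa [CFC.sqrt_unique (b := Real.sqrt (1 - η ^ 2) • g)
      (by rw [smul_mul_smul_comm, Real.mul_self_sqrt hl.le])
      (smul_nonneg (Real.sqrt_nonneg _) hg0)] at this
  have s3 : 1 - η ^ 2 ≤ Real.sqrt (1 - η ^ 2) := by
    apply Real.le_sqrt_of_sq_le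
    nlinarith [sq_nonneg η]
  have s4 : ‖g - CFC.sqrt a‖ ≤ η ^ 2 := by
    have b1 : 0 ≤ g - CFC.sqrt a := sub_nonneg.2 s1
    have b2 : g - CFC.sqrt a ≤ (1 - Real.sqrt (1 - η ^ 2)) • g := by
      rw [sub_smul, one_smul]; exact sub_le_sub_left s2 _
    refine (CStarAlgebra.norm_le_norm_of_nonneg_of_le b1 b2).trans ?_
    have b3 : Real.sqrt (1 - η ^ 2) ≤ 1 := Real.sqrt_le_one.2 (by nlinarith [sq_nonneg η])
    rw [norm_smul, Real.norm_of_nonneg (by linarith)]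
    nlinarith [norm_nonneg g]
  refine ⟨v, g, hv1, hg, hg1, hv2, fun x hx => hx.cfc_real f, ?_, ?_⟩
  · have hs : star (CFC.sqrt a) = CFC.sqrt a := (CFC.sqrt_nonneg a).isSelfAdjoint
    have hv4 : star v * g = g * CFC.sqrt a := by
      have := congrArg star hv3
      rwa [star_mul, star_mul, hg, hs] at this
    have e : star (v - g) * (v - g) = (g - CFC.sqrt a) * g + g * (g - CFC.sqrt a) := by
      calc star (v - g) * (v - g) = star v * v - star v * g - g * v + g * g := by
            rw [star_sub, hg]; noncomm_ring
        _ = _ := by rw [hv2, hv4, hv3]; noncomm_ring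
    have n1 : ‖v - g‖ * ‖v - g‖ ≤ η ^ 2 + η ^ 2 := by
      rw [← CStarRing.norm_star_mul_self, e]
      refine (norm_add_le _ _).trans (add_le_add ?_ ?_)
      · exact (norm_mul_le _ _).trans ((mul_le_of_le_one_right (norm_nonneg _) hg1).trans s4)
      · exact (norm_mul_le _ _).trans ((mul_le_of_le_one_left (norm_nonneg _) hg1).trans s4)
    nlinarith [norm_nonneg (v - g)]
  · have e : (1 - g * g) * h * (1 - g * g) = cfc (fun t => (1 - f t * f t) * t * (1 - f t * f t)) h := by
      rw [cfc_mul _ _ _, cfc_mul _ _ _, cfc_sub _ _ _, cfc_mul f f _, cfc_id' ℝ h,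
        cfc_const_one ℝ h]
    rw [e]
    refine norm_cfc_le (by positivity) fun t ht => ?_
    have ht0 := (hsp t ht).1
    have c1 : 0 ≤ 1 - f t * f t := by nlinarith [hf0 t, hf1 t]
    have c2 : 1 - f t * f t ≤ 1 := by nlinarith [hf0 t, hf1 t]
    rw [Real.norm_of_nonneg (by positivity)]
    rcases le_total (2 * y) t with h2 | h2
    · have : f t = 1 := hf2 t h2
      rw [this]; simp [hy.le]
    · calc (1 - f t * f t) * t * (1 - f t * f t) ≤ 1 * t * 1 := by gcongr
        _ ≤ _ := by linarith

end LemV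

end

section
set_option linter.style.haveILetI false
set_option linter.unusedSectionVars false
open scoped ComplexOrder Matrix.Norms.L2Operator
open Filter Topology

section Compress
variable {ι κ : Type} [Fintype ι] [DecidableEq ι] [Fintype κ] [DecidableEq κ]

def compL (V : Matrix ι κ ℂ) : Matrix ι ι ℂ →ₗ[ℂ] Matrix κ κ ℂ where
  toFun x := V.conjTranspose * x * V
  map_add' x y := by rw [Matrix.mul_add, Matrix.add_mul]
  map_smul' c x := by simp

def expL (V : Matrix ι κ ℂ) : Matrix κ κ ℂ →ₗ[ℂ] Matrix ι ι ℂ where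
  toFun x := V * x * V.conjTranspose
  map_add' x y := by rw [Matrix.mul_add, Matrix.add_mul]
  map_smul' c x := by simp

theorem compL_apply (V : Matrix ι κ ℂ) (x) : compL V x = V.conjTranspose * x * V := rfl
theorem expL_apply (V : Matrix ι κ ℂ) (x) : expL V x = V * x * V.conjTranspose := rfl

theorem cp_compL (V : Matrix ι κ ℂ) : IsCompletelyPositive (compL V) := by
  refine cp_of_gram_mat _ fun k w => ⟨Fin k × ι, inferInstance, fun l p i => (w l.1 p * V) l.2 i, ?_⟩
  intro p q i j
  have : compL V (∑ l, star (w l p) * w l q) =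
      ∑ l, (w l p * V).conjTranspose * (w l q * V) := by
    rw [map_sum]
    refine Finset.sum_congr rfl fun l _ => ?_
    rw [compL_apply, Matrix.conjTranspose_mul, Matrix.star_eq_conjTranspose]
    simp only [Matrix.mul_assoc]
  rw [this, Matrix.sum_apply, Fintype.sum_prod_type]
  refine Finset.sum_congr rfl fun l _ => ?_
  rw [Matrix.mul_apply]
  rfl

theorem expL_mul {V : Matrix ι κ ℂ} (hV : V.conjTranspose * V = 1) (x y) :
    expL V (x * y) = expL V x * expL V y := by
  simp only [expL_apply]
  calc V * (x * y) * V.conjTranspose = V * x * (1 : Matrix κ κ ℂ) * y * V.conjTranspose := by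
        simp only [Matrix.mul_assoc, Matrix.one_mul]
    _ = _ := by rw [← hV]; simp only [Matrix.mul_assoc]

theorem cp_expL {V : Matrix ι κ ℂ} (hV : V.conjTranspose * V = 1) :
    IsCompletelyPositive (expL V) := by
  refine cp_of_hom _ (expL_mul hV) fun x => ?_
  simp only [expL_apply, Matrix.star_eq_conjTranspose, Matrix.conjTranspose_mul,
    Matrix.conjTranspose_conjTranspose, Matrix.mul_assoc]

theorem iso_norm {V : Matrix ι κ ℂ} (hV : V.conjTranspose * V = 1) : ‖V‖ ≤ 1 := by
  have h1 := Matrix.l2_opNorm_conjTranspose_mul_self V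
  rw [hV] at h1
  have h2 : ‖(1 : Matrix κ κ ℂ)‖ ≤ 1 := norm_one_le' _
  nlinarith [norm_nonneg V]

theorem compL_norm {V : Matrix ι κ ℂ} (hV : V.conjTranspose * V = 1) (x) : ‖compL V x‖ ≤ ‖x‖ := by
  have h := iso_norm hV
  rw [compL_apply]
  refine (Matrix.l2_opNorm_mul _ _).trans ?_
  refine (mul_le_of_le_one_right (norm_nonneg _) h).trans ?_
  refine (Matrix.l2_opNorm_mul _ _).trans ?_
  rw [Matrix.l2_opNorm_conjTranspose]
  exact mul_le_of_le_one_left (norm_nonneg _) h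

theorem spec_iso (s : Matrix ι ι ℂ) (hs : IsPosElem s) {y : ℝ} (hy : 0 < y) :
    ∃ (κ : Type) (_ : Fintype κ) (_ : DecidableEq κ) (V : Matrix ι κ ℂ),
      V.conjTranspose * V = 1 ∧ IsPosElem (s - (y : ℂ) • (V * V.conjTranspose)) ∧
      ‖(1 - V * V.conjTranspose) * s * (1 - V * V.conjTranspose)‖ ≤ y := by
  have hh : s.IsHermitian := by
    obtain ⟨z, rfl⟩ := hs
    exact Matrix.isHermitian_conjTranspose_mul_self z
  have hpos : s.PosSemidef := by
    obtain ⟨z, rfl⟩ := hs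
    exact Matrix.posSemidef_conjTranspose_mul_self z
  set U : Matrix ι ι ℂ := (hh.eigenvectorUnitary : Matrix ι ι ℂ) with hU
  have hU1 : star U * U = 1 := Unitary.coe_star_mul_self hh.eigenvectorUnitary
  have hU2 : U * star U = 1 := Unitary.coe_mul_star_self hh.eigenvectorUnitary
  let E : (ι → ℝ) → Matrix ι ι ℂ := fun f => U * Matrix.diagonal (fun i => (f i : ℂ)) * star U
  have hE : ∀ f, E f = U * Matrix.diagonal (fun i => (f i : ℂ)) * star U := fun _ => rfl
  have hEs : s = E hh.eigenvalues := by
    conv_lhs => rw [hh.spectral_theorem]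
    rw [Unitary.conjStarAlgAut_apply]; rfl
  have hEm : ∀ f g, E f * E g = E (fun i => f i * g i) := by
    intro f g
    calc E f * E g = U * Matrix.diagonal (fun i => (f i : ℂ)) * (star U * U) *
          Matrix.diagonal (fun i => (g i : ℂ)) * star U := by simp only [hE, mul_assoc]
      _ = _ := by
        rw [hU1, mul_one, mul_assoc U, Matrix.diagonal_mul_diagonal, hE]
        simp
  have hE1 : E (fun _ => 1) = 1 := by
    rw [hE]; simp [hU2]
  have hEsub : ∀ f g, E f - E g = E (fun i => f i - g i) := by
    intro f g
    rw [hE, hE, hE, ← sub_mul, ← mul_sub, Matrix.diagonal_sub]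
    simp
  have hEsm : ∀ (r : ℝ) f, (r : ℂ) • E f = E (fun i => r * f i) := by
    intro r f
    rw [hE, hE, ← smul_mul_assoc, ← mul_smul_comm, ← Matrix.diagonal_smul]
    congr 3
    ext i
    simp
  have hEst : ∀ f, star (E f) = E f := by
    intro f
    rw [hE, star_mul, star_mul, star_star, Matrix.star_eq_conjTranspose (Matrix.diagonal _),
      Matrix.diagonal_conjTranspose, mul_assoc]
    congr 3
    ext i
    simp
  have hEpos : ∀ f, (∀ i, 0 ≤ f i) → IsPosElem (E f) := by
    intro f hf
    refine ⟨E (fun i => Real.sqrt (f i)), ?_⟩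
    rw [hEst, hEm]
    congr 1; ext i; exact (Real.mul_self_sqrt (hf i)).symm
  let κ := {i // y < hh.eigenvalues i}
  let V : Matrix ι κ ℂ := U.submatrix id Subtype.val
  let q : ι → ℝ := fun i => if y < hh.eigenvalues i then 1 else 0
  have hVV : V * V.conjTranspose = E q := by
    ext i j
    rw [Matrix.mul_apply, hE, mul_assoc, Matrix.mul_apply]
    simp only [Matrix.diagonal_mul, q]
    have : ∀ r, U i r * (((if y < hh.eigenvalues r then (1 : ℝ) else 0 : ℝ) : ℂ) * (star U) r j)
        = if y < hh.eigenvalues r then U i r * (star U) r j else 0 := by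
      intro r; split_ifs <;> simp
    simp only [this]
    rw [← Finset.sum_filter]
    exact (Finset.sum_subtype (p := fun r => y < hh.eigenvalues r) _ (by simp)
      (fun r => U i r * (star U) r j)).symm
  refine ⟨κ, inferInstance, inferInstance, V, ?_, ?_, ?_⟩
  · have : V.conjTranspose * V = (star U * U).submatrix (Subtype.val : κ → ι) Subtype.val := by
      ext i j; simp [V, Matrix.mul_apply]
    rw [this, hU1]
    exact Matrix.submatrix_one _ Subtype.val_injective
  · rw [hVV, hEsm]
    nth_rewrite 1 [hEs]
    rw [hEsub]
    refine hEpos _ fun i => ?_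
    simp only [q]
    have := hpos.eigenvalues_nonneg i
    split_ifs with h
    · linarith
    · simpa using this
  · letI := CStarAlgebra.spectralOrder (Matrix ι ι ℂ)
    haveI := CStarAlgebra.spectralOrderedRing (Matrix ι ι ℂ)
    have e : (1 - V * V.conjTranspose) * s * (1 - V * V.conjTranspose) =
        E (fun i => (1 - q i) * hh.eigenvalues i * (1 - q i)) := by
      rw [hVV, ← hE1, hEsub]
      nth_rewrite 1 [hEs]
      rw [hEm, hEm]
    rw [e]
    have hb : ∀ i, 0 ≤ (1 - q i) * hh.eigenvalues i * (1 - q i) ∧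
        (1 - q i) * hh.eigenvalues i * (1 - q i) ≤ y := by
      intro i
      have := hpos.eigenvalues_nonneg i
      simp only [q]
      split_ifs with h
      · simp [hy.le]
      · simpa using ⟨this, not_lt.1 h⟩
    have p1 := (isPosElem_iff _).1 (hEpos _ fun i => (hb i).1)
    rw [CStarAlgebra.norm_le_iff_le_algebraMap _ hy.le p1, ← sub_nonneg]
    have : algebraMap ℝ (Matrix ι ι ℂ) y = E (fun _ => y) := by
      rw [Algebra.algebraMap_eq_smul_one, ← hE1, ← Complex.coe_smul, hEsm]
      simp
    rw [this, hEsub]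
    exact (isPosElem_iff _).1 (hEpos _ fun i => sub_nonneg.2 (hb i).2)

end Compress

end

section
set_option linter.style.haveILetI false
set_option linter.unusedSectionVars false
open scoped ComplexOrder Matrix.Norms.L2Operator
open Filter Topology

section LemC
variable {B : Type*} [CStarAlgebra B] {n : ℕ} {K : Type} {c : K → Fin (n + 1)} {ι : K → Type}
  [∀ k, Fintype (ι k)] [∀ k, DecidableEq (ι k)] {φ : ∀ k, Matrix (ι k) (ι k) ℂ →ₗ[ℂ] B}

theorem OZSys.compress (h : OZSys c φ) {κ : K → Type} [∀ k, Fintype (κ k)] [∀ k, DecidableEq (κ k)]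
    (V : ∀ k, Matrix (ι k) (κ k) ℂ) (hV : ∀ k, (V k).conjTranspose * V k = 1) :
    OZSys c (fun k => (φ k) ∘ₗ expL (V k)) := by
  refine ⟨fun k => (h.cp k).comp (cp_expL (hV k)), ?_, ?_, ?_⟩
  · intro k x y
    simp only [LinearMap.comp_apply]
    rw [h.mul, h.mul k (expL (V k) 1), ← expL_mul (hV k), ← expL_mul (hV k), one_mul]
  · intro k
    simp only [LinearMap.comp_apply]
    refine (cp_norm_le (h.cp k) (h.norm k) _).trans ?_
    have h1 := iso_norm (hV k)
    rw [expL_apply, Matrix.mul_one]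
    refine (Matrix.l2_opNorm_mul _ _).trans ?_
    rw [Matrix.l2_opNorm_conjTranspose]
    exact mul_le_one₀ h1 (norm_nonneg _) h1
  · intro k l hkl hc
    exact h.orth' hkl hc _ _

theorem OZSys.conj (h : OZSys c φ) (v g : Fin (n + 1) → B) (hg : ∀ j, ‖g j‖ ≤ 1)
    (hgs : ∀ j, star (g j) = g j)
    (hv : ∀ j, star (v j) * v j = g j * g j) (hc : ∀ k x, Commute (g (c k)) (φ k x)) :
    OZSys c (fun k => conjL (star (v (c k))) ∘ₗ φ k) := by
  have hvn : ∀ j, ‖v j‖ ≤ 1 := by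
    intro j
    have h1 : ‖v j‖ * ‖v j‖ = ‖g j‖ * ‖g j‖ := by
      rw [← CStarRing.norm_star_mul_self, hv j, ← CStarRing.norm_star_mul_self, hgs]
    nlinarith [norm_nonneg (v j), norm_nonneg (g j), hg j]
  have key : ∀ j (x y : B), conjL (star (v j)) x * conjL (star (v j)) y =
      v j * (x * (g j * g j) * y) * star (v j) := by
    intro j x y
    rw [conjL_apply, conjL_apply, star_star, ← hv]
    simp only [mul_assoc]
  refine ⟨fun k => (cp_conjL _).comp (h.cp k), ?_, ?_, ?_⟩
  · intro k x y
    simp only [LinearMap.comp_apply]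
    rw [key, key]
    have h1 : ∀ z w, φ k z * (g (c k) * g (c k)) * φ k w =
        g (c k) * g (c k) * (φ k z * φ k w) := by
      intro z w
      rw [((hc k z).mul_left (hc k z)).eq.symm, mul_assoc]
    rw [h1, h1, h.mul]
  · intro k
    simp only [LinearMap.comp_apply]
    rw [conjL_apply, star_star]
    refine (norm_mul_le _ _).trans ?_
    rw [norm_star]
    refine mul_le_one₀ ?_ (norm_nonneg _) (hvn _)
    exact (norm_mul_le _ _).trans (mul_le_one₀ (hvn _) (norm_nonneg _) (h.norm k))
  · intro k l hkl hcc
    simp only [LinearMap.comp_apply]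
    rw [← hcc, key]
    rw [((hc k 1).mul_left (hc k 1)).eq.symm, mul_assoc (g (c k) * g (c k)), h.orth k l hkl hcc]
    simp

theorem OZSys.commute_color (h : OZSys c φ) (s : Finset K) (k : K) (hk : k ∈ s)
    (hs : ∀ l ∈ s, c l = c k) (x) : Commute (∑ l ∈ s, φ l 1) (φ k x) := by
  refine Commute.sum_left _ _ _ fun l hl => ?_
  by_cases hlk : l = k
  · subst hlk; exact (h.comm l x).symm
  · rw [commute_iff_eq, h.orth' hlk (hs l hl), h.orth' (Ne.symm hlk) (hs l hl).symm]

theorem color_est (h : OZSys c φ) (s : Finset K) (j) (hs : ∀ k ∈ s, c k = j)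
    {v g : B} {m y M : ℝ} (hgs : star g = g) (hg : ‖g‖ ≤ 1) (hv : star v * v = g * g)
    (hc : ∀ x, Commute (∑ k ∈ s, φ k 1) x → Commute g x) (hvg : ‖v - g‖ ≤ m) (hy : 0 ≤ y)
    (hgy : ‖(1 - g * g) * (∑ k ∈ s, φ k 1) * (1 - g * g)‖ ≤ y ^ 2)
    (z : ∀ k, Matrix (ι k) (ι k) ℂ) (hM : 0 ≤ M) (hz : ∀ k, ‖z k‖ ≤ M) :
    ‖v * (∑ k ∈ s, φ k (z k)) * star v - ∑ k ∈ s, φ k (z k)‖ ≤ 2 * m * M + y * M := by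
  set Φ := ∑ k ∈ s, φ k (z k) with hΦ
  have hΦn : ‖Φ‖ ≤ M := h.color_norm s j hs z hM fun k _ => hz k
  have hvn : ‖v‖ ≤ 1 := by
    have h1 : ‖v‖ * ‖v‖ = ‖g‖ * ‖g‖ := by
      rw [← CStarRing.norm_star_mul_self, hv, ← CStarRing.norm_star_mul_self, hgs]
    nlinarith [norm_nonneg v, norm_nonneg g]
  have hcomm : Commute g Φ := by
    refine Commute.sum_right _ _ _ fun k hk => hc _ ?_
    exact h.commute_color s k hk (fun l hl => (hs l hl).trans (hs k hk).symm) _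
  have e : v * Φ * star v - Φ = (v - g) * Φ * star v + g * Φ * star (v - g) - (1 - g * g) * Φ := by
    have h1 : g * Φ * g = g * g * Φ := by
      rw [mul_assoc, ← hcomm.eq, mul_assoc]
    rw [star_sub, hgs, mul_sub, h1]
    noncomm_ring
  have n1 : ‖(1 - g * g) * Φ‖ ≤ y * M := by
    have h1 := fam_cs s φ h.cp (1 - g * g) z
    rw [star_sub, star_one, star_mul, hgs] at h1
    have h2 : ‖∑ k ∈ s, φ k (star (z k) * z k)‖ ≤ M ^ 2 := by
      refine h.color_norm s j hs _ (sq_nonneg M) fun k _ => ?_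
      rw [CStarRing.norm_star_mul_self, ← sq]
      gcongr; exact hz k
    have h3 : ‖(1 - g * g) * Φ‖ ^ 2 ≤ (y * M) ^ 2 := by
      refine h1.trans ?_
      rw [mul_pow]
      exact mul_le_mul hgy h2 (norm_nonneg _) (sq_nonneg _)
    exact (pow_le_pow_iff_left₀ (norm_nonneg _) (by positivity) two_ne_zero).1 h3
  have hm0 : 0 ≤ m := (norm_nonneg _).trans hvg
  have n2 : ‖(v - g) * Φ * star v‖ ≤ m * M := by
    refine (norm_mul_le _ _).trans ?_
    rw [norm_star]
    refine (mul_le_of_le_one_right (norm_nonneg _) hvn).trans ((norm_mul_le _ _).trans ?_)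
    exact mul_le_mul hvg hΦn (norm_nonneg _) hm0
  have n3 : ‖g * Φ * star (v - g)‖ ≤ m * M := by
    refine (norm_mul_le _ _).trans ?_
    rw [norm_star, mul_comm m]
    refine mul_le_mul ((norm_mul_le _ _).trans ?_) hvg (norm_nonneg _) hM
    exact (mul_le_of_le_one_left (norm_nonneg _) hg).trans hΦn
  rw [e]
  have := norm_sub_le ((v - g) * Φ * star v + g * Φ * star (v - g)) ((1 - g * g) * Φ)
  have := norm_add_le ((v - g) * Φ * star v) (g * Φ * star (v - g))
  linarith

end LemC

theorem compress_est {ι κ : Type} [Fintype ι] [DecidableEq ι] [Fintype κ] [DecidableEq κ]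
    {B : Type*} [CStarAlgebra B] {ψ : B →ₗ[ℂ] Matrix ι ι ℂ} (hψ : IsCompletelyPositive ψ)
    (hψ1 : ‖ψ 1‖ ≤ 1) {p : B} (hp : p * p = p) (hps : star p = p) {V : Matrix ι κ ℂ}
    (hV : V.conjTranspose * V = 1) {t : ℝ} (ht : 0 ≤ t)
    (hs : ‖(1 - V * V.conjTranspose) * ψ p * (1 - V * V.conjTranspose)‖ ≤ t ^ 2)
    {b : B} (hb : p * b * p = b) {M : ℝ} (hM : ‖b‖ ≤ M) :
    ‖ψ b - expL V (compL V (ψ b))‖ ≤ 2 * t * M := by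
  have hM0 : 0 ≤ M := (norm_nonneg _).trans hM
  set q := V * V.conjTranspose with hq
  have hqs : star q = q := by
    rw [hq, Matrix.star_eq_conjTranspose, Matrix.conjTranspose_mul,
      Matrix.conjTranspose_conjTranspose]
  have hqq : q * q = q := by
    have := expL_mul hV 1 1
    simpa [expL_apply] using this.symm
  have key : ∀ b : B, p * b * p = b → ‖b‖ ≤ M → ‖(1 - q) * ψ b‖ ≤ t * M := by
    intro b hb hbM
    have hθ : IsCompletelyPositive (ψ ∘ₗ conjL p) := hψ.comp (cp_conjL p)
    have h1 := fam_cs (Finset.univ : Finset Unit) (fun _ => ψ ∘ₗ conjL p) (fun _ => hθ) (1 - q)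
      (fun _ => b)
    simp only [Finset.univ_unique, Finset.sum_singleton, LinearMap.comp_apply, conjL_apply, hps,
      mul_one, hp, hb, star_sub, star_one, hqs] at h1
    have hpn := proj_norm hp hps
    have h2 : ‖ψ (p * (star b * b) * p)‖ ≤ M ^ 2 := by
      refine (cp_norm_le hψ hψ1 _).trans ?_
      refine (norm_mul_le _ _).trans ?_
      refine (mul_le_of_le_one_right (norm_nonneg _) hpn).trans ?_
      refine (norm_mul_le _ _).trans ?_
      refine (mul_le_of_le_one_left (norm_nonneg _) hpn).trans ?_
      rw [CStarRing.norm_star_mul_self, ← sq]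
      gcongr
    have h3 : ‖(1 - q) * ψ b‖ ^ 2 ≤ (t * M) ^ 2 := by
      refine h1.trans ?_
      rw [mul_pow]
      exact mul_le_mul hs h2 (norm_nonneg _) (sq_nonneg _)
    exact (pow_le_pow_iff_left₀ (norm_nonneg _) (by positivity) two_ne_zero).1 h3
  have k1 := key b hb hM
  have k2 := key (star b) (by
    have := congrArg star hb
    rwa [star_mul, star_mul, hps, ← mul_assoc] at this) (by rwa [norm_star])
  have k3 : ‖ψ b * (1 - q)‖ ≤ t * M := by
    rw [← norm_star, star_mul, star_sub, star_one, hqs, ← hψ.star_map]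
    exact k2
  have hqn := proj_norm hqq hqs
  have e : ψ b - expL V (compL V (ψ b)) = (1 - q) * ψ b + q * (ψ b * (1 - q)) := by
    have : expL V (compL V (ψ b)) = q * ψ b * q := by
      rw [expL_apply, compL_apply, hq]; simp only [Matrix.mul_assoc]
    rw [this]; noncomm_ring
  rw [e]
  have k4 : ‖q * (ψ b * (1 - q))‖ ≤ t * M := (norm_mul_le _ _).trans
    ((mul_le_of_le_one_left (norm_nonneg _) hqn).trans k3)
  have := norm_add_le ((1 - q) * ψ b) (q * (ψ b * (1 - q)))
  linarith

end

section
set_option linter.style.haveILetI false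
set_option linter.unusedSectionVars false
open scoped ComplexOrder Matrix.Norms.L2Operator
open Filter Topology

section LemC
variable {B : Type*} [CStarAlgebra B] {n : ℕ} {K : Type} {c : K → Fin (n + 1)} {ι : K → Type}
  [∀ k, Fintype (ι k)] [∀ k, DecidableEq (ι k)] {φ : ∀ k, Matrix (ι k) (ι k) ℂ →ₗ[ℂ] B}

theorem corner_est [Fintype K] (h : OZSys c φ) {κ : K → Type} [∀ k, Fintype (κ k)]
    [∀ k, DecidableEq (κ k)] (V : ∀ k, Matrix (ι k) (κ k) ℂ)
    (hV : ∀ k, (V k).conjTranspose * V k = 1) {ψ : ∀ k, B →ₗ[ℂ] Matrix (ι k) (ι k) ℂ}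
    (hψ : ∀ k, IsCompletelyPositive (ψ k))
    {p : B} (hp : p * p = p) (hps : star p = p) {y δ : ℝ} (hy : 0 < y)
    (hpos : ∀ k, IsPosElem (ψ k p - (y : ℂ) • (V k * (V k).conjTranspose)))
    (s : Finset K) (j) (hs : ∀ k ∈ s, c k = j) (hδ : ‖∑ k, φ k (ψ k p) - p‖ ≤ δ) :
    ‖(1 - p) * ∑ k ∈ s, ((φ k) ∘ₗ expL (V k)) 1‖ ^ 2 ≤ y⁻¹ * δ := by
  letI := CStarAlgebra.spectralOrder B
  haveI := CStarAlgebra.spectralOrderedRing B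
  have hO := h.compress V hV
  set Φ : ∀ k, Matrix (κ k) (κ k) ℂ →ₗ[ℂ] B := fun k => (φ k) ∘ₗ expL (V k) with hΦ
  have hpp : p = star p * p := by rw [hps, hp]
  have h1 := fam_cs s Φ hO.cp (1 - p) (fun k => 1)
  simp only [star_one, mul_one] at h1
  have h2 := hO.color_sum s j hs
  have hcs : star (1 - p) = 1 - p := by rw [star_sub, star_one, hps]
  have hcc : (1 - p) * (1 - p) = 1 - p := by simp [mul_sub, sub_mul, hp]
  have hcn := proj_norm hcc hcs
  rw [hcs] at h1
  have h3 : y • ∑ k ∈ s, Φ k 1 ≤ ∑ k, φ k (ψ k p) := by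
    rw [Finset.smul_sum]
    calc ∑ k ∈ s, y • Φ k 1 ≤ ∑ k ∈ s, φ k (ψ k p) := by
          refine Finset.sum_le_sum fun k _ => ?_
          rw [← sub_nonneg, ← isPosElem_iff]
          have := (h.cp k).pos (hpos k)
          rw [map_sub, map_smul] at this
          have e : Φ k 1 = φ k (V k * (V k).conjTranspose) := by
            rw [hΦ, LinearMap.comp_apply, expL_apply, Matrix.mul_one]
          rw [e, ← Complex.coe_smul]
          exact this
      _ ≤ _ := by
          refine Finset.sum_le_univ_sum_of_nonneg fun k => ?_
          exact (isPosElem_iff _).1 ((h.cp k).pos ((hψ k).pos ⟨p, hpp⟩))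
  have hS0 : 0 ≤ ∑ k ∈ s, Φ k 1 := Finset.sum_nonneg fun k _ =>
    (isPosElem_iff _).1 ((hO.cp k).pos ⟨1, by simp⟩)
  set S := ∑ k ∈ s, Φ k 1 with hS
  set P := ∑ k, φ k (ψ k p) with hP
  have h4 : y • ((1 - p) * S * (1 - p)) ≤ (1 - p) * P * (1 - p) := by
    have := star_left_conjugate_le_conjugate h3 (1 - p)
    rwa [hcs, mul_smul_comm, smul_mul_assoc] at this
  have h5 : 0 ≤ (1 - p) * S * (1 - p) := by
    have := star_left_conjugate_nonneg hS0 (1 - p)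
    rwa [hcs] at this
  have h6 := CStarAlgebra.norm_le_norm_of_nonneg_of_le (smul_nonneg hy.le h5) h4
  rw [norm_smul, Real.norm_of_nonneg hy.le] at h6
  have h7 : ‖(1 - p) * P * (1 - p)‖ ≤ δ := by
    have : (1 - p) * P * (1 - p) = (1 - p) * (P - p) * (1 - p) := by
      have : (1 - p) * p = 0 := by simp [sub_mul, hp]
      rw [mul_sub (1 - p) P p, this, sub_zero]
    rw [this]
    refine (norm_mul_le _ _).trans ?_
    refine (mul_le_of_le_one_right (norm_nonneg _) hcn).trans ((norm_mul_le _ _).trans ?_)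
    exact (mul_le_of_le_one_left (norm_nonneg _) hcn).trans hδ
  calc _ ≤ ‖(1 - p) * S * (1 - p)‖ * ‖S‖ := h1
    _ ≤ ‖(1 - p) * S * (1 - p)‖ := mul_le_of_le_one_right (norm_nonneg _) h2
    _ ≤ y⁻¹ * δ := by
      rw [← div_eq_inv_mul, le_div_iff₀ hy, mul_comm]
      exact h6.trans h7

end LemC

theorem lemmaC {n : ℕ} {B : Type*} [CStarAlgebra B] (hB : ND n B) {p : B} (hp : p * p = p)
    (hps : star p = p) (T : Finset B) (hT : ∀ b ∈ T, p * b * p = b) {η : ℝ} (hη : 0 < η) :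
    ∃ (K : Type) (_ : Fintype K) (c : K → Fin (n + 1)) (ι : K → Type) (_ : ∀ k, Fintype (ι k))
      (_ : ∀ k, DecidableEq (ι k)) (ψ : ∀ k, B →ₗ[ℂ] Matrix (ι k) (ι k) ℂ)
      (φ : ∀ k, Matrix (ι k) (ι k) ℂ →ₗ[ℂ] B),
      (∀ k, IsCompletelyPositive (ψ k)) ∧ (∀ k, ‖ψ k 1‖ ≤ 1) ∧ OZSys c φ ∧
      (∀ k x, ψ k (p * x * p) = ψ k x) ∧ (∀ k x, p * φ k x * p = φ k x) ∧
      ∀ b ∈ T, ‖∑ k, φ k (ψ k b) - b‖ < η := by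
  classical
  letI := CStarAlgebra.spectralOrder B
  haveI := CStarAlgebra.spectralOrderedRing B
  have hpp : p = star p * p := by rw [hps, hp]
  have hpn := proj_norm hp hps
  obtain ⟨M, hM1, hM⟩ : ∃ M : ℝ, 1 ≤ M ∧ ∀ b ∈ T, ‖b‖ ≤ M := by
    refine ⟨1 + ∑ b ∈ T, ‖b‖, by linarith [Finset.sum_nonneg fun (b : B) (_ : b ∈ T) => norm_nonneg b],
      fun b hb => ?_⟩
    have := Finset.single_le_sum (fun (b : B) (_ : b ∈ T) => norm_nonneg b) hb
    linarith
  have hN : (0 : ℝ) < (n : ℝ) + 1 := by positivity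
  obtain ⟨t, ht0, ht1, ht⟩ : ∃ t : ℝ, 0 < t ∧ t ≤ 1 ∧ t * (6 * M * (n + 1)) ≤ η := by
    have : 0 < 6 * M * ((n : ℝ) + 1) := by positivity
    refine ⟨min 1 (η / (6 * M * (n + 1))), by positivity, min_le_left _ _, ?_⟩
    rw [← le_div_iff₀ this]
    exact min_le_right _ _
  have hy : 0 < t ^ 2 := by positivity
  obtain ⟨K, _, c, ι, _, _, ψ, φ, hψ, hψ1, hφ, happ⟩ := hB (insert p T) (t ^ 8 / 16) (by positivity)
  choose κ i1 i2 V hV hVpos hVn using fun k =>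
    spec_iso (ψ k p) ((hψ k).pos ⟨p, hpp⟩) hy
  have hO := hφ.compress V hV
  set Φ : ∀ k, Matrix (κ k) (κ k) ℂ →ₗ[ℂ] B := fun k => (φ k) ∘ₗ expL (V k) with hΦ
  let s : Fin (n + 1) → Finset K := fun j => Finset.univ.filter fun k => c k = j
  have hs : ∀ j, ∀ k ∈ s j, c k = j := fun j k hk => by simpa [s] using hk
  have hm : ∀ j, ‖(1 - p) * ∑ k ∈ s j, Φ k 1‖ ≤ t ^ 3 / 4 := by
    intro j
    have h1 := corner_est hφ V hV hψ hp hps hy hVpos (s j) j (hs j)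
      (happ p (Finset.mem_insert_self _ _)).le
    have h2 : (t ^ 2)⁻¹ * (t ^ 8 / 16) = (t ^ 3 / 4) ^ 2 := by field_simp; ring
    rw [h2] at h1
    exact (pow_le_pow_iff_left₀ (norm_nonneg _) (by positivity) two_ne_zero).1 h1
  have hV' : ∀ j, ∃ v g : B, p * v = v ∧ star g = g ∧ ‖g‖ ≤ 1 ∧ star v * v = g * g ∧
      (∀ x, Commute (∑ k ∈ s j, Φ k 1) x → Commute g x) ∧ ‖v - g‖ ≤ 2 * (t ^ 3 / 4 / (t ^ 2 / 2)) ∧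
      ‖(1 - g * g) * (∑ k ∈ s j, Φ k 1) * (1 - g * g)‖ ≤ 2 * (t ^ 2 / 2) := by
    intro j
    refine lemV ?_ (hO.color_sum _ j (hs j)) hp hps (by positivity) (hm j) (by positivity) ?_
    · exact Finset.sum_nonneg fun k _ => (isPosElem_iff _).1 ((hO.cp k).pos ⟨1, by simp⟩)
    · have : t ^ 3 = t ^ 2 * t := by ring
      nlinarith
  choose v g hpv hgs hgn hvg hgc hvgn hgy using hV'
  have hcom : ∀ k x, Commute (g (c k)) (Φ k x) := by
    intro k x
    refine hgc _ _ (hO.commute_color _ k (by simp [s]) (hs (c k)) x)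
  have hO2 := hO.conj v g hgn hgs hvg hcom
  have hψ1' : ∀ k, ‖ψ k p‖ ≤ 1 := fun k => (cp_norm_le (hψ k) (hψ1 k) _).trans hpn
  refine ⟨K, inferInstance, c, κ, i1, i2, fun k => compL (V k) ∘ₗ ψ k ∘ₗ conjL p,
    fun k => conjL (star (v (c k))) ∘ₗ Φ k, ?_, ?_, hO2, ?_, ?_, ?_⟩
  · exact fun k => (cp_compL _).comp ((hψ k).comp (cp_conjL p))
  · intro k
    simp only [LinearMap.comp_apply, conjL_apply, hps, mul_one, hp]
    exact (compL_norm (hV k) _).trans (hψ1' k)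
  · intro k x
    simp only [LinearMap.comp_apply, conjL_apply, hps]
    congr 2
    calc p * (p * x * p) * p = (p * p) * x * (p * p) := by simp only [mul_assoc]
      _ = _ := by rw [hp]
  · intro k x
    simp only [LinearMap.comp_apply, conjL_apply, star_star]
    have h1 : star (v (c k)) * p = star (v (c k)) := by
      have := congrArg star (hpv (c k))
      rwa [star_mul, hps] at this
    calc p * (v (c k) * Φ k x * star (v (c k))) * p
        = (p * v (c k)) * Φ k x * (star (v (c k)) * p) := by simp only [mul_assoc]
      _ = _ := by rw [h1, hpv]
  · intro b hb
    have hbp := hT b hb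
    have hbM := hM b hb
    have hM0 : 0 ≤ M := by linarith
    simp only [LinearMap.comp_apply, conjL_apply, hps, hbp, star_star]
    let x : ∀ k, Matrix (κ k) (κ k) ℂ := fun k => compL (V k) (ψ k b)
    have hx : ∀ k, ‖x k‖ ≤ M := fun k =>
      (compL_norm (hV k) _).trans ((cp_norm_le (hψ k) (hψ1 k) _).trans hbM)
    have a1 : ‖∑ k, φ k (ψ k b) - ∑ k, Φ k (x k)‖ ≤ 2 * t * M * (n + 1) := by
      rw [← Finset.sum_sub_distrib]
      have e : ∀ k, φ k (ψ k b) - Φ k (x k) = φ k (ψ k b - expL (V k) (compL (V k) (ψ k b))) := by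
        intro k; rw [map_sub]; rfl
      simp only [e]
      refine hφ.total_norm _ (by positivity) fun k => ?_
      exact compress_est (hψ k) (hψ1 k) hp hps (hV k) ht0.le (hVn k) hbp hbM
    have a2 : ∀ j, ‖v j * (∑ k ∈ s j, Φ k (x k)) * star (v j) - ∑ k ∈ s j, Φ k (x k)‖ ≤
        2 * t * M + t * M := by
      intro j
      refine color_est hO (s j) j (hs j) (hgs j) (hgn j) (hvg j) (hgc j) ?_ ht0.le ?_ x hM0 hx
      · refine (hvgn j).trans (le_of_eq ?_)
        field_simp; ring
      · refine (hgy j).trans (le_of_eq (by ring))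
    have a3 : ∑ k, v (c k) * Φ k (x k) * star (v (c k)) - ∑ k, Φ k (x k) =
        ∑ j, (v j * (∑ k ∈ s j, Φ k (x k)) * star (v j) - ∑ k ∈ s j, Φ k (x k)) := by
      rw [Finset.sum_sub_distrib]
      congr 1
      · rw [← Finset.sum_fiberwise Finset.univ c]
        refine Finset.sum_congr rfl fun j _ => ?_
        rw [Finset.mul_sum, Finset.sum_mul]
        refine Finset.sum_congr rfl fun k hk => ?_
        rw [hs j k hk]
      · rw [← Finset.sum_fiberwise Finset.univ c]
    have a4 : ‖∑ k, v (c k) * Φ k (x k) * star (v (c k)) - ∑ k, Φ k (x k)‖ ≤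
        (n + 1) * (3 * t * M) := by
      rw [a3]
      refine (norm_sum_le_of_le _ fun j _ => a2 j).trans ?_
      simp
      apply le_of_eq; ring
    have a5 := happ b (Finset.mem_insert_of_mem hb)
    have a6 : t ^ 8 / 16 ≤ t := by
      have : t ^ 8 ≤ t := by
        calc t ^ 8 ≤ t ^ 1 := pow_le_pow_of_le_one ht0.le ht1 (by norm_num)
          _ = t := pow_one t
      linarith
    have e : ∑ k, v (c k) * Φ k (x k) * star (v (c k)) - b =
        (∑ k, v (c k) * Φ k (x k) * star (v (c k)) - ∑ k, Φ k (x k)) -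
        (∑ k, φ k (ψ k b) - ∑ k, Φ k (x k)) + (∑ k, φ k (ψ k b) - b) := by abel
    change ‖∑ k, v (c k) * Φ k (x k) * star (v (c k)) - b‖ < η
    rw [e]
    refine (norm_add_le _ _).trans_lt ?_
    have a7 := norm_sub_le (∑ k, v (c k) * Φ k (x k) * star (v (c k)) - ∑ k, Φ k (x k))
      (∑ k, φ k (ψ k b) - ∑ k, Φ k (x k))
    have a8 : t ≤ t * M * (n + 1) := by
      have : 1 ≤ M * (n + 1) := by nlinarith [Nat.cast_nonneg (α := ℝ) n]
      nlinarith
    nlinarith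

end

section
set_option linter.style.haveILetI false
set_option linter.unusedSectionVars false
open scoped ComplexOrder Matrix.Norms.L2Operator
open Filter Topology

theorem lemmaCL {n : ℕ} {D : Type} [CStarAlgebra D]
    (H : ∀ (S : Finset D) (ε : ℝ), 0 < ε → ∃ (B : Type) (_ : CStarAlgebra B) (p : B)
      (σ : B →ₗ[ℂ] D), ND n B ∧ p * p = p ∧ star p = p ∧ IsCompletelyPositive σ ∧ σ 1 = 1 ∧
      (∀ x, σ (p * x * p) = σ x) ∧ (∀ x y, σ (p * x * p * y * p) = σ x * σ y) ∧
      ∀ a ∈ S, ∃ b, ‖σ b - a‖ < ε) : ND n D := by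
  classical
  refine lemmaP fun S δ hδ => ?_
  obtain ⟨M, hM1, hM⟩ : ∃ M : ℝ, 1 ≤ M ∧ ∀ b ∈ S, ‖b‖ ≤ M := by
    refine ⟨1 + ∑ b ∈ S, ‖b‖, by linarith [Finset.sum_nonneg fun (b : D) (_ : b ∈ S) => norm_nonneg b],
      fun b hb => ?_⟩
    have := Finset.single_le_sum (fun (b : D) (_ : b ∈ S) => norm_nonneg b) hb
    linarith
  obtain ⟨ε, hε0, hε1, hε⟩ : ∃ t : ℝ, 0 < t ∧ t ≤ 1 ∧ t * (2 * M + 1) ≤ δ / 2 := by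
    have : 0 < 2 * M + 1 := by positivity
    refine ⟨min 1 (δ / 2 / (2 * M + 1)), by positivity, min_le_left _ _, ?_⟩
    rw [← le_div_iff₀ this]
    exact min_le_right _ _
  obtain ⟨B, _, p, σ, hB, hp, hps, hσ, hσ1, hσp, hσm, hS⟩ := H S ε hε0
  choose! b hb using hS
  let b' : D → B := fun a => p * b a * p
  have hb's : ∀ a, star (b' a) = p * star (b a) * p := by
    intro a; simp only [b', star_mul, hps, mul_assoc]
  have hpl : ∀ z, p * (p * z) = p * z := fun z => by rw [← mul_assoc, hp]
  have hco : ∀ x y, p * (p * x * p * (p * y * p)) * p = p * x * p * (p * y * p) := by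
    intro x y; simp only [mul_assoc, hpl, hp]
  have hco1 : ∀ x, p * (p * x * p) * p = p * x * p := by
    intro x; simp only [mul_assoc, hpl, hp]
  let T : Finset B := {p} ∪ S.image b' ∪ S.image (fun a => star (b' a)) ∪
    S.image (fun a => star (b' a) * b' a) ∪ S.image (fun a => b' a * star (b' a))
  have hT : ∀ w ∈ T, p * w * p = w := by
    intro w hw
    simp only [T, Finset.mem_union, Finset.mem_singleton, Finset.mem_image] at hw
    rcases hw with (((rfl | ⟨a, _, rfl⟩) | ⟨a, _, rfl⟩) | ⟨a, _, rfl⟩) | ⟨a, _, rfl⟩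
    · rw [hp, hp]
    · exact hco1 _
    · simp only [hb's]; exact hco1 _
    · simp only [hb's]; exact hco _ _
    · simp only [hb's]; exact hco _ _
  obtain ⟨K, i0, c, ι, i1, i2, ψ, φ, hψ, hψ1, hφ, hψp, hφp, happ⟩ :=
    lemmaC hB hp hps T hT (half_pos hδ)
  have hσn : ∀ x, ‖σ x‖ ≤ ‖x‖ := cp_norm_le hσ (by rw [hσ1]; exact norm_one_le' D)
  have hmul : ∀ k l x y, σ (φ k x) * σ (φ l y) = σ (φ k x * φ l y) := by
    intro k l x y
    rw [← hσm, hφp]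
    congr 1
    conv_rhs => rw [← hφp k x, ← hφp l y]
    conv_lhs => rw [← hφp k x, ← hφp l y]
    simp only [mul_assoc, hpl, hp]
  have hsum : ∀ w ∈ T, ‖∑ k, (σ ∘ₗ φ k) (ψ k w) - σ w‖ ≤ δ / 2 := by
    intro w hw
    have : ∑ k, (σ ∘ₗ φ k) (ψ k w) - σ w = σ (∑ k, φ k (ψ k w) - w) := by
      rw [map_sub, map_sum]; rfl
    rw [this]
    exact (hσn _).trans (happ w hw).le
  have fin : ∀ w ∈ T, ∀ a, ‖σ w - a‖ ≤ δ / 2 → ‖∑ k, (σ ∘ₗ φ k) (ψ k w) - a‖ ≤ δ := by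
    intro w hw a ha
    have h1 := hsum w hw
    have := norm_add_le (∑ k, (σ ∘ₗ φ k) (ψ k w) - σ w) (σ w - a)
    rw [sub_add_sub_cancel] at this
    linarith
  refine ⟨B, inferInstance, K, i0, c, ι, i1, i2, ψ, fun k => σ ∘ₗ φ k, hψ, hψ1, ?_, ?_, ?_⟩
  · refine ⟨fun k => hσ.comp (hφ.cp k), ?_, ?_, ?_⟩
    · intro k x y
      simp only [LinearMap.comp_apply]
      rw [hmul, hmul, hφ.mul]
    · intro k
      exact (hσn _).trans (hφ.norm k)
    · intro k l hkl hc
      simp only [LinearMap.comp_apply]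
      rw [hmul, hφ.orth k l hkl hc, map_zero]
  · have h1 : ∀ k, ψ k 1 = ψ k p := by
      intro k
      have := hψp k 1
      rw [mul_one, hp] at this
      exact this.symm
    simp only [h1]
    refine fin p (by simp [T]) 1 ?_
    have : σ p = 1 := by
      have := hσp 1
      rw [mul_one, hp, hσ1] at this
      exact this
    rw [this, sub_self, norm_zero]; positivity
  · intro a ha
    have haM := hM a ha
    have hba := (hb a ha).le
    have e1 : σ (b' a) = σ (b a) := hσp _
    have e2 : σ (star (b' a)) = star (σ (b a)) := by rw [hσ.star_map, e1]
    have hm2 : ∀ x y, σ (p * x * p * (p * y * p)) = σ x * σ y := by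
      intro x y
      rw [← hσm]; congr 1; simp only [mul_assoc, hpl]
    have e3 : σ (star (b' a) * b' a) = star (σ (b a)) * σ (b a) := by
      rw [hb's, hm2, hσ.star_map]
    have e4 : σ (b' a * star (b' a)) = σ (b a) * star (σ (b a)) := by
      rw [hb's, hm2, hσ.star_map]
    have hεδ : ε ≤ δ / 2 := by nlinarith
    set z := σ (b a) with hz
    have hzM : ‖z‖ ≤ M + 1 := by
      have := norm_add_le (z - a) a
      rw [sub_add_cancel] at this
      linarith
    have hsz : ‖star z - star a‖ ≤ ε := by rw [← star_sub, norm_star]; exact hba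
    have prod : ∀ x y x' y' : D, ‖x - x'‖ ≤ ε → ‖y - y'‖ ≤ ε → ‖x‖ ≤ M + 1 → ‖y'‖ ≤ M →
        ‖x * y - x' * y'‖ ≤ δ / 2 := by
      intro x y x' y' h1 h2 h3 h4
      have e : x * y - x' * y' = x * (y - y') + (x - x') * y' := by noncomm_ring
      rw [e]
      refine (norm_add_le _ _).trans ?_
      have n1 := (norm_mul_le x (y - y')).trans (mul_le_mul h3 h2 (norm_nonneg _) (by linarith))
      have n2 := (norm_mul_le (x - x') y').trans (mul_le_mul h1 h4 (norm_nonneg _) hε0.le)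
      nlinarith
    refine ⟨b' a, fin _ ?_ _ ?_, fin _ ?_ _ ?_, fin _ ?_ _ ?_, fin _ ?_ _ ?_⟩
    · simp only [T, Finset.mem_union, Finset.mem_image]
      exact Or.inl (Or.inl (Or.inl (Or.inr ⟨a, ha, rfl⟩)))
    · rw [e1]; linarith
    · simp only [T, Finset.mem_union, Finset.mem_image]
      exact Or.inl (Or.inl (Or.inr ⟨a, ha, rfl⟩))
    · rw [e2]; linarith
    · simp only [T, Finset.mem_union, Finset.mem_image]
      exact Or.inl (Or.inr ⟨a, ha, rfl⟩)
    · rw [e3]; exact prod _ _ _ _ hsz hba (by rwa [norm_star]) haM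
    · simp only [T, Finset.mem_union, Finset.mem_image]
      exact Or.inr ⟨a, ha, rfl⟩
    · rw [e4]; exact prod _ _ _ _ hba hsz hzM (by rwa [norm_star])

end

section
set_option linter.style.haveILetI false
set_option linter.unusedSectionVars false
open scoped ComplexOrder Matrix.Norms.L2Operator
open Filter Topology

theorem pos_of_map_pos {E F : Type*} [CStarAlgebra E] [CStarAlgebra F] [PartialOrder E]
    [StarOrderedRing E] [PartialOrder F] [StarOrderedRing F] (I : E →⋆ₙₐ[ℂ] F)
    (hI : Function.Injective I) {Z : E} (hZ : 0 ≤ I Z) : 0 ≤ Z := by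
  have hsa : IsSelfAdjoint Z := by
    have : IsSelfAdjoint (I Z) := hZ.isSelfAdjoint
    apply hI
    rw [map_star]; exact this
  have hd := CFC.posPart_sub_negPart Z hsa
  have hn : 0 ≤ Z⁻ := CFC.negPart_nonneg Z
  have hns : star Z⁻ = Z⁻ := hn.isSelfAdjoint
  have h1 : Z⁻ * Z * Z⁻ = - (Z⁻ * Z⁻ * Z⁻) := by
    have : Z⁻ * Z = -(Z⁻ * Z⁻) := by
      calc Z⁻ * Z = Z⁻ * (Z⁺ - Z⁻) := by rw [hd]
        _ = _ := by rw [mul_sub, CFC.negPart_mul_posPart, zero_sub]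
    rw [this, neg_mul]
  have h2 : 0 ≤ I (Z⁻ * Z * Z⁻) := by
    have := star_left_conjugate_nonneg hZ (I Z⁻)
    rwa [← map_star, hns, ← map_mul, ← map_mul] at this
  have h3 : 0 ≤ I (Z⁻ * Z⁻ * Z⁻) := by
    obtain ⟨y, hy⟩ := (isPosElem_iff _).2 hn
    have : I (Z⁻ * Z⁻ * Z⁻) = star (I (y * Z⁻)) * I (y * Z⁻) := by
      rw [← map_star, ← map_mul, star_mul, hns]
      congr 1
      calc Z⁻ * Z⁻ * Z⁻ = Z⁻ * (star y * y) * Z⁻ := by rw [← hy]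
        _ = _ := by simp only [mul_assoc]
    rw [this]; exact star_mul_self_nonneg _
  have h4 : I (Z⁻ * Z⁻ * Z⁻) = 0 := by
    rw [h1, map_neg] at h2
    exact le_antisymm (neg_nonneg.1 h2) h3
  have h5 : Z⁻ * Z⁻ * Z⁻ = 0 := hI (by rw [h4, map_zero])
  have h6 : Z⁻ * Z⁻ = 0 := by
    have : star (Z⁻ * Z⁻) * (Z⁻ * Z⁻) = 0 := by
      rw [star_mul, hns, ← mul_assoc, h5, zero_mul]
    exact (CStarRing.star_mul_self_eq_zero_iff _).1 this
  have h7 : Z⁻ = 0 := by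
    have : star Z⁻ * Z⁻ = 0 := by rw [hns, h6]
    exact (CStarRing.star_mul_self_eq_zero_iff _).1 this
  exact (CFC.negPart_eq_zero_iff Z hsa).1 h7

theorem cp_of_inj {R D B : Type*} [Ring R] [StarRing R] [Module ℂ R] [CStarAlgebra D]
    [CStarAlgebra B] (I : D →⋆ₙₐ[ℂ] B) (hI : Function.Injective I) (σ : R →ₗ[ℂ] D)
    (θ : R →ₗ[ℂ] B) (hθ : IsCompletelyPositive θ) (h : ∀ x, I (σ x) = θ x) :
    IsCompletelyPositive σ := by
  intro k x hx
  letI := CStarAlgebra.spectralOrder D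
  haveI := CStarAlgebra.spectralOrderedRing D
  letI := CStarAlgebra.spectralOrder B
  haveI := CStarAlgebra.spectralOrderedRing B
  have h1 := hθ k x hx
  have h2 : (0 : CStarMatrix (Fin k) (Fin k) B) ≤ (x.map θ : Matrix (Fin k) (Fin k) B) :=
    (isPosElem_iff (D := CStarMatrix (Fin k) (Fin k) B) _).1 h1
  refine (isPosElem_iff (D := CStarMatrix (Fin k) (Fin k) D) _).2 ?_
  refine pos_of_map_pos (CStarMatrix.mapₙₐ I) ?_ ?_
  · intro a b hab
    ext i j
    exact hI (congrFun (congrFun hab i) j)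
  · have e : (CStarMatrix.mapₙₐ I (x.map σ) : CStarMatrix (Fin k) (Fin k) B) = x.map θ := by
      funext i j
      exact h _
    exact e ▸ h2

theorem ND.of_hom {n : ℕ} {D : Type} [CStarAlgebra D]
    (H : ∀ (S : Finset D) (ε : ℝ), 0 < ε → ∃ (B : Type) (_ : CStarAlgebra B) (σ : B →⋆ₐ[ℂ] D),
      ND n B ∧ ∀ a ∈ S, ∃ b, ‖σ b - a‖ < ε) : ND n D := by
  refine lemmaCL fun S ε hε => ?_
  obtain ⟨B, i, σ, hB, hS⟩ := H S ε hε
  refine ⟨B, i, 1, σ.toAlgHom.toLinearMap, hB, by simp, by simp, ?_, ?_, ?_, ?_, hS⟩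
  · exact cp_of_hom _ (fun x y => map_mul σ x y) (fun x => map_star σ x)
  · exact map_one σ
  · intro x; simp
  · intro x y; simp

theorem ND.of_equiv {n : ℕ} {D B : Type} [CStarAlgebra D] [CStarAlgebra B] (hB : ND n B)
    (e : D ≃⋆ₐ[ℂ] B) : ND n D := by
  refine ND.of_hom fun S ε hε => ⟨B, inferInstance, (e.symm : B →⋆ₐ[ℂ] D), hB, fun a _ => ⟨e a, ?_⟩⟩
  simpa using hε

theorem ND.of_corner {n : ℕ} {D B : Type} [CStarAlgebra D] [CStarAlgebra B] (hB : ND n B)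
    {p : B} (hp : p * p = p) (hps : star p = p) (I : D →⋆ₙₐ[ℂ] B) (hI : Function.Injective I)
    (hI1 : I 1 = p) (hr : Set.range I = {x : B | p * x * p = x}) : ND n D := by
  have hpl : ∀ z, p * (p * z) = p * z := fun z => by rw [← mul_assoc, hp]
  have hex : ∀ x : B, ∃ d : D, I d = p * x * p := by
    intro x
    have : p * x * p ∈ Set.range I := by
      rw [hr]
      simp only [Set.mem_ofPred_eq, mul_assoc, hpl, hp]
    exact this
  choose f hf using hex
  let σ : B →ₗ[ℂ] D :=
    { toFun := f
      map_add' := fun x y => hI (by rw [map_add, hf, hf, hf, mul_add, add_mul])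
      map_smul' := fun c x => hI (by
        rw [RingHom.id_apply, map_smul, hf, hf, mul_smul_comm, smul_mul_assoc]) }
  have hσ : ∀ x, I (σ x) = p * x * p := hf
  refine lemmaCL fun S ε hε => ⟨B, inferInstance, p, σ, hB, hp, hps, ?_, ?_, ?_, ?_, ?_⟩
  · refine cp_of_inj I hI σ (conjL p) (cp_conjL p) fun x => ?_
    rw [hσ, conjL_apply, hps]
  · apply hI; rw [hσ, mul_one, hp, hI1]
  · intro x; apply hI; rw [hσ, hσ]; simp only [mul_assoc, hpl, hp]
  · intro x y; apply hI; rw [hσ, map_mul I, hσ, hσ]; simp only [mul_assoc, hpl, hp]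
  · intro a _
    refine ⟨I a, ?_⟩
    have : σ (I a) = a := by
      apply hI
      have : I a ∈ {x : B | p * x * p = x} := by rw [← hr]; exact ⟨a, rfl⟩
      rw [hσ]; exact this
    rw [this, sub_self, norm_zero]; exact hε

end

section
set_option linter.style.haveILetI false
set_option linter.unusedSectionVars false
open scoped ComplexOrder Matrix.Norms.L2Operator
open Filter Topology

theorem ND.prod {n : ℕ} {B₁ B₂ : Type} [CStarAlgebra B₁] [CStarAlgebra B₂] (h₁ : ND n B₁)
    (h₂ : ND n B₂) : ND n (B₁ × B₂) := by
  classical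
  intro S ε hε
  obtain ⟨K₁, _, c₁, ι₁, i₁, j₁, ψ₁, φ₁, hψ₁, hn₁, ho₁, hS₁⟩ := h₁ (S.image Prod.fst) ε hε
  obtain ⟨K₂, _, c₂, ι₂, i₂, j₂, ψ₂, φ₂, hψ₂, hn₂, ho₂, hS₂⟩ := h₂ (S.image Prod.snd) ε hε
  have hfst : IsCompletelyPositive (LinearMap.fst ℂ B₁ B₂) :=
    cp_of_hom _ (fun _ _ => rfl) (fun _ => rfl)
  have hsnd : IsCompletelyPositive (LinearMap.snd ℂ B₁ B₂) :=
    cp_of_hom _ (fun _ _ => rfl) (fun _ => rfl)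
  have hinl : IsCompletelyPositive (LinearMap.inl ℂ B₁ B₂) :=
    cp_of_hom _ (fun _ _ => by simp) (fun _ => by simp [Prod.ext_iff])
  have hinr : IsCompletelyPositive (LinearMap.inr ℂ B₁ B₂) :=
    cp_of_hom _ (fun _ _ => by simp) (fun _ => by simp [Prod.ext_iff])
  let ι : K₁ ⊕ K₂ → Type := Sum.elim ι₁ ι₂
  letI iF : ∀ k, Fintype (ι k) := fun k => match k with
    | Sum.inl k => i₁ k
    | Sum.inr k => i₂ k
  letI iD : ∀ k, DecidableEq (ι k) := fun k => match k with
    | Sum.inl k => j₁ k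
    | Sum.inr k => j₂ k
  let ψ : ∀ k, (B₁ × B₂) →ₗ[ℂ] Matrix (ι k) (ι k) ℂ := fun k => match k with
    | Sum.inl k => ψ₁ k ∘ₗ LinearMap.fst ℂ B₁ B₂
    | Sum.inr k => ψ₂ k ∘ₗ LinearMap.snd ℂ B₁ B₂
  let φ : ∀ k, Matrix (ι k) (ι k) ℂ →ₗ[ℂ] (B₁ × B₂) := fun k => match k with
    | Sum.inl k => LinearMap.inl ℂ B₁ B₂ ∘ₗ φ₁ k
    | Sum.inr k => LinearMap.inr ℂ B₁ B₂ ∘ₗ φ₂ k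
  refine ⟨K₁ ⊕ K₂, inferInstance, Sum.elim c₁ c₂, ι, iF, iD, ψ, φ, ?_, ?_, ⟨?_, ?_, ?_, ?_⟩, ?_⟩
  · rintro (k | k)
    · exact (hψ₁ k).comp hfst
    · exact (hψ₂ k).comp hsnd
  · rintro (k | k)
    · exact hn₁ k
    · exact hn₂ k
  · rintro (k | k)
    · exact hinl.comp (ho₁.cp k)
    · exact hinr.comp (ho₂.cp k)
  · rintro (k | k) x y
    · exact Prod.ext (ho₁.mul k x y) (by change (0 : B₂) * 0 = 0 * 0; rfl)
    · exact Prod.ext (by change (0 : B₁) * 0 = 0 * 0; rfl) (ho₂.mul k x y)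
  · rintro (k | k)
    · exact max_le (ho₁.norm k) (by change ‖(0 : B₂)‖ ≤ 1; simp)
    · exact max_le (by change ‖(0 : B₁)‖ ≤ 1; simp) (ho₂.norm k)
  · rintro (k | k) (l | l) hkl hc
    · exact Prod.ext (ho₁.orth k l (fun h => hkl (by rw [h])) hc) (by change (0 : B₂) * 0 = 0; simp)
    · exact Prod.ext (mul_zero _) (zero_mul _)
    · exact Prod.ext (zero_mul _) (mul_zero _)
    · exact Prod.ext (by change (0 : B₁) * 0 = 0; simp) (ho₂.orth k l (fun h => hkl (by rw [h])) hc)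
  · intro a ha
    have e : ∑ k, φ k (ψ k a) = (∑ k, φ₁ k (ψ₁ k a.1), ∑ k, φ₂ k (ψ₂ k a.2)) := by
      rw [Fintype.sum_sum_type]
      refine Prod.ext ?_ ?_
      · rw [Prod.fst_add, Prod.fst_sum, Prod.fst_sum]
        change ∑ k, φ₁ k (ψ₁ k a.1) + ∑ _k : K₂, (0 : B₁) = _
        simp
      · rw [Prod.snd_add, Prod.snd_sum, Prod.snd_sum]
        change ∑ _k : K₁, (0 : B₂) + ∑ k, φ₂ k (ψ₂ k a.2) = _
        simp
    rw [e]
    exact max_lt (hS₁ a.1 (Finset.mem_image_of_mem _ ha)) (hS₂ a.2 (Finset.mem_image_of_mem _ ha))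

end

section
set_option linter.style.haveILetI false
set_option linter.unusedSectionVars false
open scoped ComplexOrder Matrix.Norms.L2Operator
open Filter Topology

section Mat
variable {B : Type} [CStarAlgebra B] {m : ℕ} {ι : Type} [Fintype ι] [DecidableEq ι]

def blk (x : Matrix (Fin m × ι) (Fin m × ι) ℂ) (p q : Fin m) : Matrix ι ι ℂ :=
  Matrix.of fun i j => x (p, i) (q, j)

def ampPsi (ψ : B →ₗ[ℂ] Matrix ι ι ℂ) :
    Matrix (Fin m) (Fin m) B →ₗ[ℂ] Matrix (Fin m × ι) (Fin m × ι) ℂ where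
  toFun X := Matrix.of fun P Q => ψ (X P.1 Q.1) P.2 Q.2
  map_add' X Y := by ext P Q; simp
  map_smul' c X := by ext P Q; simp

def ampPhi (φ : Matrix ι ι ℂ →ₗ[ℂ] B) :
    Matrix (Fin m × ι) (Fin m × ι) ℂ →ₗ[ℂ] Matrix (Fin m) (Fin m) B where
  toFun x := Matrix.of fun p q => φ (blk x p q)
  map_add' X Y := by
    ext p q
    simp only [Matrix.of_apply, Matrix.add_apply, ← map_add]
    congr 1
  map_smul' c X := by
    ext p q
    simp only [Matrix.of_apply, Matrix.smul_apply, ← map_smul, RingHom.id_apply]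
    congr 1

theorem ampPhi_apply (φ : Matrix ι ι ℂ →ₗ[ℂ] B) (x : Matrix (Fin m × ι) (Fin m × ι) ℂ)
    (p q : Fin m) : ampPhi φ x p q = φ (blk x p q) := rfl

theorem ampPsi_apply (ψ : B →ₗ[ℂ] Matrix ι ι ℂ) (X : Matrix (Fin m) (Fin m) B) (P Q : Fin m × ι) :
    ampPsi ψ X P Q = ψ (X P.1 Q.1) P.2 Q.2 := rfl

theorem blk_mul (x y : Matrix (Fin m × ι) (Fin m × ι) ℂ) (p q : Fin m) :
    blk (x * y) p q = ∑ r, blk x p r * blk y r q := by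
  ext i j
  simp only [blk, Matrix.of_apply, Matrix.sum_apply, Matrix.mul_apply, Fintype.sum_prod_type]

theorem blk_star (x : Matrix (Fin m × ι) (Fin m × ι) ℂ) (p q : Fin m) :
    blk (star x) p q = star (blk x q p) := rfl

theorem blk_one (p q : Fin m) : blk (1 : Matrix (Fin m × ι) (Fin m × ι) ℂ) p q =
    if p = q then 1 else 0 := by
  ext i j
  by_cases h : p = q
  · subst h; simp [blk, Matrix.one_apply]
  · simp [blk, h]

theorem blk_sum {L : Type*} [Fintype L] (x : L → Matrix (Fin m × ι) (Fin m × ι) ℂ) (p q : Fin m) :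
    blk (∑ l, x l) p q = ∑ l, blk (x l) p q := by
  ext i j
  simp [blk, Matrix.sum_apply]

theorem cp_ampPhi {φ : Matrix ι ι ℂ →ₗ[ℂ] B} (h : IsCompletelyPositive φ) :
    IsCompletelyPositive (ampPhi (m := m) φ) := by
  refine cp_of_gram_mat _ fun k w => ?_
  obtain ⟨v, hv⟩ := h.gram (L := Fin k × Fin m) (m := Fin k × Fin m)
    (fun l P => blk (w l.1 P.1) l.2 P.2)
  refine ⟨Fin k × Fin m, inferInstance, fun l P p => v l (P, p), fun P Q p q => ?_⟩
  rw [← hv (P, p) (Q, q), ampPhi_apply, blk_sum]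
  simp only [blk_mul, blk_star, Fintype.sum_prod_type]

theorem cp_ampPsi {ψ : B →ₗ[ℂ] Matrix ι ι ℂ} (h : IsCompletelyPositive ψ) :
    IsCompletelyPositive (ampPsi (m := m) ψ) := by
  refine cp_of_gram_mat _ fun k w => ?_
  obtain ⟨v, hv⟩ := h.gram (L := Fin k × Fin m) (m := Fin k × Fin m)
    (fun l P => w l.1 P.1 l.2 P.2)
  refine ⟨(Fin k × Fin m) × ι, inferInstance, fun l P p => v l.1 (P, p.1) l.2 p.2,
    fun P Q p q => ?_⟩
  have e : (∑ l, star (w l P) * w l Q) p.1 q.1 =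
      ∑ l : Fin k × Fin m, star (w l.1 P l.2 p.1) * w l.1 Q l.2 q.1 := by
    rw [Matrix.sum_apply, Fintype.sum_prod_type]
    rfl
  rw [ampPsi_apply, e, hv (P, p.1) (Q, q.1), Matrix.sum_apply, Fintype.sum_prod_type (α₁ := Fin k × Fin m)]
  rfl

def diagHom (R : Type*) [CStarAlgebra R] (m : ℕ) : R →⋆ₐ[ℂ] Matrix (Fin m) (Fin m) R where
  toFun x := Matrix.diagonal fun _ => x
  map_one' := by simp
  map_mul' x y := by simp
  map_zero' := by simp
  map_add' x y := by simp
  commutes' c := by ext i j; simp [Matrix.diagonal, Matrix.algebraMap_matrix_apply]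
  map_star' x := by simp [Matrix.star_eq_conjTranspose, Matrix.diagonal_conjTranspose]

def kronHom (ι : Type) [Fintype ι] [DecidableEq ι] (m : ℕ) :
    Matrix ι ι ℂ →⋆ₐ[ℂ] Matrix (Fin m × ι) (Fin m × ι) ℂ where
  toFun x := Matrix.kronecker 1 x
  map_one' := by simp
  map_mul' x y := by simp [← Matrix.mul_kronecker_mul]
  map_zero' := by simp
  map_add' x y := by simp [Matrix.kronecker_add]
  commutes' c := by
    simp [Algebra.algebraMap_eq_smul_one, Matrix.kronecker_smul]
  map_star' x := by simp [Matrix.star_eq_conjTranspose, Matrix.conjTranspose_kronecker]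

def singleHom (R : Type*) [CStarAlgebra R] (m : ℕ) (i : Fin m) :
    R →⋆ₙₐ[ℂ] Matrix (Fin m) (Fin m) R where
  toFun x := Matrix.single i i x
  map_smul' c x := by simp [Matrix.smul_single]
  map_mul' x y := by simp
  map_zero' := by simp
  map_add' x y := by simp [Matrix.single_add]
  map_star' x := by simp [Matrix.star_eq_conjTranspose]

theorem cm_norm_le {D : Type} [CStarAlgebra D] (e : D ≃⋆ₐ[ℂ] Matrix (Fin m) (Fin m) B) (d : D) :
    ‖d‖ ≤ ∑ i, ∑ j, ‖e d i j‖ := by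
  have hs : ∀ i j (b : B), ‖e.symm (Matrix.single i j b)‖ ≤ ‖b‖ := by
    intro i j b
    let J : B →⋆ₙₐ[ℂ] D := (e.symm : Matrix (Fin m) (Fin m) B →⋆ₙₐ[ℂ] D).comp (singleHom B m j)
    have h1 : star (e.symm (Matrix.single i j b)) * e.symm (Matrix.single i j b) =
        J (star b * b) := by
      change _ = e.symm (Matrix.single j j (star b * b))
      rw [← map_star, ← map_mul]
      simp [Matrix.star_eq_conjTranspose]
    have h2 : ‖J (star b * b)‖ ≤ ‖star b * b‖ := NonUnitalStarAlgHom.norm_apply_le J _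
    rw [← h1, CStarRing.norm_star_mul_self, CStarRing.norm_star_mul_self] at h2
    nlinarith [norm_nonneg b, norm_nonneg (e.symm (Matrix.single i j b))]
  have e1 : d = ∑ i, ∑ j, e.symm (Matrix.single i j (e d i j)) := by
    simp only [← map_sum]
    rw [← Matrix.matrix_eq_sum_single (e d)]
    exact (e.symm_apply_apply d).symm
  conv_lhs => rw [e1]
  refine (norm_sum_le _ _).trans (Finset.sum_le_sum fun i _ => ?_)
  exact (norm_sum_le _ _).trans (Finset.sum_le_sum fun j _ => hs i j _)

theorem ampPhi_one (φ : Matrix ι ι ℂ →ₗ[ℂ] B) : ampPhi (m := m) φ 1 = diagHom B m (φ 1) := by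
  ext p q
  rw [ampPhi_apply, blk_one]
  by_cases h : p = q
  · subst h; simp [diagHom]
  · simp [diagHom, h]

theorem ampPsi_one (ψ : B →ₗ[ℂ] Matrix ι ι ℂ) : ampPsi (m := m) ψ 1 = kronHom ι m (ψ 1) := by
  ext P Q
  rw [ampPsi_apply]
  by_cases h : P.1 = Q.1
  · simp [kronHom, h, Matrix.one_apply]
  · simp [kronHom, h]

theorem ND.matrix {n : ℕ} (hB : ND n B) {D : Type} [CStarAlgebra D]
    (e : D ≃⋆ₐ[ℂ] Matrix (Fin m) (Fin m) B) : ND n D := by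
  classical
  letI := CStarAlgebra.spectralOrder B
  haveI := CStarAlgebra.spectralOrderedRing B
  intro S ε hε
  obtain ⟨K, _, c, ι, i, j, ψ, φ, hψ, hn, ho, hS⟩ :=
    hB (S.biUnion fun X => Finset.univ.image fun p : Fin m × Fin m => e X p.1 p.2)
      (ε / (m * m + 1)) (by positivity)
  let E : D →ₗ[ℂ] Matrix (Fin m) (Fin m) B := e.toAlgEquiv.toLinearMap
  let E' : Matrix (Fin m) (Fin m) B →ₗ[ℂ] D := e.symm.toAlgEquiv.toLinearMap
  have hE : IsCompletelyPositive E := cp_of_hom _ (fun x y => map_mul e x y) (fun x => map_star e x)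
  have hE' : IsCompletelyPositive E' :=
    cp_of_hom _ (fun x y => map_mul e.symm x y) (fun x => map_star e.symm x)
  have hdm : ∀ k x y, ampPhi (m := m) (φ k) x * ampPhi (φ k) y =
      ampPhi (φ k) 1 * ampPhi (φ k) (x * y) := by
    intro k x y
    rw [ampPhi_one]
    ext p q
    simp only [diagHom, StarAlgHom.coe_mk', AlgHom.coe_mk, RingHom.coe_mk, MonoidHom.coe_mk,
      OneHom.coe_mk, Matrix.diagonal_mul, ampPhi_apply, blk_mul, map_sum, Finset.mul_sum]
    rw [Matrix.mul_apply]
    exact Finset.sum_congr rfl fun r _ => ho.mul k _ _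
  refine ⟨K, inferInstance, c, fun k => Fin m × ι k, inferInstance, inferInstance,
    fun k => ampPsi (ψ k) ∘ₗ E, fun k => E' ∘ₗ ampPhi (φ k), fun k => (cp_ampPsi (hψ k)).comp hE,
    fun k => ?_, ⟨fun k => hE'.comp (cp_ampPhi (ho.cp k)), ?_, ?_, ?_⟩, ?_⟩
  · change ‖ampPsi (ψ k) (e 1)‖ ≤ 1
    rw [map_one, ampPsi_one]
    exact (NonUnitalStarAlgHom.norm_apply_le (kronHom (ι k) m) _).trans (hn k)
  · intro k x y
    change e.symm (ampPhi (φ k) x) * e.symm (ampPhi (φ k) y) =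
      e.symm (ampPhi (φ k) 1) * e.symm (ampPhi (φ k) (x * y))
    rw [← map_mul, hdm, map_mul]
  · intro k
    let J : B →⋆ₐ[ℂ] D := (e.symm : Matrix (Fin m) (Fin m) B →⋆ₐ[ℂ] D).comp (diagHom B m)
    have e1 : e.symm (ampPhi (φ k) 1) = J (φ k 1) := congrArg e.symm (ampPhi_one _)
    exact (congrArg norm e1).le.trans ((NonUnitalStarAlgHom.norm_apply_le J _).trans (ho.norm k))
  · intro k l hkl hc
    change e.symm (ampPhi (φ k) 1) * e.symm (ampPhi (φ l) 1) = 0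
    rw [← map_mul, ampPhi_one, ampPhi_one, ← map_mul, ho.orth k l hkl hc, map_zero, map_zero]
  · intro X hX
    have hle : ‖∑ k, e.symm (ampPhi (φ k) (ampPsi (ψ k) (e X))) - X‖ ≤
        ∑ i : Fin m, ∑ j : Fin m, ε / (m * m + 1) := by
      refine (cm_norm_le e _).trans (Finset.sum_le_sum fun p _ => Finset.sum_le_sum fun q _ => ?_)
      have := hS (e X p q) (Finset.mem_biUnion.2 ⟨X, hX, Finset.mem_image.2 ⟨(p, q),
        Finset.mem_univ _, rfl⟩⟩)
      refine le_trans (le_of_eq ?_) this.le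
      congr 1
      simp only [map_sub, map_sum, StarAlgEquiv.apply_symm_apply, Matrix.sub_apply,
        Matrix.sum_apply]
      rfl
    refine lt_of_le_of_lt hle ?_
    simp only [Finset.sum_const, Finset.card_univ, Fintype.card_fin, nsmul_eq_mul]
    rw [← mul_assoc, mul_div_assoc', div_lt_iff₀ (by positivity)]
    nlinarith

end Mat

theorem FinSat.nd {n : ℕ} {B : CStarAlg} (h : FinSat (nucClass n) B) : ND n B.carrier := by
  induction h with
  | base h => exact h.2.nd
  | iso _ h ih => exact h.elim fun e => ih.of_equiv e
  | sum _ _ h ih1 ih2 => exact h.elim fun e => (ih1.prod ih2).of_equiv e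
  | matrix k _ h ih => exact h.elim fun e => ih.matrix e
  | corner p _ _ hp hps h ih =>
    obtain ⟨I, hI, hI1, hr⟩ := h
    exact ih.of_corner hp hps I hI hI1 hr

end

section
set_option linter.style.haveILetI false
set_option linter.unusedSectionVars false
open scoped ComplexOrder Matrix.Norms.L2Operator
open Filter Topology

theorem proj_fun : ∃ f : ℝ → ℝ, Continuous f ∧ ∀ (x η : ℝ), |x * x - x| ≤ η → η < 3 / 16 →
    f x * f x = f x ∧ |f x - x| ≤ 4 * η := by
  refine ⟨fun t => max 0 (min 1 (2 * t - 1 / 2)), by fun_prop, fun x η h hη => ?_⟩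
  obtain ⟨h1, h2⟩ := abs_le.1 h
  rcases le_or_gt x (1 / 4) with hx | hx
  · have e : max 0 (min 1 (2 * x - 1 / 2)) = 0 :=
      max_eq_left ((min_le_right _ _).trans (by linarith))
    simp only [e]
    refine ⟨by simp, abs_le.2 ⟨?_, ?_⟩⟩
    · nlinarith
    · nlinarith
  · rcases le_or_gt (3 / 4) x with hx' | hx'
    · have e : max 0 (min 1 (2 * x - 1 / 2)) = 1 := by
        rw [min_eq_left (by linarith), max_eq_right zero_le_one]
      simp only [e]
      refine ⟨by simp, abs_le.2 ⟨?_, ?_⟩⟩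
      · nlinarith
      · nlinarith
    · exfalso; nlinarith

theorem exists_proj {A : Type*} [CStarAlgebra A] {y : A} (hy : star y = y) {η : ℝ}
    (h : ‖y * y - y‖ ≤ η) (hη : η < 3 / 16) : ∃ p : A, p * p = p ∧ star p = p ∧ ‖p - y‖ ≤ 4 * η := by
  obtain ⟨f, hf, hfx⟩ := proj_fun
  have hsa : IsSelfAdjoint y := hy
  have hη0 : 0 ≤ η := (norm_nonneg _).trans h
  have e0 : cfc (fun x : ℝ => x * x - x) y = y * y - y := by
    rw [cfc_sub (fun x : ℝ => x * x) (fun x => x) y, cfc_mul (fun x : ℝ => x) (fun x => x) y,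
      cfc_id' ℝ y]
  have hs : ∀ x ∈ spectrum ℝ y, |x * x - x| ≤ η := by
    intro x hx
    have := norm_apply_le_norm_cfc (fun x : ℝ => x * x - x) y hx
    rw [e0] at this
    exact this.trans h
  refine ⟨cfc f y, ?_, (cfc_predicate (R := ℝ) (p := IsSelfAdjoint) f y), ?_⟩
  · rw [← cfc_mul f f y]
    exact cfc_congr fun x hx => (hfx x η (hs x hx) hη).1
  · have e1 : cfc (fun x => f x - x) y = cfc f y - y := by
      rw [cfc_sub f (fun x => x) y, cfc_id' ℝ y]
    rw [← e1]
    exact norm_cfc_le (by positivity) fun x hx => (hfx x η (hs x hx) hη).2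

theorem isqrt_fun : ∃ f : ℝ → ℝ, Continuous f ∧ ∀ x δ : ℝ, |x - 1| ≤ δ → δ ≤ 1 / 2 →
    f x * f x * x = 1 ∧ |f x - 1| ≤ 2 * δ := by
  refine ⟨fun x => (Real.sqrt (max x (1 / 4)))⁻¹, ?_, fun x δ h hδ => ?_⟩
  · refine Continuous.inv₀ (by fun_prop) fun x => ?_
    exact (Real.sqrt_pos.2 (lt_of_lt_of_le (by norm_num) (le_max_right _ _))).ne'
  · obtain ⟨h1, h2⟩ := abs_le.1 h
    have e : max x (1 / 4) = x := max_eq_left (by linarith)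
    simp only [e]
    have hx : 0 < x := by linarith
    set r := Real.sqrt x with hr
    have hr2 : r * r = x := Real.mul_self_sqrt hx.le
    have hr0 : 1 / 2 ≤ r := Real.le_sqrt_of_sq_le (by linarith)
    refine ⟨by rw [← hr2]; field_simp, ?_⟩
    have hi : r⁻¹ ≤ 2 := by
      rw [inv_le_comm₀ (by linarith) (by norm_num)]; linarith
    have e2 : r⁻¹ - 1 = r⁻¹ * (1 - r) := by field_simp
    have hb : |1 - r| ≤ δ := by
      rw [abs_le]; constructor <;> nlinarith
    rw [e2, abs_mul, abs_of_nonneg (by positivity : 0 ≤ r⁻¹)]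
    exact mul_le_mul hi hb (abs_nonneg _) (by norm_num)

section Low
variable {G A : Type*} [Group G] [Fintype G] [CStarAlgebra A] {α : G → (A →⋆ₐ[ℂ] A)}

theorem alpha_norm (α : G → (A →⋆ₐ[ℂ] A)) (g : G) (x : A) : ‖α g x‖ ≤ ‖x‖ :=
  NonUnitalStarAlgHom.norm_apply_le (α g) x

theorem sum_alpha (hact : IsGroupAction α) (h : G) (x : A) :
    α h (∑ g, α g x) = ∑ g, α g x := by
  rw [map_sum]
  simp only [hact.2]
  exact Fintype.sum_equiv (Equiv.mulLeft h) _ _ fun g => rfl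

/-- near-orthogonality -/
theorem near_orth {q : G → A} (hq : ∀ g, q g * q g = q g) (hqs : ∀ g, star (q g) = q g) {δ : ℝ}
    (hδ : ‖∑ g, q g - 1‖ ≤ δ) {g h : G} (hgh : g ≠ h) : ‖q h * q g‖ ^ 2 ≤ δ := by
  classical
  letI := CStarAlgebra.spectralOrder A
  haveI := CStarAlgebra.spectralOrderedRing A
  have hpos : ∀ k, 0 ≤ q g * q k * q g := fun k => by
    have : q g * q k * q g = star (q k * q g) * (q k * q g) := by
      rw [star_mul, hqs, hqs, mul_assoc, mul_assoc, ← mul_assoc (q k) (q k), hq]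
    rw [this]; exact star_mul_self_nonneg _
  have e : q g * (∑ k, q k - 1) * q g = ∑ k ∈ Finset.univ.erase g, q g * q k * q g := by
    have : ∑ k, q k = q g + ∑ k ∈ Finset.univ.erase g, q k :=
      (Finset.add_sum_erase _ _ (Finset.mem_univ g)).symm
    rw [this, mul_sub, mul_add, sub_mul, add_mul, mul_one, hq, hq, Finset.mul_sum, Finset.sum_mul]
    abel
  have hle : q g * q h * q g ≤ q g * (∑ k, q k - 1) * q g := by
    rw [e]
    exact Finset.single_le_sum (f := fun k => q g * q k * q g) (fun k _ => hpos k)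
      (Finset.mem_erase.2 ⟨hgh.symm, Finset.mem_univ _⟩)
  have h1 := CStarAlgebra.norm_le_norm_of_nonneg_of_le (hpos h) hle
  have h2 : ‖q h * q g‖ ^ 2 = ‖q g * q h * q g‖ := by
    rw [sq, ← CStarRing.norm_star_mul_self, star_mul, hqs, hqs, mul_assoc, mul_assoc,
      ← mul_assoc (q h) (q h), hq]
  rw [h2]
  refine h1.trans (le_trans ?_ hδ)
  have n1 := proj_norm (hq g) (hqs g)
  calc ‖q g * (∑ k, q k - 1) * q g‖ ≤ ‖q g‖ * ‖∑ k, q k - 1‖ * ‖q g‖ :=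
        (norm_mul_le _ _).trans (mul_le_mul_of_nonneg_right (norm_mul_le _ _) (norm_nonneg _))
    _ ≤ 1 * ‖∑ k, q k - 1‖ * 1 := by gcongr
    _ = _ := by ring

open Classical in
theorem lowdin_orth {q : G → A} (hq : ∀ g, q g * q g = q g) {t : A} (ht : t * ∑ g, q g = 1)
    {r : ℝ} (hr : ∀ g h, g ≠ h → ‖q h * q g‖ ≤ r) (hr1 : Fintype.card G * r < 1) (g h : G) :
    q g * t * q h = if g = h then q g else 0 := by
  let c : G → A := fun h => q g * t * q h - if g = h then q g else 0
  have hsum : ∑ h, c h = 0 := by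
    simp only [c, Finset.sum_sub_distrib, ← Finset.mul_sum, mul_assoc, ht, mul_one]
    simp
  have hc : ∀ h, c h * q h = c h := by
    intro h
    simp only [c, sub_mul, mul_assoc, hq]
    split_ifs with hgh
    · rw [hgh, hq]
    · simp
  have hk : ∀ k, ‖c k‖ ≤ r * ∑ h, ‖c h‖ := by
    intro k
    have e : c k = - ∑ h ∈ Finset.univ.erase k, c h * (q h * q k) := by
      have h0 : ∑ h, c h * q k = 0 := by rw [← Finset.sum_mul, hsum, zero_mul]
      rw [← Finset.add_sum_erase _ _ (Finset.mem_univ k), hc] at h0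
      rw [eq_neg_of_add_eq_zero_left h0]
      congr 1
      refine Finset.sum_congr rfl fun h _ => ?_
      rw [← mul_assoc, hc]
    calc ‖c k‖ = ‖∑ h ∈ Finset.univ.erase k, c h * (q h * q k)‖ := by rw [e, norm_neg]
      _ ≤ ∑ h ∈ Finset.univ.erase k, ‖c h‖ * r := by
        refine (norm_sum_le _ _).trans (Finset.sum_le_sum fun h hh => ?_)
        refine (norm_mul_le _ _).trans (mul_le_mul_of_nonneg_left ?_ (norm_nonneg _))
        exact hr k h (Finset.ne_of_mem_erase hh).symm
      _ ≤ ∑ h, ‖c h‖ * r := by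
        by_cases hr0 : 0 ≤ r
        · exact Finset.sum_le_sum_of_subset_of_nonneg (Finset.erase_subset _ _)
            fun _ _ _ => mul_nonneg (norm_nonneg _) hr0
        · have : ∀ h, h = k := fun h => by
            by_contra hne
            exact hr0 ((norm_nonneg _).trans (hr h k hne))
          have hz : c k = 0 := by
            have : Finset.univ = {k} := by ext x; simp [this x]
            rwa [this, Finset.sum_singleton] at hsum
          have hz' : ∀ h, c h = 0 := fun h => by rw [this h, hz]
          simp [hz']
      _ = _ := by rw [← Finset.sum_mul, mul_comm]
  have hM : ∑ h, ‖c h‖ ≤ Fintype.card G * (r * ∑ h, ‖c h‖) := by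
    refine (Finset.sum_le_sum fun k _ => hk k).trans ?_
    simp
  have hM0 : ∑ h, ‖c h‖ = 0 := by
    have : 0 ≤ ∑ h, ‖c h‖ := Finset.sum_nonneg fun _ _ => norm_nonneg _
    nlinarith
  have := (Finset.sum_eq_zero_iff_of_nonneg fun h _ => norm_nonneg (c h)).1 hM0 h (Finset.mem_univ _)
  exact sub_eq_zero.1 (norm_eq_zero.1 this)

open Classical in
theorem lowdin (hact : IsGroupAction α) {p : A} (hp : p * p = p) (hps : star p = p) {δ : ℝ}
    (hδ : ‖∑ g, α g p - 1‖ ≤ δ) (hδ1 : δ ≤ 1 / 2) (hδ2 : Fintype.card G * Real.sqrt δ < 1) :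
    ∃ e : A, e * e = e ∧ star e = e ∧ (∀ g h, g ≠ h → α g e * α h e = 0) ∧ ∑ g, α g e = 1 ∧
      ‖e - p‖ ≤ 6 * δ := by
  obtain ⟨f, hf, hfx⟩ := isqrt_fun
  have hq : ∀ g, α g p * α g p = α g p := fun g => by rw [← map_mul, hp]
  have hqs : ∀ g, star (α g p) = α g p := fun g => by rw [← map_star, hps]
  set s := ∑ g, α g p with hs
  have hsa : IsSelfAdjoint s := by
    rw [isSelfAdjoint_iff, hs, star_sum]; simp only [hqs]
  have hδ0 : 0 ≤ δ := (norm_nonneg _).trans hδ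
  have e0 : cfc (fun x : ℝ => x - 1) s = s - 1 := by
    rw [cfc_sub (fun x : ℝ => x) (fun _ => 1) s, cfc_id' ℝ s, cfc_const_one ℝ s]
  have hsp : ∀ x ∈ spectrum ℝ s, |x - 1| ≤ δ := by
    intro x hx
    have := norm_apply_le_norm_cfc (fun x : ℝ => x - 1) s hx
    rw [e0] at this
    exact this.trans hδ
  set u := cfc f s with hu
  have hus : star u = u := cfc_predicate (R := ℝ) (p := IsSelfAdjoint) f s
  have huus : u * u * s = 1 := by
    have : cfc (fun x => f x * f x * x) s = u * u * s := by
      rw [cfc_mul (fun x => f x * f x) (fun x => x) s, cfc_mul f f s, cfc_id' ℝ s]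
    rw [← this, ← cfc_const_one ℝ s]
    exact cfc_congr fun x hx => (hfx x δ (hsp x hx) hδ1).1
  have hcomm : Commute u s := (Commute.refl s).cfc_real f
  have hu1 : ‖u - 1‖ ≤ 2 * δ := by
    have : cfc (fun x => f x - 1) s = u - 1 := by
      rw [cfc_sub f (fun _ => 1) s, cfc_const_one ℝ s]
    rw [← this]
    exact norm_cfc_le (by positivity) fun x hx => (hfx x δ (hsp x hx) hδ1).2
  have hau : ∀ g, α g u = u := by
    intro g
    have hc : Continuous (α g) := AddMonoidHomClass.continuous_of_bound (α g) 1 fun x => by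
      rw [one_mul]; exact alpha_norm α g x
    rw [hu, StarAlgHomClass.map_cfc (α g) f s (hf := hf.continuousOn) (hφ := hc) (ha := hsa)
      (hφa := hsa.map (α g)), hs, sum_alpha hact]
  have horth : ∀ g h, α g p * (u * u) * α h p = if g = h then α g p else 0 := by
    refine lowdin_orth hq huus (r := Real.sqrt δ) (fun g h hgh => ?_) hδ2
    exact Real.le_sqrt_of_sq_le (near_orth hq hqs hδ hgh)
  have hae : ∀ g, α g (u * p * u) = u * α g p * u := fun g => by
    rw [map_mul, map_mul, hau]
  have hee : ∀ g h, α g (u * p * u) * α h (u * p * u) = u * (if g = h then α g p else 0) * u := by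
    intro g h
    rw [← horth, hae, hae]; simp only [mul_assoc]
  refine ⟨u * p * u, ?_, ?_, ?_, ?_, ?_⟩
  · have := hee 1 1
    rwa [if_pos rfl, hact.1, hact.1] at this
  · rw [star_mul, star_mul, hus, hps, mul_assoc]
  · intro g h hgh
    rw [hee, if_neg hgh]; simp
  · simp only [hae]
    rw [← Finset.sum_mul, ← Finset.mul_sum, ← hs, mul_assoc, ← hcomm.eq, ← mul_assoc, huus]
  · have n1 := proj_norm hp hps
    have n2 : ‖u‖ ≤ 2 := by
      calc ‖u‖ = ‖(u - 1) + 1‖ := by rw [sub_add_cancel]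
        _ ≤ ‖u - 1‖ + ‖(1 : A)‖ := norm_add_le _ _
        _ ≤ 2 * δ + 1 := add_le_add hu1 (norm_one_le' A)
        _ ≤ 2 := by linarith
    have e1 : u * p * u - p = (u - 1) * p * u + p * (u - 1) := by noncomm_ring
    rw [e1]
    calc _ ≤ ‖u - 1‖ * ‖p‖ * ‖u‖ + ‖p‖ * ‖u - 1‖ := (norm_add_le _ _).trans
          (add_le_add ((norm_mul_le _ _).trans
            (mul_le_mul_of_nonneg_right (norm_mul_le _ _) (norm_nonneg _))) (norm_mul_le _ _))
      _ ≤ (2 * δ) * 1 * 2 + 1 * (2 * δ) := by gcongr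
      _ = _ := by ring

end Low

end

section
set_option linter.style.haveILetI false
set_option linter.unusedSectionVars false
open scoped ComplexOrder Matrix.Norms.L2Operator
open Filter Topology

section Rok
variable {G A : Type*} [Group G] [Fintype G] [CStarAlgebra A] {α : G → (A →⋆ₐ[ℂ] A)}

theorem comm_pert {x y a : A} {θ : ℝ} (h : ‖y - x‖ ≤ θ) :
    ‖y * a - a * y‖ ≤ ‖x * a - a * x‖ + 2 * θ * ‖a‖ := by
  have e : y * a - a * y = (x * a - a * x) + ((y - x) * a - a * (y - x)) := by noncomm_ring
  rw [e]
  refine (norm_add_le _ _).trans (add_le_add le_rfl ?_)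
  calc _ ≤ ‖(y - x) * a‖ + ‖a * (y - x)‖ := norm_sub_le _ _
    _ ≤ ‖y - x‖ * ‖a‖ + ‖a‖ * ‖y - x‖ := add_le_add (norm_mul_le _ _) (norm_mul_le _ _)
    _ ≤ θ * ‖a‖ + ‖a‖ * θ := by gcongr
    _ = _ := by ring

theorem sum_pert (α : G → (A →⋆ₐ[ℂ] A)) {x y : A} {θ : ℝ} (h : ‖y - x‖ ≤ θ) :
    ‖∑ g, α g y - 1‖ ≤ ‖∑ g, α g x - 1‖ + Fintype.card G * θ := by
  have e : ∑ g, α g y - 1 = (∑ g, α g x - 1) + ∑ g, α g (y - x) := by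
    simp only [map_sub, Finset.sum_sub_distrib]; abel
  rw [e]
  refine (norm_add_le _ _).trans (add_le_add le_rfl ?_)
  refine (norm_sum_le _ _).trans ((Finset.sum_le_sum fun g _ =>
    (alpha_norm α g _).trans h).trans ?_)
  simp

theorem rok1 (hRok : ActionHasRokhlin α) (S : Finset A) {η : ℝ} (hη : 0 < η) :
    ∃ y : A, star y = y ∧ ‖y * y - y‖ ≤ η ∧ ‖∑ g, α g y - 1‖ ≤ η ∧
      ∀ a ∈ S, ‖y * a - a * y‖ ≤ η := by
  obtain ⟨e, hM, h1, h2, h3, h4, h5⟩ := hRok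
  obtain ⟨M, hM⟩ := hM 1
  have hM0 : 0 ≤ M := (norm_nonneg _).trans (hM 0)
  set N : ℝ := ((Fintype.card G : ℕ) : ℝ) with hN
  have hN0 : 0 ≤ N := by positivity
  set C : ℝ := ∑ a ∈ S, ‖a‖ with hC
  have hC0 : 0 ≤ C := Finset.sum_nonneg fun _ _ => norm_nonneg _
  have hCa : ∀ a ∈ S, ‖a‖ ≤ C := fun a ha =>
    Finset.single_le_sum (f := fun a => ‖a‖) (fun _ _ => norm_nonneg _) ha
  set T : ℝ := 2 * M + 2 * N + 2 * C + 4 with hT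
  have hT0 : 0 < T := by positivity
  set θ : ℝ := min 1 (η / T) with hθ
  have hθ0 : 0 < θ := lt_min one_pos (by positivity)
  have hθ1 : θ ≤ 1 := min_le_left _ _
  have hθT : T * θ ≤ η := by
    calc T * θ ≤ T * (η / T) := mul_le_mul_of_nonneg_left (min_le_right _ _) hT0.le
      _ = η := by field_simp
  have ev : ∀ᶠ k in atTop, ‖e 1 k * e 1 k - e 1 k‖ < θ ∧ ‖star (e 1 k) - e 1 k‖ < θ ∧
      (∀ a ∈ S, ‖e 1 k * a - a * e 1 k‖ < θ) ∧ ‖(∑ g : G, e g k) - 1‖ < θ ∧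
      ∀ g, ‖α g (e 1 k) - e (g * 1) k‖ < θ := by
    refine ((h1 1).eventually_lt_const hθ0).and (((h2 1).eventually_lt_const hθ0).and
      (Filter.Eventually.and ?_ ((h4.eventually_lt_const hθ0).and ?_)))
    · rw [Filter.eventually_all_finset]
      exact fun a _ => (h3 1 a).eventually_lt_const hθ0
    · rw [Filter.eventually_all]
      exact fun g => (h5 g 1).eventually_lt_const hθ0
  obtain ⟨k, k1, k2, k3, k4, k5⟩ := ev.exists
  have hMk := hM k
  set x := e 1 k with hx
  let d : A := (1 / 2 : ℂ) • (star x - x)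
  have hd : ‖d‖ ≤ θ := by
    simp only [d]
    rw [norm_smul]
    norm_num
    linarith [norm_nonneg (star x - x)]
  have hyx : ‖(x + d) - x‖ ≤ θ := by rwa [add_sub_cancel_left]
  refine ⟨x + d, ?_, ?_, ?_, ?_⟩
  · have : x + d = (1 / 2 : ℂ) • (star x + x) := by
      simp only [d]
      module
    rw [this, star_smul, star_add, star_star, add_comm]
    simp
  · have e1 : (x + d) * (x + d) - (x + d) = (x * x - x) + (x * d + d * x + d * d - d) := by
      noncomm_ring
    rw [e1]
    calc _ ≤ ‖x * x - x‖ + (‖x * d‖ + ‖d * x‖ + ‖d * d‖ + ‖d‖) := by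
          refine (norm_add_le _ _).trans (add_le_add le_rfl ((norm_sub_le _ _).trans
            (add_le_add ((norm_add_le _ _).trans (add_le_add (norm_add_le _ _) le_rfl)) le_rfl)))
      _ ≤ θ + (M * θ + θ * M + θ * θ + θ) := by
          gcongr
          · exact (norm_mul_le _ _).trans (mul_le_mul hMk hd (norm_nonneg _) hM0)
          · exact (norm_mul_le _ _).trans (mul_le_mul hd hMk (norm_nonneg _) hθ0.le)
          · exact (norm_mul_le _ _).trans (mul_le_mul hd hd (norm_nonneg _) hθ0.le)
      _ ≤ T * θ := by
          rw [hT]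
          nlinarith [mul_nonneg hN0 hθ0.le, mul_nonneg hC0 hθ0.le]
      _ ≤ η := hθT
  · refine (sum_pert α hyx).trans (le_trans ?_ hθT)
    have e2 : ∑ g, α g x - 1 = (∑ g, e g k - 1) + ∑ g, (α g x - e (g * 1) k) := by
      simp only [mul_one, Finset.sum_sub_distrib]; abel
    have : ‖∑ g, α g x - 1‖ ≤ θ + N * θ := by
      rw [e2]
      refine (norm_add_le _ _).trans (add_le_add k4.le ((norm_sum_le _ _).trans ?_))
      refine (Finset.sum_le_sum fun g _ => (k5 g).le).trans ?_
      simp [hN]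
    rw [hT]
    nlinarith [mul_nonneg hM0 hθ0.le, mul_nonneg hC0 hθ0.le]
  · intro a ha
    refine (comm_pert hyx).trans (le_trans ?_ hθT)
    have := k3 a ha
    have h6 := mul_le_mul_of_nonneg_left (hCa a ha) hθ0.le
    rw [hT]
    nlinarith [mul_nonneg hM0 hθ0.le, mul_nonneg hN0 hθ0.le]

theorem rok2 (hact : IsGroupAction α) (hRok : ActionHasRokhlin α) (S : Finset A) {ε : ℝ}
    (hε : 0 < ε) : ∃ e : A, e * e = e ∧ star e = e ∧ (∀ g h, g ≠ h → α g e * α h e = 0) ∧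
      ∑ g, α g e = 1 ∧ ∀ a ∈ S, ‖e * a - a * e‖ ≤ ε := by
  set N : ℝ := ((Fintype.card G : ℕ) : ℝ) with hN
  have hN0 : 0 ≤ N := by positivity
  set C : ℝ := ∑ a ∈ S, ‖a‖ with hC
  have hC0 : 0 ≤ C := Finset.sum_nonneg fun _ _ => norm_nonneg _
  have hCa : ∀ a ∈ S, ‖a‖ ≤ C := fun a ha =>
    Finset.single_le_sum (f := fun a => ‖a‖) (fun _ _ => norm_nonneg _) ha
  -- target perturbation
  obtain ⟨δ, hδ0, hδ1, hδ2, hδ3⟩ : ∃ δ : ℝ, 0 < δ ∧ δ ≤ 1 / 2 ∧ N * Real.sqrt δ < 1 ∧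
      (1 + 20 * C) * δ ≤ ε := by
    refine ⟨min (1 / 2) (min ((1 / (N + 1)) ^ 2) (ε / (1 + 20 * C))), ?_, min_le_left _ _, ?_, ?_⟩
    · refine lt_min (by norm_num) (lt_min (by positivity) (by positivity))
    · have : Real.sqrt (min (1 / 2) (min ((1 / (N + 1)) ^ 2) (ε / (1 + 20 * C)))) ≤ 1 / (N + 1) := by
        rw [Real.sqrt_le_left (by positivity)]
        exact (min_le_right _ _).trans (min_le_left _ _)
      refine lt_of_le_of_lt (mul_le_mul_of_nonneg_left this hN0) ?_
      rw [mul_one_div, div_lt_one (by positivity)]; linarith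
    · calc _ ≤ (1 + 20 * C) * (ε / (1 + 20 * C)) := mul_le_mul_of_nonneg_left
            ((min_le_right _ _).trans (min_le_right _ _)) (by positivity)
        _ = ε := by field_simp
  set η : ℝ := min (1 / 16) (δ / (4 * N + 1)) with hη
  have hη0 : 0 < η := lt_min (by norm_num) (by positivity)
  have hηδ : (4 * N + 1) * η ≤ δ := by
    calc _ ≤ (4 * N + 1) * (δ / (4 * N + 1)) :=
          mul_le_mul_of_nonneg_left (min_le_right _ _) (by positivity)
      _ = δ := by field_simp
  have hηδ' : η ≤ δ := by nlinarith [mul_nonneg hN0 hη0.le]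
  obtain ⟨y, hy, hyy, hys, hya⟩ := rok1 hRok S hη0
  obtain ⟨p, hp, hps, hpy⟩ := exists_proj hy hyy (lt_of_le_of_lt (min_le_left _ _) (by norm_num))
  have hsum : ‖∑ g, α g p - 1‖ ≤ δ := by
    refine (sum_pert α hpy).trans (le_trans ?_ hηδ)
    rw [← hN]; linarith
  obtain ⟨e, he, hes, ho, h1, hep⟩ := lowdin hact hp hps hsum hδ1 hδ2
  refine ⟨e, he, hes, ho, h1, fun a ha => ?_⟩
  have hey : ‖e - y‖ ≤ 10 * δ := by
    calc ‖e - y‖ = ‖(e - p) + (p - y)‖ := by congr 1; abel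
      _ ≤ 6 * δ + 4 * η := (norm_add_le _ _).trans (add_le_add hep hpy)
      _ ≤ _ := by linarith
  refine (comm_pert hey).trans (le_trans ?_ hδ3)
  have h6 := mul_le_mul_of_nonneg_left (hCa a ha) hδ0.le
  have h7 := hya a ha
  nlinarith

end Rok

theorem rok_main {n : ℕ} {A G : Type} [CStarAlgebra A] [Group G] [Fintype G]
    {α : G → (A →⋆ₐ[ℂ] A)} (hact : IsGroupAction α) (hRok : ActionHasRokhlin α) (hA : ND n A)
    (hcl : IsClosed (fixedPointAlgebra α : Set A)) :
    @ND n (fixedPointAlgebra α) (StarSubalgebra.cstarAlgebra _ (h_closed := hcl)) := by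
  classical
  letI : CStarAlgebra (fixedPointAlgebra α) := StarSubalgebra.cstarAlgebra _ (h_closed := hcl)
  let N : ℝ := ((Fintype.card G : ℕ) : ℝ)
  have hN0 : 0 ≤ N := by positivity
  refine lemmaCL fun S ε hε => ?_
  obtain ⟨e, he, hes, ho, h1, hS⟩ := rok2 hact hRok (S.image (Subtype.val : fixedPointAlgebra α → A))
    (ε := ε / (N + 1)) (by positivity)
  have hel : ∀ z, e * (e * z) = e * z := fun z => by rw [← mul_assoc, he]
  let θ : A →ₗ[ℂ] A := ∑ g, (α g).toAlgHom.toLinearMap ∘ₗ conjL e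
  have hθ : ∀ x, θ x = ∑ g, α g (e * x * e) := by
    intro x
    simp only [θ, LinearMap.sum_apply, LinearMap.comp_apply, conjL_apply, hes]
    rfl
  have hθcp : IsCompletelyPositive θ := cp_sum _ fun g _ =>
    (cp_of_hom _ (fun x y => map_mul (α g) x y) (fun x => map_star (α g) x)).comp (cp_conjL e)
  have hfix : ∀ x, θ x ∈ fixedPointAlgebra α := by
    intro x h
    rw [hθ, sum_alpha hact]
  let σ : A →ₗ[ℂ] fixedPointAlgebra α :=
    { toFun := fun x => ⟨θ x, hfix x⟩
      map_add' := fun x y => Subtype.ext (map_add θ x y)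
      map_smul' := fun c x => Subtype.ext (map_smul θ c x) }
  have hσ : ∀ x, ((σ x : fixedPointAlgebra α) : A) = θ x := fun x => rfl
  let I : fixedPointAlgebra α →⋆ₙₐ[ℂ] A := ((fixedPointAlgebra α).subtype : _ →⋆ₙₐ[ℂ] A)
  have hI : Function.Injective I := Subtype.val_injective
  refine ⟨A, inferInstance, e, σ, hA, he, hes, cp_of_inj I hI σ θ hθcp (fun x => rfl), ?_, ?_, ?_, ?_⟩
  · apply Subtype.ext
    rw [hσ, hθ]
    simp only [mul_one, he, h1]
    rfl
  · intro x
    apply Subtype.ext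
    rw [hσ, hσ, hθ, hθ]
    simp only [mul_assoc, hel, he]
  · intro x y
    apply Subtype.ext
    change _ = θ x * θ y
    rw [hσ, hθ, hθ, hθ, Finset.sum_mul]
    refine Finset.sum_congr rfl fun g _ => ?_
    rw [Finset.mul_sum, Finset.sum_eq_single g]
    · rw [← map_mul]
      simp only [mul_assoc, hel, he]
    · intro h _ hhg
      rw [map_mul, map_mul (α h), map_mul (α h), mul_assoc, mul_assoc, ← mul_assoc (α g e),
        ho g h hhg.symm, zero_mul, mul_zero]
    · simp
  · intro a ha
    refine ⟨(a : A), ?_⟩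
    have hfa : ∀ g, α g (a : A) = a := a.2
    have e1 : θ (a : A) - a = ∑ g, α g (e * ((a : A) * e - e * a)) := by
      have : (a : A) = ∑ g, α g (e * a) := by
        simp only [map_mul, hfa]
        rw [← Finset.sum_mul, h1, one_mul]
      have e3 : ∀ g, α g (e * ((a : A) * e - e * a)) = α g (e * a * e) - α g (e * a) := by
        intro g
        rw [← map_sub, mul_sub, hel, mul_assoc]
      simp only [e3, Finset.sum_sub_distrib]
      rw [← this, hθ]
    have e2 : ‖σ a - a‖ = ‖θ (a : A) - a‖ := rfl
    rw [e2, e1]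
    have hb := hS (a : A) (Finset.mem_image_of_mem Subtype.val ha)
    have hen := proj_norm he hes
    calc _ ≤ ∑ _g : G, ε / (N + 1) := by
          refine (norm_sum_le _ _).trans (Finset.sum_le_sum fun g _ => (alpha_norm α g _).trans ?_)
          calc _ ≤ ‖e‖ * ‖(a : A) * e - e * a‖ := norm_mul_le _ _
            _ ≤ 1 * (ε / (N + 1)) := by
              rw [norm_sub_rev] at hb
              gcongr
            _ = _ := one_mul _
      _ = N * (ε / (N + 1)) := by simp [N]
      _ < ε := by
        rw [mul_div_assoc', div_lt_iff₀ (by positivity)]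
        nlinarith

theorem final {n : ℕ} {A G : Type} [CStarAlgebra A] (hA : IsUnitalLocalAlg (nucClass n) A)
    [Group G] [Fintype G] {α : G → (A →⋆ₐ[ℂ] A)} (hact : IsGroupAction α)
    (hRok : ActionHasRokhlin α) : NuclearDimensionLE n (fixedPointAlgebra α) := by
  have hcl : IsClosed (fixedPointAlgebra α : Set A) := by
    have : (fixedPointAlgebra α : Set A) = ⋂ g, {a : A | α g a = a} := by
      ext a; simp only [Set.mem_iInter]; rfl
    rw [this]
    refine isClosed_iInter fun g => isClosed_eq ?_ continuous_id
    exact AddMonoidHomClass.continuous_of_bound (α g) 1 fun x => by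
      rw [one_mul]; exact alpha_norm α g x
  have hND : ND n A := ND.of_hom fun S ε hε => by
    obtain ⟨B, hB, φ, hφ⟩ := hA S ε hε
    refine ⟨B.carrier, inferInstance, φ, hB.nd, fun a ha => ?_⟩
    obtain ⟨b, hb⟩ := hφ a ha
    exact ⟨b, by rwa [norm_sub_rev]⟩
  letI : CStarAlgebra (fixedPointAlgebra α) := StarSubalgebra.cstarAlgebra _ (h_closed := hcl)
  exact (rok_main hact hRok hND hcl).nuclearDimensionLE

end

open TopologicalSpace in
theorem stmt3 (n : ℕ) (A : Type) [CStarAlgebra A] [SeparableSpace A]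
    (hA : IsUnitalLocalAlg (nucClass n) A)
    (G : Type) [Group G] [Fintype G] (α : G → (A →⋆ₐ[ℂ] A))
    (hact : IsGroupAction α) (hRok : ActionHasRokhlin α) :
    NuclearDimensionLE n (fixedPointAlgebra α) := by
  exact final hA hact hRok

end
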